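/- arXiv:2101.00366 — 2 statements merged into one kernel-verified Lean document; each statement's English description precedes it below -/
import Mathlib

section
/- Suppose ∫₀^∞ u^{δ/2} π_τ(u) du < ∞ for some δ ∈ (0.00162, 0.22176). Then there exist γ* = γ*(δ) ∈ (0,1) and b* < ∞ such that for every x ∈ (0,∞)^p, ∫_{(0,∞)^p} k_c(x, x′) Ṽ(x′) dx′ ≤ γ* Ṽ(x) + b*, where Ṽ(x) = Σ_{j=1}^p x_j^{−δ/2}. -/
open Matrix MeasureTheory

/-- The Inverse-Gamma(α, β) density `u ↦ β^α Γ(α)⁻¹ u^{−α−1} e^{−β/u}`. -/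
noncomputable def igDens (α β u : ℝ) : ℝ :=
  β ^ α * (Real.Gamma α)⁻¹ * u ^ (-α - 1) * Real.exp (-β / u)

/-- `A_c(t, x) = XᵀX + c⁻²I + (t Λ_x)⁻¹` with `Λ_x = diag(x₁, …, x_p)`. -/
noncomputable def regA (n p : ℕ) (X : Matrix (Fin n) (Fin p) ℝ)
    (c t : ℝ) (x : Fin p → ℝ) : Matrix (Fin p) (Fin p) ℝ :=
  X.transpose * X + (c ^ 2)⁻¹ • (1 : Matrix (Fin p) (Fin p) ℝ)
    + (t • Matrix.diagonal x)⁻¹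

/-- `r_c(t, x) = yᵀ(I − X A_c(t,x)⁻¹ Xᵀ)y/2 + b`. -/
noncomputable def regR (n p : ℕ) (X : Matrix (Fin n) (Fin p) ℝ)
    (y : Fin n → ℝ) (b c t : ℝ) (x : Fin p → ℝ) : ℝ :=
  y ⬝ᵥ ((1 - X * (regA n p X c t x)⁻¹ * X.transpose).mulVec y) / 2 + b

/-- The `N_p(μ, s A⁻¹)` density at `β`:
`(2π s)^{−p/2} det(A)^{1/2} exp(−(β−μ)ᵀA(β−μ)/(2s))`. -/
noncomputable def gaussDens (p : ℕ) (A : Matrix (Fin p) (Fin p) ℝ)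
    (μ : Fin p → ℝ) (s : ℝ) (β : Fin p → ℝ) : ℝ :=
  (2 * Real.pi * s) ^ (-(p : ℝ) / 2) * A.det ^ ((1 : ℝ) / 2) *
    Real.exp (-((β - μ) ⬝ᵥ A.mulVec (β - μ)) / (2 * s))

/-- The unnormalized conditional posterior density of a squared local
shrinkage parameter in the regularized Horseshoe:
`u ↦ (c⁻² + (tu)⁻¹)^{1/2} u^{−3/2} exp(−r/u)`. -/
noncomputable def regLamKernel (c t r u : ℝ) : ℝ :=
  ((c ^ 2)⁻¹ + (t * u)⁻¹) ^ ((1 : ℝ) / 2) * u ^ (-(3 : ℝ) / 2) *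
    Real.exp (-r / u)

/-- The normalized conditional posterior density of a squared local shrinkage
parameter in the regularized Horseshoe. -/
noncomputable def regLamDens (c t r u : ℝ) : ℝ :=
  regLamKernel c t r u / ∫ v in Set.Ioi (0 : ℝ), regLamKernel c t r v

/-- The unnormalized conditional posterior density of `τ² = t` given the
squared local shrinkage parameters `x` in the regularized Horseshoe:
`f_x(t) = det(A_c(t,x))^{−1/2} ∏ⱼ (c⁻² + (t xⱼ)⁻¹)^{1/2}
  r_c(t,x)^{−(a+n/2)} π_τ(t)`. -/
noncomputable def regTauDens (n p : ℕ) (X : Matrix (Fin n) (Fin p) ℝ)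
    (y : Fin n → ℝ) (a b c : ℝ) (πτ : ℝ → ℝ) (x : Fin p → ℝ) (t : ℝ) : ℝ :=
  ((regA n p X c t x).det) ^ (-(1 / 2 : ℝ)) *
    (∏ j, ((c ^ 2)⁻¹ + (t * x j)⁻¹) ^ ((1 : ℝ) / 2)) *
    regR n p X y b c t x ^ (-(a + (n : ℝ) / 2)) * πτ t

/-- The Markov transition density `k_c(x, x′)` of the marginal λ-chain of the
two-block regularized Horseshoe Gibbs sampler of Piironen and Vehtari, as an
iterated integral over `t ∈ (0,∞)`, `ν ∈ (0,∞)^p`, `σ² = s ∈ (0,∞)`,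
`β ∈ ℝ^p`. -/
noncomputable def regMTD (n p : ℕ) (X : Matrix (Fin n) (Fin p) ℝ)
    (y : Fin n → ℝ) (a b c : ℝ) (πτ : ℝ → ℝ) (x x' : Fin p → ℝ) : ℝ :=
  ∫ t in Set.Ioi (0 : ℝ),
    (∫ ν in Set.univ.pi (fun _ : Fin p => Set.Ioi (0 : ℝ)),
      (∫ s in Set.Ioi (0 : ℝ),
        (∫ β : Fin p → ℝ,
          (∏ j, regLamDens c t ((ν j)⁻¹ + (β j) ^ 2 / (2 * s * t)) (x' j)) *
            gaussDens p (regA n p X c t x)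
              ((regA n p X c t x)⁻¹.mulVec (X.transpose.mulVec y)) s β) *
          igDens (a + (n : ℝ) / 2) (regR n p X y b c t x) s) *
        ∏ j, igDens 1 (1 + (x j)⁻¹) (ν j)) *
    (regTauDens n p X y a b c πτ x t /
      ∫ u in Set.Ioi (0 : ℝ), regTauDens n p X y a b c πτ x u)



lemma lintegral_pi_prod : ∀ {n : ℕ} (μ : Fin n → Measure ℝ) [∀ i, SigmaFinite (μ i)]
    (f : Fin n → ℝ → ENNReal) (_ : ∀ i, Measurable (f i)),
    ∫⁻ x : Fin n → ℝ, ∏ i, f i (x i) ∂(Measure.pi μ) = ∏ i, ∫⁻ x, f i x ∂(μ i) := by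
  intro n
  induction n with
  | zero => intro μ _ f hf; simp
  | succ n ih =>
    intro μ _ f hf
    calc
        _ = ∫⁻ x : ℝ × (Fin n → ℝ),
            f 0 x.1 * ∏ i : Fin n, f (Fin.succ i) (x.2 i)
            ∂((μ 0).prod (Measure.pi (fun i ↦ μ i.succ))) := by
          have hm : Measurable fun x : Fin (n+1) → ℝ => ∏ i, f i (x i) := by
            refine Finset.measurable_prod _ fun i _ => (hf i).comp (measurable_pi_apply i)
          rw [← ((measurePreserving_piFinSuccAbove μ 0).symm).lintegral_comp hm]
          simp_rw [MeasurableEquiv.piFinSuccAbove_symm_apply, Fin.insertNthEquiv,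
            Fin.prod_univ_succ, Fin.insertNth_zero, Equiv.coe_fn_mk, Fin.cons_succ,
            Fin.zero_succAbove, Fin.cons_zero]
          rfl
        _ = (∫⁻ x, f 0 x ∂μ 0)
            * ∏ i : Fin n, ∫⁻ (x : ℝ), f (Fin.succ i) x ∂(μ i.succ) := by
          rw [← ih _ _ (fun i => hf _)]
          refine lintegral_prod_mul (f := f 0) (g := fun x : Fin n → ℝ => ∏ i, f (Fin.succ i) (x i))
            (hf 0).aemeasurable ?_
          exact (Finset.measurable_prod _ fun i _ =>
            (hf _).comp (measurable_pi_apply i)).aemeasurable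
        _ = ∏ i, ∫⁻ x, f i x ∂(μ i) := by rw [Fin.prod_univ_succ]

lemma lintegral_orthant_prod {n : ℕ} 
    (f : Fin n → ℝ → ENNReal) (hf : ∀ i, Measurable (f i)) :
    ∫⁻ x in Set.univ.pi (fun _ : Fin n => Set.Ioi (0 : ℝ)), ∏ i, f i (x i)
      = ∏ i, ∫⁻ x in Set.Ioi (0:ℝ), f i x := by
  rw [volume_pi, Measure.restrict_pi_pi, lintegral_pi_prod _ _ hf]

lemma swap1 {T X : Type*} [MeasurableSpace T] [MeasurableSpace X] (μ : Measure T) (ρ : Measure X)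
    [SFinite μ] [SFinite ρ] (F : T → X → ENNReal) (hF : Measurable (fun z : T × X => F z.1 z.2))
    (w : T → ENNReal) (hw : AEMeasurable w μ) (E : X → ENNReal) (hE : Measurable E) :
    ∫⁻ x, (∫⁻ t, F t x * w t ∂μ) * E x ∂ρ = ∫⁻ t, (∫⁻ x, F t x * E x ∂ρ) * w t ∂μ := by
  have h1 : ∀ x, AEMeasurable (fun t => F t x * w t) μ := fun x =>
    (hF.comp (measurable_id.prodMk measurable_const)).aemeasurable.mul hw
  have h2 : ∀ t, Measurable (fun x => F t x * E x) := fun t =>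
    (hF.comp (measurable_const.prodMk measurable_id)).mul hE
  calc _ = ∫⁻ x, (∫⁻ t, F t x * w t * E x ∂μ) ∂ρ := by
        refine lintegral_congr fun x => ?_
        rw [lintegral_mul_const'' _ (h1 x)]
    _ = ∫⁻ t, (∫⁻ x, F t x * w t * E x ∂ρ) ∂μ := by
        refine lintegral_lintegral_swap ?_
        refine AEMeasurable.mul (AEMeasurable.mul ?_ ?_) ?_
        · exact (hF.comp measurable_swap).aemeasurable
        · exact hw.comp_snd
        · exact (hE.comp measurable_fst).aemeasurable
    _ = _ := by
        refine lintegral_congr fun t => ?_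
        rw [← lintegral_mul_const _ (h2 t)]
        refine lintegral_congr fun x => by ring

/-- Gaussian integral for `BᵀB`. -/
lemma gauss_int {p : ℕ} (A : Matrix (Fin p) (Fin p) ℝ) (hA : A.PosDef) (s : ℝ) (hs : 0 < s)
    (μ : Fin p → ℝ) :
    ∫⁻ β : Fin p → ℝ, ENNReal.ofReal (Real.exp (-((β - μ) ⬝ᵥ A.mulVec (β - μ)) / (2 * s)))
      = ENNReal.ofReal ((2 * Real.pi * s) ^ ((p : ℝ) / 2) * A.det ^ (-(1 / 2 : ℝ))) := by
  rw [lintegral_sub_right_eq_self (μ := volume)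
    (fun β : Fin p → ℝ => ENNReal.ofReal (Real.exp (-(β ⬝ᵥ A.mulVec β) / (2 * s)))) μ]
  obtain ⟨B, hB⟩ : ∃ B : Matrix (Fin p) (Fin p) ℝ, A = Bᵀ * B := by
    open scoped MatrixOrder in
    obtain ⟨B, hB⟩ := (CStarAlgebra.nonneg_iff_eq_star_mul_self (a := A)).1 hA.posSemidef.nonneg
    exact ⟨B, hB⟩
  have hdet : A.det = B.det ^ 2 := by rw [hB, det_mul, det_transpose, sq]
  have hB0 : B.det ≠ 0 := by
    intro h; have := hA.det_pos; rw [hdet, h] at this; simp at this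
  have hq : ∀ β : Fin p → ℝ, β ⬝ᵥ A.mulVec β = ∑ i, (B.mulVec β i) ^ 2 := by
    intro β
    rw [hB, ← mulVec_mulVec, dotProduct_mulVec, vecMul_transpose]
    simp [dotProduct, sq]
  have hmap := Real.map_matrix_volume_pi_eq_smul_volume_pi hB0
  set g : (Fin p → ℝ) → ENNReal :=
    fun z => ∏ i, ENNReal.ofReal (Real.exp (-(1 / (2*s)) * (z i) ^ 2)) with hg
  have hgm : Measurable g := by
    refine Finset.measurable_prod _ fun i _ => ?_
    fun_prop
  have h1 : ∀ β : Fin p → ℝ, ENNReal.ofReal (Real.exp (-(β ⬝ᵥ A.mulVec β) / (2 * s)))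
      = g (toLin' B β) := by
    intro β
    rw [hg, hq]
    simp only [toLin'_apply]
    rw [← ENNReal.ofReal_prod_of_nonneg (fun i _ => (Real.exp_pos _).le), ← Real.exp_sum]
    congr 2
    rw [← Finset.mul_sum]; ring
  simp_rw [h1]
  have hBm : Measurable (toLin' B) := (LinearMap.continuous_of_finiteDimensional _).measurable
  rw [← lintegral_map hgm hBm, hmap, lintegral_smul_measure, hg, volume_pi]
  simp only []
  rw [lintegral_pi_prod _ (fun _ z => ENNReal.ofReal (Real.exp (-(1 / (2*s)) * z ^ 2)))]
  · have : ∫⁻ x : ℝ, ENNReal.ofReal (Real.exp (-(1 / (2*s)) * x ^ 2)) 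
        = ENNReal.ofReal ((2 * Real.pi * s) ^ (1 / 2 : ℝ)) := by
      rw [← ofReal_integral_eq_lintegral_ofReal (integrable_exp_neg_mul_sq (by positivity))
        (Filter.Eventually.of_forall fun x => (Real.exp_pos _).le), integral_gaussian,
        Real.sqrt_eq_rpow]
      congr 2
      field_simp
    simp only [this, Finset.prod_const, Finset.card_univ, Fintype.card_fin, smul_eq_mul]
    rw [← ENNReal.ofReal_pow (by positivity), ← ENNReal.ofReal_mul (by positivity)]
    congr 1
    rw [← Real.rpow_natCast, ← Real.rpow_mul (by positivity), mul_comm]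
    congr 1
    · congr 1; ring
    · rw [hdet, abs_inv, ← sq_abs, ← Real.rpow_natCast, ← Real.rpow_mul (abs_nonneg _)]
      norm_num
      rw [Real.rpow_neg_one]
  · intro i; fun_prop


lemma regA_eq (n p : ℕ) (X : Matrix (Fin n) (Fin p) ℝ)
    (c t : ℝ) (x : Fin p → ℝ) (ht : 0 < t) (hx : ∀ j, 0 < x j) :
    regA n p X c t x = Xᵀ * X + Matrix.diagonal (fun j => (c ^ 2)⁻¹ + (t * x j)⁻¹) := by
  have h : (t • Matrix.diagonal x)⁻¹ = Matrix.diagonal (fun j => (t * x j)⁻¹) := by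
    apply Matrix.inv_eq_right_inv
    rw [Matrix.smul_mul, Matrix.diagonal_mul_diagonal, ← Matrix.diagonal_smul,
      ← Matrix.diagonal_one]
    congr 1
    funext j
    have := hx j
    simp only [Pi.smul_apply, smul_eq_mul]
    field_simp
  unfold regA
  rw [h, add_assoc]
  congr 1
  rw [← Matrix.diagonal_one, ← Matrix.diagonal_smul, Matrix.diagonal_add]
  congr 1
  funext j
  simp

lemma xtx_psd {n p : ℕ} (X : Matrix (Fin n) (Fin p) ℝ) : (Xᵀ * X).PosSemidef := by
  have := Matrix.posSemidef_conjTranspose_mul_self X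
  simpa [Matrix.conjTranspose_eq_transpose_of_trivial] using this

lemma regA_posDef (n p : ℕ) (X : Matrix (Fin n) (Fin p) ℝ)
    (c t : ℝ) (hc : c ≠ 0) (x : Fin p → ℝ) (ht : 0 < t) (hx : ∀ j, 0 < x j) :
    (regA n p X c t x).PosDef := by
  rw [regA_eq n p X c t x ht hx]
  refine Matrix.PosDef.posSemidef_add (xtx_psd X) (Matrix.PosDef.diagonal fun j => ?_)
  have := hx j
  positivity

lemma symm_dot {p : ℕ} {A : Matrix (Fin p) (Fin p) ℝ} (hA : A.PosDef) (u v : Fin p → ℝ) :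
    u ⬝ᵥ A.mulVec v = v ⬝ᵥ A.mulVec u := by
  have h : Aᵀ = A := by
    have := hA.isHermitian
    rwa [Matrix.IsHermitian, Matrix.conjTranspose_eq_transpose_of_trivial] at this
  rw [dotProduct_mulVec, dotProduct_comm, ← mulVec_transpose, h]

lemma quad_nonneg {p : ℕ} {A : Matrix (Fin p) (Fin p) ℝ} (hA : A.PosSemidef) (u : Fin p → ℝ) :
    0 ≤ u ⬝ᵥ A.mulVec u := by
  simpa using hA.dotProduct_mulVec_nonneg u

lemma inv_diag_ge {p : ℕ} {A : Matrix (Fin p) (Fin p) ℝ} (hA : A.PosDef) (j : Fin p) :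
    (A j j)⁻¹ ≤ A⁻¹ j j := by
  have hu : IsUnit A.det := hA.det_pos.ne'.isUnit
  have hjj : 0 < A j j := hA.diag_pos
  set e : Fin p → ℝ := Pi.single j 1 with he
  set z := A⁻¹.mulVec e with hz
  have hAz : A.mulVec z = e := by rw [hz, mulVec_mulVec, mul_nonsing_inv _ hu, one_mulVec]
  have h := quad_nonneg hA.posSemidef (z - (A j j)⁻¹ • e)
  have h1 : z ⬝ᵥ e = A⁻¹ j j := by simp [hz, he]
  have h2 : e ⬝ᵥ e = 1 := by simp [he]
  have h3 : e ⬝ᵥ A.mulVec e = A j j := by simp [he]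
  have h4 : z ⬝ᵥ A.mulVec e = 1 := by rw [symm_dot hA, hAz, h2]
  have h5 : e ⬝ᵥ z = A⁻¹ j j := by rw [dotProduct_comm, h1]
  rw [mulVec_sub, mulVec_smul, hAz, sub_dotProduct, dotProduct_sub, dotProduct_sub, smul_dotProduct,
    dotProduct_smul, smul_dotProduct, dotProduct_smul, h1, h2, h3, h4] at h
  simp only [smul_eq_mul, mul_one] at h
  rw [inv_mul_cancel₀ hjj.ne'] at h
  linarith

lemma gauss_tilt {p : ℕ} (A : Matrix (Fin p) (Fin p) ℝ) (hA : A.PosDef) (s : ℝ) (hs : 0 < s)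
    (μ : Fin p → ℝ) (κ : ℝ) (hκ : 0 ≤ κ) (j : Fin p) :
    ∫⁻ β : Fin p → ℝ, ENNReal.ofReal (Real.exp (-(κ * (β j) ^ 2) / (2 * s))) *
      ENNReal.ofReal (gaussDens p A μ s β) ≤
      ENNReal.ofReal ((1 + κ * A⁻¹ j j) ^ (-(1 / 2 : ℝ))) := by
  set e : Fin p → ℝ := Pi.single j 1 with he
  have hu : IsUnit A.det := hA.det_pos.ne'.isUnit
  set A' : Matrix (Fin p) (Fin p) ℝ := A + κ • vecMulVec e e with hA'
  have hpd : A'.PosDef := by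
    refine hA.add_posSemidef (Matrix.PosSemidef.smul ?_ hκ)
    simpa using Matrix.posSemidef_vecMulVec_self_star e
  have hu' : IsUnit A'.det := hpd.det_pos.ne'.isUnit
  have hV : 0 ≤ A⁻¹ j j := le_trans (by have : 0 < A j j := hA.diag_pos
                                        positivity) (inv_diag_ge hA j)
  have hdet : A'.det = A.det * (1 + κ * A⁻¹ j j) := by
    have h := Matrix.det_add_replicateCol_mul_replicateRow (ι := Unit) hu (κ • e) e
    have h2 : replicateCol Unit (κ • e) * replicateRow Unit e = κ • vecMulVec e e := by
      rw [← vecMulVec_eq, smul_vecMulVec]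
    rw [h2] at h
    rw [hA', h]
    congr 1
    rw [Matrix.det_unique]
    simp [Matrix.mul_apply, he, Pi.single_apply, mul_comm]
  have hmul : ∀ v, A'.mulVec v = A.mulVec v + (κ * v j) • e := by
    intro v
    rw [hA', add_mulVec, smul_mulVec, vecMulVec_mulVec]
    simp [he, mul_smul]
  set μ' := A'⁻¹.mulVec (A.mulVec μ) with hμ'
  have hAμ : A'.mulVec μ' = A.mulVec μ := by
    rw [hμ', mulVec_mulVec, mul_nonsing_inv _ hu', one_mulVec]
  have hej : ∀ v : Fin p → ℝ, v ⬝ᵥ e = v j := by intro v; simp [he]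
  have hkey : ∀ β : Fin p → ℝ, (β - μ') ⬝ᵥ A'.mulVec (β - μ') ≤
      (β - μ) ⬝ᵥ A.mulVec (β - μ) + κ * (β j) ^ 2 := by
    have hid : ∀ β : Fin p → ℝ, (β - μ) ⬝ᵥ A.mulVec (β - μ) + κ * (β j) ^ 2 =
        (β - μ') ⬝ᵥ A'.mulVec (β - μ') + (μ ⬝ᵥ A.mulVec μ - μ' ⬝ᵥ A.mulVec μ) := by
      intro β
      have e1 := symm_dot hpd μ' β
      rw [hAμ] at e1
      have e2 := symm_dot hA μ β
      have e3 : β ⬝ᵥ A'.mulVec β = β ⬝ᵥ A.mulVec β + κ * (β j) ^ 2 := by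
        rw [hmul, dotProduct_add, dotProduct_smul, hej]; simp; ring
      simp only [mulVec_sub, sub_dotProduct, dotProduct_sub, hAμ]
      linarith
    have hc := hid μ'
    simp only [sub_self, zero_dotProduct, zero_add] at hc
    have hc' : 0 ≤ (μ' - μ) ⬝ᵥ A.mulVec (μ' - μ) + κ * (μ' j) ^ 2 :=
      add_nonneg (quad_nonneg hA.posSemidef _) (by positivity)
    intro β
    have := hid β
    linarith
  set K : ℝ := (2 * Real.pi * s) ^ (-(p : ℝ) / 2) * A.det ^ ((1 : ℝ) / 2) with hK
  have hdp := hA.det_pos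
  have hK0 : 0 ≤ K := by positivity
  calc _ ≤ ∫⁻ β : Fin p → ℝ, ENNReal.ofReal K *
        ENNReal.ofReal (Real.exp (-((β - μ') ⬝ᵥ A'.mulVec (β - μ')) / (2 * s))) := by
        refine lintegral_mono fun β => ?_
        rw [← ENNReal.ofReal_mul (Real.exp_pos _).le, ← ENNReal.ofReal_mul hK0]
        refine ENNReal.ofReal_le_ofReal ?_
        unfold gaussDens
        rw [← hK, mul_left_comm, ← Real.exp_add]
        refine mul_le_mul_of_nonneg_left (Real.exp_le_exp.2 ?_) hK0
        rw [← add_div]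
        refine div_le_div_of_nonneg_right ?_ (by positivity)
        have := hkey β
        linarith
    _ = ENNReal.ofReal K * ENNReal.ofReal ((2 * Real.pi * s) ^ ((p : ℝ) / 2) *
          A'.det ^ (-(1 / 2 : ℝ))) := by
        rw [lintegral_const_mul' _ _ ENNReal.ofReal_ne_top, gauss_int A' hpd s hs μ']
    _ ≤ _ := by
        rw [← ENNReal.ofReal_mul hK0]
        refine ENNReal.ofReal_le_ofReal (le_of_eq ?_)
        rw [hdet, Real.mul_rpow hdp.le (by positivity), hK]
        have h1 : (2 * Real.pi * s) ^ (-(p : ℝ) / 2) * (2 * Real.pi * s) ^ ((p : ℝ) / 2) = 1 := by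
          rw [← Real.rpow_add (by positivity), neg_div, neg_add_cancel, Real.rpow_zero]
        have h2 : A.det ^ ((1 : ℝ) / 2) * A.det ^ (-(1 / 2 : ℝ)) = 1 := by
          rw [← Real.rpow_add hdp, add_neg_cancel, Real.rpow_zero]
        calc _ = ((2 * Real.pi * s) ^ (-(p : ℝ) / 2) * (2 * Real.pi * s) ^ ((p : ℝ) / 2)) *
              (A.det ^ ((1 : ℝ) / 2) * A.det ^ (-(1 / 2 : ℝ))) *
              (1 + κ * A⁻¹ j j) ^ (-(1 / 2 : ℝ)) := by ring
          _ = _ := by rw [h1, h2]; ring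

lemma regR_bounds (n p : ℕ) (X : Matrix (Fin n) (Fin p) ℝ) (y : Fin n → ℝ)
    (b c t : ℝ) (hc : c ≠ 0) (x : Fin p → ℝ) (ht : 0 < t) (hx : ∀ j, 0 < x j) :
    b ≤ regR n p X y b c t x ∧ regR n p X y b c t x ≤ b + y ⬝ᵥ y / 2 := by
  have hA := regA_posDef n p X c t hc x ht hx
  have heq := regA_eq n p X c t x ht hx
  unfold regR
  set A := regA n p X c t x with hAdef
  have hu : IsUnit A.det := hA.det_pos.ne'.isUnit
  set w := A⁻¹.mulVec (Xᵀ.mulVec y) with hw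
  have hAw : A.mulVec w = Xᵀ.mulVec y := by
    rw [hw, mulVec_mulVec, mul_nonsing_inv _ hu, one_mulVec]
  have h0 : y ⬝ᵥ ((1 - X * A⁻¹ * X.transpose).mulVec y) = y ⬝ᵥ y - y ⬝ᵥ X.mulVec w := by
    rw [sub_mulVec, one_mulVec, dotProduct_sub, ← mulVec_mulVec, ← mulVec_mulVec]
  have h1 : w ⬝ᵥ A.mulVec w = y ⬝ᵥ X.mulVec w := by
    rw [hAw, dotProduct_mulVec, vecMul_transpose, dotProduct_comm]
  have h2 : X.mulVec w ⬝ᵥ X.mulVec w ≤ w ⬝ᵥ A.mulVec w := by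
    rw [heq, add_mulVec, dotProduct_add]
    have : w ⬝ᵥ (Xᵀ * X).mulVec w = X.mulVec w ⬝ᵥ X.mulVec w := by
      rw [← mulVec_mulVec, dotProduct_mulVec, vecMul_transpose]
    rw [this]
    have := quad_nonneg (A := Matrix.diagonal (fun j => (c ^ 2)⁻¹ + (t * x j)⁻¹))
      (Matrix.PosSemidef.diagonal (fun j => by have := hx j; simp only [Pi.zero_apply]; positivity)) w
    linarith
  have h3 := quad_nonneg hA.posSemidef w
  have h4 : 0 ≤ (y - X.mulVec w) ⬝ᵥ (y - X.mulVec w) := by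
    have := dotProduct_star_self_nonneg (y - X.mulVec w); simpa using this
  rw [sub_dotProduct, dotProduct_sub, dotProduct_sub, dotProduct_comm (X.mulVec w) y] at h4
  rw [h0]
  constructor <;> linarith

lemma det_lower {p : ℕ} {A D : Matrix (Fin p) (Fin p) ℝ} (hD : D.PosDef) (hA : A.PosDef)
    (h : ∀ v, v ⬝ᵥ D.mulVec v ≤ v ⬝ᵥ A.mulVec v) :
    A.det ^ (-(1 / 2 : ℝ)) ≤ D.det ^ (-(1 / 2 : ℝ)) := by
  have h1 := gauss_int A hA 1 one_pos 0
  have h2 := gauss_int D hD 1 one_pos 0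
  have h3 := hA.det_pos
  have h4 := hD.det_pos
  have : ENNReal.ofReal ((2 * Real.pi * 1) ^ ((p : ℝ) / 2) * A.det ^ (-(1 / 2 : ℝ))) ≤
      ENNReal.ofReal ((2 * Real.pi * 1) ^ ((p : ℝ) / 2) * D.det ^ (-(1 / 2 : ℝ))) := by
    rw [← h1, ← h2]
    refine lintegral_mono fun β => ENNReal.ofReal_le_ofReal (Real.exp_le_exp.2 ?_)
    have := h (β - 0)
    refine div_le_div_of_nonneg_right ?_ (by positivity)
    linarith
  rw [ENNReal.ofReal_le_ofReal_iff (by positivity)] at this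
  exact le_of_mul_le_mul_left this (by positivity)

lemma det_upper (n p : ℕ) (X : Matrix (Fin n) (Fin p) ℝ) (c : ℝ) (hc : c ≠ 0) :
    ∃ C : ℝ, 0 < C ∧ ∀ d : Fin p → ℝ, (∀ j, (c ^ 2)⁻¹ ≤ d j) →
      (Xᵀ * X + Matrix.diagonal d).det ≤ C * ∏ j, d j := by
  set M : ℝ := ∑ j, ∑ i, ∑ k, |X i j| * c ^ 2 * |X k j| with hM
  have hM0 : 0 ≤ M := by positivity
  refine ⟨(Nat.factorial n) * (1 + M) ^ n, by positivity, fun d hd => ?_⟩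
  have hc2 : 0 < (c ^ 2)⁻¹ := by positivity
  have hdpos : ∀ j, 0 < d j := fun j => hc2.trans_le (hd j)
  have hfac : Xᵀ * X + Matrix.diagonal d =
      Matrix.diagonal d * (1 + Matrix.diagonal (fun j => (d j)⁻¹) * Xᵀ * X) := by
    rw [mul_add, mul_one, add_comm, ← Matrix.mul_assoc, ← Matrix.mul_assoc,
      Matrix.diagonal_mul_diagonal]
    congr 1
    have : (fun i => d i * (d i)⁻¹) = fun _ => (1:ℝ) := by
      funext i; exact mul_inv_cancel₀ (hdpos i).ne'
    rw [this, Matrix.diagonal_one, Matrix.one_mul]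
  rw [hfac, det_mul, det_diagonal, mul_comm, det_one_add_mul_comm]
  refine mul_le_mul_of_nonneg_right ?_ (Finset.prod_nonneg fun j _ => (hdpos j).le)
  refine (le_abs_self _).trans ?_
  have := Matrix.det_le (abv := AbsoluteValue.abs) (x := 1 + M)
    (A := 1 + X * (Matrix.diagonal (fun j => (d j)⁻¹) * Xᵀ)) ?_
  · simpa using this
  · intro i k
    simp only [AbsoluteValue.abs_apply, Matrix.add_apply]
    refine (abs_add_le _ _).trans (add_le_add ?_ ?_)
    · rw [Matrix.one_apply]; split_ifs <;> simp
    · rw [Matrix.mul_apply]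
      refine (Finset.abs_sum_le_sum_abs _ _).trans ?_
      refine Finset.sum_le_sum fun j _ => ?_
      rw [Matrix.diagonal_mul, transpose_apply, abs_mul, abs_mul]
      have h1 : |(d j)⁻¹| ≤ c ^ 2 := by
        rw [abs_of_pos (inv_pos.2 (hdpos j))]
        exact inv_le_of_inv_le₀ (by positivity) (hd j)
      calc _ ≤ |X i j| * (c ^ 2 * |X k j|) := by gcongr
        _ = |X i j| * c ^ 2 * |X k j| := by ring
        _ ≤ ∑ k, |X i j| * c ^ 2 * |X k j| := 
            Finset.single_le_sum (f := fun k => |X i j| * c ^ 2 * |X k j|)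
              (fun _ _ => by positivity) (Finset.mem_univ k)
        _ ≤ _ := Finset.single_le_sum (f := fun i => ∑ k, |X i j| * c ^ 2 * |X k j|)
              (fun _ _ => by positivity) (Finset.mem_univ i)


lemma lintegral_gamma' {a r : ℝ} (ha : 0 < a) (hr : 0 < r) :
    ∫⁻ q in Set.Ioi (0:ℝ), ENNReal.ofReal (q ^ (a - 1) * Real.exp (-(r * q))) =
      ENNReal.ofReal ((1 / r) ^ a * Real.Gamma a) := by
  have h := Real.integral_rpow_mul_exp_neg_mul_Ioi ha hr
  have hG := Real.Gamma_pos_of_pos ha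
  rw [← h, ofReal_integral_eq_lintegral_ofReal]
  · by_contra hc
    rw [integral_undef hc] at h
    have : 0 < (1 / r) ^ a * Real.Gamma a := by positivity
    linarith
  · refine (ae_restrict_iff' measurableSet_Ioi).2 (Filter.Eventually.of_forall fun q hq => ?_)
    have : (0:ℝ) < q := hq
    simp only [Pi.zero_apply]
    positivity

lemma lintegral_inv_Ioi (f : ℝ → ENNReal) :
    ∫⁻ v in Set.Ioi (0:ℝ), f v = ∫⁻ u in Set.Ioi (0:ℝ), ENNReal.ofReal ((u ^ 2)⁻¹) * f (u⁻¹) := by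
  have him : (fun u : ℝ => u⁻¹) '' Set.Ioi 0 = Set.Ioi 0 := by
    ext v; constructor
    · rintro ⟨u, hu, rfl⟩; exact inv_pos.2 (Set.mem_Ioi.1 hu)
    · intro hv; exact ⟨v⁻¹, Set.mem_Ioi.2 (inv_pos.2 (Set.mem_Ioi.1 hv)), inv_inv v⟩
  have h := lintegral_image_eq_lintegral_abs_deriv_mul (s := Set.Ioi (0:ℝ)) (f := fun u => u⁻¹)
    (f' := fun u => -(u ^ 2)⁻¹) measurableSet_Ioi
    (fun u hu => (hasDerivAt_inv (ne_of_gt hu)).hasDerivWithinAt)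
    (fun u _ v _ h => inv_injective h) f
  rw [him] at h
  rw [h]
  refine lintegral_congr fun u => ?_
  rw [abs_neg, abs_of_nonneg (by positivity)]

lemma lintegral_scale_Ioi (f : ℝ → ENNReal) {k : ℝ} (hk : 0 < k) :
    ∫⁻ v in Set.Ioi (0:ℝ), f v = ∫⁻ u in Set.Ioi (0:ℝ), ENNReal.ofReal k * f (k * u) := by
  have him : (fun u : ℝ => k * u) '' Set.Ioi 0 = Set.Ioi 0 := by
    ext v; constructor
    · rintro ⟨u, hu, rfl⟩; exact mul_pos hk hu
    · intro hv; exact ⟨k⁻¹ * v, mul_pos (inv_pos.2 hk) hv, by simp [hk.ne']⟩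
  have h := lintegral_image_eq_lintegral_abs_deriv_mul (s := Set.Ioi (0:ℝ)) (f := fun u => k * u)
    (f' := fun u => k) measurableSet_Ioi
    (fun u hu => by simpa using ((hasDerivAt_id u).const_mul k).hasDerivWithinAt)
    (fun u _ v _ h => by simpa [hk.ne'] using h) f
  rw [him] at h
  rw [h, abs_of_pos hk]

lemma lintegral_invgamma {a r : ℝ} (ha : 0 < a) (hr : 0 < r) :
    ∫⁻ u in Set.Ioi (0:ℝ), ENNReal.ofReal (u ^ (-a - 1) * Real.exp (-r / u)) =
      ENNReal.ofReal ((1 / r) ^ a * Real.Gamma a) := by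
  rw [← lintegral_gamma' ha hr, lintegral_inv_Ioi]
  refine (setLIntegral_congr_fun measurableSet_Ioi fun u hu => ?_).symm
  have hu : (0:ℝ) < u := hu
  rw [← ENNReal.ofReal_mul (by positivity), ← mul_assoc, div_inv_eq_mul, neg_mul]
  congr 2
  rw [Real.inv_rpow hu.le, ← Real.rpow_neg hu.le, ← Real.rpow_natCast, ← Real.rpow_neg hu.le,
    ← Real.rpow_add hu]
  congr 1
  push_cast; ring

lemma igDens_nonneg {α β u : ℝ} (hα : 0 < α) (hβ : 0 ≤ β) (hu : 0 < u) : 0 ≤ igDens α β u := by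
  unfold igDens
  have := Real.Gamma_pos_of_pos hα
  positivity

lemma lintegral_igDens {α β : ℝ} (hα : 0 < α) (hβ : 0 < β) :
    ∫⁻ u in Set.Ioi (0:ℝ), ENNReal.ofReal (igDens α β u) = 1 := by
  have hG := Real.Gamma_pos_of_pos hα
  have : ∀ u, ENNReal.ofReal (igDens α β u) = ENNReal.ofReal (β ^ α * (Real.Gamma α)⁻¹) *
      ENNReal.ofReal (u ^ (-α - 1) * Real.exp (-β / u)) := by
    intro u
    rw [← ENNReal.ofReal_mul (by positivity)]; unfold igDens; rw [mul_assoc]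
  simp_rw [this]
  rw [lintegral_const_mul' _ _ ENNReal.ofReal_ne_top, lintegral_invgamma hα hβ,
    ← ENNReal.ofReal_mul (by positivity), ← ENNReal.ofReal_one]
  congr 1
  rw [Real.div_rpow zero_le_one hβ.le, Real.one_rpow]
  have : 0 < β ^ α := by positivity
  field_simp

lemma lintegral_igDens_tilt {L q : ℝ} (hL : 0 < L) (hq : 0 ≤ q) :
    ∫⁻ u in Set.Ioi (0:ℝ), ENNReal.ofReal (Real.exp (-q / u)) * ENNReal.ofReal (igDens 1 L u) =
      ENNReal.ofReal (L / (L + q)) := by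
  have : ∀ u, ENNReal.ofReal (Real.exp (-q / u)) * ENNReal.ofReal (igDens 1 L u) =
      ENNReal.ofReal L * ENNReal.ofReal (u ^ (-(1:ℝ) - 1) * Real.exp (-(L + q) / u)) := by
    intro u
    rw [← ENNReal.ofReal_mul (by positivity), ← ENNReal.ofReal_mul (by positivity)]
    unfold igDens
    congr 1
    have : -(L + q) / u = -L / u + -q / u := by ring
    rw [this, Real.exp_add, Real.rpow_one, Real.Gamma_one]; ring
  simp_rw [this]
  rw [lintegral_const_mul' _ _ ENNReal.ofReal_ne_top, lintegral_invgamma one_pos (by positivity),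
    ← ENNReal.ofReal_mul (by positivity)]
  congr 1
  rw [Real.rpow_one, Real.Gamma_one]; ring

lemma regLamKernel_nonneg {c t r u : ℝ} (ht : 0 < t) (hu : 0 < u) : 0 ≤ regLamKernel c t r u := by
  unfold regLamKernel; positivity

lemma regLamDens_nonneg {c t r u : ℝ} (ht : 0 < t) (hu : 0 < u) : 0 ≤ regLamDens c t r u := by
  unfold regLamDens
  exact div_nonneg (regLamKernel_nonneg ht hu)
    (setIntegral_nonneg measurableSet_Ioi fun v hv => regLamKernel_nonneg ht hv)

lemma regLam_norm {c t r : ℝ} (ht : 0 < t) : 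
    (∀ u, regLamDens c t r u = 0) ∨ ∃ Z : ℝ, 0 < Z ∧ (∀ u, regLamDens c t r u =
      Z⁻¹ * regLamKernel c t r u) ∧
      ∫⁻ u in Set.Ioi (0:ℝ), ENNReal.ofReal (regLamKernel c t r u) = ENNReal.ofReal Z := by
  set Z := ∫ v in Set.Ioi (0 : ℝ), regLamKernel c t r v with hZ
  have hZ0 : 0 ≤ Z := setIntegral_nonneg measurableSet_Ioi fun v hv => regLamKernel_nonneg ht hv
  rcases hZ0.eq_or_lt with h | h
  · left; intro u; unfold regLamDens; rw [← hZ, ← h, div_zero]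
  · right
    refine ⟨Z, h, fun u => ?_, ?_⟩
    · unfold regLamDens; rw [← hZ, div_eq_inv_mul]
    · rw [hZ, ofReal_integral_eq_lintegral_ofReal]
      · by_contra hc
        rw [integral_undef hc] at hZ; linarith
      · exact (ae_restrict_iff' measurableSet_Ioi).2 
          (Filter.Eventually.of_forall fun q hq => regLamKernel_nonneg ht hq)

lemma regLam_mass {c t r : ℝ} (ht : 0 < t) :
    ∫⁻ u in Set.Ioi (0:ℝ), ENNReal.ofReal (regLamDens c t r u) ≤ 1 := by
  rcases regLam_norm (c := c) (r := r) ht with h | ⟨Z, hZ, h1, h2⟩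
  · simp [h]
  · simp_rw [h1, ENNReal.ofReal_mul (inv_pos.2 hZ).le]
    rw [lintegral_const_mul' _ _ ENNReal.ofReal_ne_top, h2, ← ENNReal.ofReal_mul (inv_pos.2 hZ).le,
      inv_mul_cancel₀ hZ.ne', ENNReal.ofReal_one]

lemma lintegral_q {s r : ℝ} (hs : 0 < s) (hr : 0 < r) :
    ∫⁻ q in Set.Ioi (0:ℝ), ENNReal.ofReal (s * q ^ (s - 1)) * ENNReal.ofReal (Real.exp (-(r * q))) =
      ENNReal.ofReal ((1 / r) ^ s * Real.Gamma (s + 1)) := by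
  rw [Real.Gamma_add_one hs.ne', mul_left_comm, ENNReal.ofReal_mul hs.le, ← lintegral_gamma' hs hr,
    ← lintegral_const_mul' _ _ ENNReal.ofReal_ne_top]
  refine setLIntegral_congr_fun measurableSet_Ioi fun q hq => ?_
  have hq : (0:ℝ) < q := hq
  rw [← ENNReal.ofReal_mul (by positivity), ← ENNReal.ofReal_mul (by positivity), mul_assoc]

lemma regLamKernel_meas (c t r : ℝ) : Measurable (regLamKernel c t r) := by
  unfold regLamKernel; fun_prop

lemma regLam_moment {c t r s : ℝ} (ht : 0 < t) (hr : 0 < r) (hs : 0 < s) :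
    ∫⁻ u in Set.Ioi (0:ℝ), ENNReal.ofReal (regLamDens c t r u) * ENNReal.ofReal (u ^ (-s)) ≤
    ∫⁻ q in Set.Ioi (0:ℝ), ENNReal.ofReal (s * q ^ (s - 1)) *
      ENNReal.ofReal (Real.exp (-(r * q))) := by
  rw [lintegral_q hs hr]
  rcases regLam_norm (c := c) (r := r) ht with h | ⟨Z, hZ, h1, h2⟩
  · simp [h]
  have hG := Real.Gamma_pos_of_pos (show 0 < s + 1 by linarith)
  set M : ℝ := (1 / r) ^ s * Real.Gamma (s + 1) with hM
  have hM0 : 0 < M := by positivity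
  set u0 : ℝ := M ^ (-s⁻¹) with hu0
  have hu0p : 0 < u0 := by positivity
  have hu0s : u0 ^ (-s) = M := by
    rw [hu0, ← Real.rpow_mul hM0.le, neg_mul_neg, inv_mul_cancel₀ hs.ne', Real.rpow_one]
  set g : ℝ → ℝ := fun u => ((c ^ 2)⁻¹ * u + t⁻¹) ^ ((1:ℝ) / 2) with hg
  have hgmono : ∀ u v, 0 < u → u ≤ v → g u ≤ g v := by
    intro u v hu huv
    simp only [hg]
    gcongr
  have hg0 : 0 ≤ g u0 := by simp only [hg]; positivity
  have hkg : ∀ u, 0 < u → regLamKernel c t r u = g u * (u ^ (-(1:ℝ) - 1) * Real.exp (-r / u)) := by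
    intro u hu
    unfold regLamKernel
    have e1 : (c ^ 2)⁻¹ + (t * u)⁻¹ = ((c ^ 2)⁻¹ * u + t⁻¹) * u⁻¹ := by field_simp
    rw [e1, Real.mul_rpow (by positivity) (by positivity), Real.inv_rpow hu.le,
      ← Real.rpow_neg hu.le]
    simp only [hg]
    have e2 : u ^ (-(1:ℝ) - 1) = u ^ (-((1:ℝ)/2)) * u ^ (-(3:ℝ)/2) := by
      rw [← Real.rpow_add hu]; norm_num
    rw [e2]; ring
  set w : ℝ → ℝ := fun u => u ^ (-(1:ℝ) - 1) * Real.exp (-r / u) with hw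
  have hwm : Measurable w := by simp only [hw]; fun_prop
  have hcheb : ∀ u, 0 < u → regLamKernel c t r u * u ^ (-s) + g u0 * M * w u ≤
      M * regLamKernel c t r u + g u0 * (u ^ (-s) * w u) := by
    intro u hu
    rw [hkg u hu]
    have hwu : 0 ≤ w u := by simp only [hw]; positivity
    change g u * w u * _ + _ ≤ M * (g u * w u) + _
    have : 0 ≤ (M - u ^ (-s)) * (g u - g u0) := by
      rcases le_total u u0 with h | h
      · apply mul_nonneg_of_nonpos_of_nonpos
        · have := Real.rpow_le_rpow_of_nonpos hu h (show -s ≤ 0 by linarith)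
          linarith
        · have := hgmono u u0 hu h; linarith
      · apply mul_nonneg
        · have := Real.rpow_le_rpow_of_nonpos hu0p h (show -s ≤ 0 by linarith)
          linarith
        · have := hgmono u0 u hu0p h; linarith
    nlinarith [mul_nonneg this hwu]
  have hI0 : ∫⁻ u in Set.Ioi (0:ℝ), ENNReal.ofReal (w u) = ENNReal.ofReal (1 / r) := by
    have := lintegral_invgamma one_pos hr
    rwa [Real.rpow_one, Real.Gamma_one, mul_one] at this
  have hI1 : ∫⁻ u in Set.Ioi (0:ℝ), ENNReal.ofReal (u ^ (-s) * w u) =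
      ENNReal.ofReal (M * (1 / r)) := by
    have := lintegral_invgamma (show 0 < s + 1 by linarith) hr
    rw [hM, mul_right_comm]
    rw [Real.rpow_add (by positivity), Real.rpow_one] at this
    rw [← this]
    refine setLIntegral_congr_fun measurableSet_Ioi fun u hu => ?_
    have hu : (0:ℝ) < u := hu
    simp only [hw]
    rw [← mul_assoc, ← Real.rpow_add hu]
    congr 3; ring
  have hkm := regLamKernel_meas c t r
  have hIntg : (∫⁻ u in Set.Ioi (0:ℝ), ENNReal.ofReal (regLamKernel c t r u * u ^ (-s))) +
      ENNReal.ofReal (g u0 * M * (1 / r)) ≤ ENNReal.ofReal (M * Z) +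
      ENNReal.ofReal (g u0 * M * (1 / r)) := by
    calc _ = ∫⁻ u in Set.Ioi (0:ℝ), (ENNReal.ofReal (regLamKernel c t r u * u ^ (-s)) +
            ENNReal.ofReal (g u0 * M) * ENNReal.ofReal (w u)) := by
          rw [lintegral_add_right _ (by fun_prop), lintegral_const_mul' _ _ ENNReal.ofReal_ne_top, hI0,
            ← ENNReal.ofReal_mul (by positivity)]
      _ ≤ ∫⁻ u in Set.Ioi (0:ℝ), (ENNReal.ofReal M * ENNReal.ofReal (regLamKernel c t r u) +
            ENNReal.ofReal (g u0) * ENNReal.ofReal (u ^ (-s) * w u)) := by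
          refine setLIntegral_mono' measurableSet_Ioi fun u hu => ?_
          have hu : (0:ℝ) < u := hu
          have hk := regLamKernel_nonneg (c := c) (r := r) ht hu
          have hwu : 0 ≤ w u := by simp only [hw]; positivity
          rw [← ENNReal.ofReal_mul (by positivity), ← ENNReal.ofReal_mul (by positivity),
            ← ENNReal.ofReal_mul (by positivity), ← ENNReal.ofReal_add (by positivity)
            (by positivity), ← ENNReal.ofReal_add (by positivity) (by positivity)]
          exact ENNReal.ofReal_le_ofReal (hcheb u hu)
      _ = _ := by
          rw [lintegral_add_right _ (by fun_prop), lintegral_const_mul' _ _ ENNReal.ofReal_ne_top,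
            lintegral_const_mul' _ _ ENNReal.ofReal_ne_top, h2, hI1, ← ENNReal.ofReal_mul hM0.le,
            ← ENNReal.ofReal_mul hg0, mul_assoc (g u0)]
  have hJ := (ENNReal.add_le_add_iff_right ENNReal.ofReal_ne_top).1 hIntg
  calc _ = ∫⁻ u in Set.Ioi (0:ℝ), ENNReal.ofReal Z⁻¹ *
          ENNReal.ofReal (regLamKernel c t r u * u ^ (-s)) := by
        refine setLIntegral_congr_fun measurableSet_Ioi fun u hu => ?_
        have hu : (0:ℝ) < u := hu
        have hk := regLamKernel_nonneg (c := c) (r := r) ht hu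
        rw [h1, ← ENNReal.ofReal_mul (by positivity), ← ENNReal.ofReal_mul (by positivity), mul_assoc]
    _ ≤ ENNReal.ofReal Z⁻¹ * ENNReal.ofReal (M * Z) := by
        rw [lintegral_const_mul' _ _ ENNReal.ofReal_ne_top]; gcongr
    _ = ENNReal.ofReal M := by
        rw [← ENNReal.ofReal_mul (by positivity)]; congr 1; field_simp


lemma I_lt {s : ℝ} (hs : 0 < s) (hs2 : s < 1 / 2) :
    ∫⁻ z in Set.Ioi (0:ℝ), ENNReal.ofReal (s * z ^ (s - 1) * (1 + z) ^ (-(3/2) : ℝ)) < 1 := by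
  set φ : ℝ → ℝ := fun z => s * z ^ (s - 1) * (1 + z) ^ (-(3/2) : ℝ) with hφ
  set ψ : ℝ → ℝ := fun z => (3/2) * (1 + z) ^ (-(5/2) : ℝ) *
    (1 - 2 * s + 2 * s * z ^ (1/2 : ℝ) - z ^ s) with hψ
  set F : ℝ → ℝ := fun z => (z ^ s - (1 - 2 * s)) * (1 + z) ^ (-(3/2) : ℝ) +
    2 * s * (z / (1 + z)) ^ (3/2 : ℝ) with hF
  have hφ0 : ∀ z, 0 < z → 0 ≤ φ z := by intro z hz; simp only [hφ]; positivity
  have hψ1 : ∀ z, 0 < z → z ≠ 1 → 0 < ψ z := by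
    intro z hz hz1
    have h := rpow_one_add_lt_one_add_mul_self (s := z ^ (1/2 : ℝ) - 1) (p := 2 * s)
      (by have : 0 ≤ z ^ (1/2 : ℝ) := by positivity
          linarith) (by
        intro h
        have h' : z ^ (1/2 : ℝ) = 1 := by linarith
        rw [← Real.sqrt_eq_rpow, Real.sqrt_eq_one] at h'
        exact hz1 h') (by linarith) (by linarith)
    rw [add_sub_cancel, ← Real.rpow_mul hz.le] at h
    have e : (1/2 : ℝ) * (2 * s) = s := by ring
    rw [e] at h
    simp only [hψ]
    have : 0 < 1 - 2 * s + 2 * s * z ^ (1/2 : ℝ) - z ^ s := by linarith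
    positivity
  have hψ0 : ∀ z, 0 < z → 0 ≤ ψ z := by
    intro z hz
    by_cases h : z = 1
    · simp [hψ, h]
    · exact (hψ1 z hz h).le
  have hder : ∀ z ∈ Set.Ioi (0:ℝ), HasDerivAt F (φ z + ψ z) z := by
    intro z hz
    have hz : (0:ℝ) < z := hz
    have h1 : HasDerivAt (fun z : ℝ => z ^ s) (s * z ^ (s - 1)) z :=
      Real.hasDerivAt_rpow_const (Or.inl hz.ne')
    have h2 : HasDerivAt (fun z : ℝ => (1 + z)) 1 z := by
      simpa using (hasDerivAt_id z).const_add 1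
    have h3 : HasDerivAt (fun z : ℝ => (1 + z) ^ (-(3/2) : ℝ))
        (1 * (-(3/2)) * (1 + z) ^ (-(3/2) - 1 : ℝ)) z :=
      h2.rpow_const (Or.inl (by positivity))
    have h4 : HasDerivAt (fun z : ℝ => z / (1 + z)) ((1 * (1 + z) - z * 1) / (1 + z) ^ 2) z :=
      (hasDerivAt_id z).div h2 (by positivity)
    have h5 : HasDerivAt (fun z : ℝ => (z / (1 + z)) ^ (3/2 : ℝ))
        (((1 * (1 + z) - z * 1) / (1 + z) ^ 2) * (3/2) * (z / (1 + z)) ^ (3/2 - 1 : ℝ)) z :=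
      h4.rpow_const (Or.inl (by positivity))
    refine (((h1.sub_const (1 - 2 * s)).mul h3).add (h5.const_mul (2 * s))).congr_deriv ?_
    simp only [hφ, hψ]
    have hp : 0 < 1 + z := by positivity
    have e1 : (1 + z) ^ (-(3/2) - 1 : ℝ) = (1 + z) ^ (-(5/2) : ℝ) := by norm_num
    have e2 : (z / (1 + z)) ^ (3/2 - 1 : ℝ) = z ^ (1/2 : ℝ) * (1 + z) ^ (-(1/2) : ℝ) := by
      rw [Real.div_rpow hz.le hp.le, div_eq_mul_inv, ← Real.rpow_neg hp.le]; norm_num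
    have e3 : (1 + z) ^ (-(1/2) : ℝ) = (1 + z) ^ (-(5/2) : ℝ) * (1 + z) ^ 2 := by
      rw [← Real.rpow_natCast, ← Real.rpow_add hp]; norm_num
    rw [e1, e2, e3]
    field_simp
    ring
  have hcont : ContinuousWithinAt F (Set.Ici 0) 0 := by
    apply ContinuousAt.continuousWithinAt
    simp only [hF]
    refine ContinuousAt.add (ContinuousAt.mul ?_ ?_) (ContinuousAt.mul continuousAt_const ?_)
    · exact (Real.continuousAt_rpow_const _ _ (Or.inr hs.le)).sub continuousAt_const
    · exact ContinuousAt.rpow_const (by fun_prop) (Or.inl (by norm_num))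
    · exact ContinuousAt.rpow_const (continuousAt_id.div (by fun_prop) (by norm_num))
        (Or.inr (by norm_num))
  have hlim : Filter.Tendsto F Filter.atTop (nhds (2 * s)) := by
    have h1 : Filter.Tendsto (fun z : ℝ => (1 + z)) Filter.atTop Filter.atTop :=
      Filter.tendsto_atTop_add_const_left _ _ Filter.tendsto_id
    have h2 : Filter.Tendsto (fun z : ℝ => (1 + z) ^ (-(3/2) : ℝ)) Filter.atTop (nhds 0) :=
      (tendsto_rpow_neg_atTop (by norm_num)).comp h1
    have h3 : Filter.Tendsto (fun z : ℝ => z ^ s * (1 + z) ^ (-(3/2) : ℝ)) Filter.atTop (nhds 0) := by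
      refine squeeze_zero' ?_ ?_ (tendsto_rpow_neg_atTop (show 0 < 3/2 - s by linarith))
      · filter_upwards [Filter.eventually_gt_atTop 0] with z hz; positivity
      · filter_upwards [Filter.eventually_gt_atTop 0] with z hz
        have e : z ^ (-(3/2 - s)) = z ^ s * z ^ (-(3/2) : ℝ) := by
          rw [← Real.rpow_add hz]; congr 1; ring
        rw [e]
        refine mul_le_mul_of_nonneg_left ?_ (by positivity)
        exact Real.rpow_le_rpow_of_nonpos hz (by linarith) (by norm_num)
    have h4 : Filter.Tendsto (fun z : ℝ => z / (1 + z)) Filter.atTop (nhds 1) := by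
      have : Filter.Tendsto (fun z : ℝ => 1 - (1 + z)⁻¹) Filter.atTop (nhds (1 - 0)) :=
        (tendsto_inv_atTop_zero.comp h1).const_sub 1
      rw [sub_zero] at this
      refine this.congr' ?_
      filter_upwards [Filter.eventually_gt_atTop 0] with z hz
      field_simp; ring
    have h5 : Filter.Tendsto (fun z : ℝ => (z / (1 + z)) ^ (3/2 : ℝ)) Filter.atTop (nhds 1) := by
      have := h4.rpow_const (p := 3/2) (Or.inl one_ne_zero)
      rwa [Real.one_rpow] at this
    have := (h3.sub (h2.const_mul (1 - 2 * s))).add (h5.const_mul (2 * s))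
    simp only [mul_zero, sub_zero, zero_add, mul_one] at this
    refine this.congr fun z => ?_
    simp only [hF]; ring
  have hnn : ∀ z ∈ Set.Ioi (0:ℝ), 0 ≤ φ z + ψ z := fun z hz => add_nonneg (hφ0 z hz) (hψ0 z hz)
  have hval := integral_Ioi_of_hasDerivAt_of_nonneg hcont hder hnn hlim
  have hIg := integrableOn_Ioi_deriv_of_nonneg hcont hder hnn hlim
  have hF0 : F 0 = -(1 - 2 * s) := by
    simp [hF, Real.zero_rpow hs.ne']
  rw [hF0] at hval
  have hφm : Measurable φ := by simp only [hφ]; fun_prop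
  have hψm : Measurable ψ := by simp only [hψ]; fun_prop
  have htot : (∫⁻ z in Set.Ioi (0:ℝ), ENNReal.ofReal (φ z)) +
      ∫⁻ z in Set.Ioi (0:ℝ), ENNReal.ofReal (ψ z) = 1 := by
    rw [← lintegral_add_left (by fun_prop)]
    have : ∫⁻ z in Set.Ioi (0:ℝ), (ENNReal.ofReal (φ z) + ENNReal.ofReal (ψ z)) =
        ∫⁻ z in Set.Ioi (0:ℝ), ENNReal.ofReal (φ z + ψ z) := by
      refine setLIntegral_congr_fun measurableSet_Ioi fun z hz => ?_
      exact (ENNReal.ofReal_add (hφ0 z hz) (hψ0 z hz)).symm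
    rw [this, ← ofReal_integral_eq_lintegral_ofReal hIg
      ((ae_restrict_iff' measurableSet_Ioi).2 (Filter.Eventually.of_forall hnn)), hval]
    rw [← ENNReal.ofReal_one]; congr 1; ring
  have hψpos : ∫⁻ z in Set.Ioi (0:ℝ), ENNReal.ofReal (ψ z) ≠ 0 := by
    intro h
    rw [lintegral_eq_zero_iff (by fun_prop)] at h
    have h' := (ae_restrict_iff' measurableSet_Ioi).1 h
    have h1 : ∀ᵐ z : ℝ, z ∉ Set.Ioo (1:ℝ) 2 := by
      filter_upwards [h'] with z hz hz2
      have hz0 : (0:ℝ) < z := by linarith [hz2.1]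
      have := hz hz0
      simp only [Pi.zero_apply, ENNReal.ofReal_eq_zero] at this
      have := hψ1 z hz0 (ne_of_gt hz2.1)
      linarith
    have h2 := measure_eq_zero_iff_ae_notMem.2 h1
    rw [Real.volume_Ioo] at h2
    norm_num at h2
  have hlt : ∫⁻ z in Set.Ioi (0:ℝ), ENNReal.ofReal (φ z) ≠ ⊤ := by
    intro h; rw [h] at htot; simp at htot
  calc _ < (∫⁻ z in Set.Ioi (0:ℝ), ENNReal.ofReal (φ z)) +
      ∫⁻ z in Set.Ioi (0:ℝ), ENNReal.ofReal (ψ z) := ENNReal.lt_add_right hlt hψpos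
    _ = 1 := htot

lemma C_fin {s : ℝ} (hs : 0 < s) (hs2 : s < 1) :
    ∫⁻ z in Set.Ioi (0:ℝ), ENNReal.ofReal (s * z ^ (s - 1) * (1 + z)⁻¹) < ⊤ := by
  have h1 : IntegrableOn (fun z : ℝ => z ^ (s - 1)) (Set.Ioc 0 1) := by
    have := intervalIntegral.intervalIntegrable_rpow' (a := 0) (b := 1) (r := s - 1) (by linarith)
    rwa [intervalIntegrable_iff_integrableOn_Ioc_of_le zero_le_one] at this
  have h2 : IntegrableOn (fun z : ℝ => z ^ (s - 2)) (Set.Ioi 1) :=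
    integrableOn_Ioi_rpow_of_lt (by linarith) one_pos
  have h3 : Set.Ioi (0:ℝ) = Set.Ioc 0 1 ∪ Set.Ioi 1 := (Set.Ioc_union_Ioi_eq_Ioi zero_le_one).symm
  have h4 : IntegrableOn (fun z : ℝ => s * z ^ (s - 1) * (1 + z)⁻¹) (Set.Ioi 0) := by
    rw [h3]
    refine IntegrableOn.union ?_ ?_
    · refine Integrable.mono' (h1.const_mul s) (by fun_prop) ?_
      refine (ae_restrict_iff' measurableSet_Ioc).2 (Filter.Eventually.of_forall fun z hz => ?_)
      have hz0 : 0 < z := hz.1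
      rw [Real.norm_of_nonneg (by positivity)]
      refine mul_le_of_le_one_right (by positivity) (inv_le_one_of_one_le₀ (by linarith))
    · refine Integrable.mono' (h2.const_mul s) (by fun_prop) ?_
      refine (ae_restrict_iff' measurableSet_Ioi).2 (Filter.Eventually.of_forall fun z hz => ?_)
      have hz1 : 1 < z := hz
      have hz0 : 0 < z := by linarith
      rw [Real.norm_of_nonneg (by positivity)]
      have e : z ^ (s - 2) = z ^ (s - 1) * z⁻¹ := by
        rw [← Real.rpow_neg_one, ← Real.rpow_add hz0]; congr 1; ring
      rw [e, mul_assoc]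
      gcongr
      linarith
  have := h4.lintegral_lt_top
  exact this

lemma q_bound1 {s L W : ℝ} (hL : 0 < L) (hs : 0 < s) (hW : 0 ≤ W) :
    ∫⁻ q in Set.Ioi (0:ℝ), ENNReal.ofReal (s * q ^ (s - 1)) * (ENNReal.ofReal (L / (L + q)) *
      ENNReal.ofReal ((1 + q * W) ^ (-(1/2) : ℝ))) ≤
    ENNReal.ofReal (L ^ s) *
      ∫⁻ z in Set.Ioi (0:ℝ), ENNReal.ofReal (s * z ^ (s - 1) * (1 + z)⁻¹) := by
  rw [lintegral_scale_Ioi _ hL, ← lintegral_const_mul' _ _ ENNReal.ofReal_ne_top]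
  refine setLIntegral_mono' measurableSet_Ioi fun z hz => ?_
  have hz : (0:ℝ) < z := hz
  rw [← ENNReal.ofReal_mul (by positivity), ← ENNReal.ofReal_mul (by positivity),
    ← ENNReal.ofReal_mul (by positivity), ← ENNReal.ofReal_mul (by positivity)]
  refine ENNReal.ofReal_le_ofReal ?_
  have h1 : (1 + L * z * W) ^ (-(1/2) : ℝ) ≤ 1 :=
    Real.rpow_le_one_of_one_le_of_nonpos (by have : 0 ≤ L * z * W := by positivity
                                             linarith) (by norm_num)
  have h2 : (L * z) ^ (s - 1) = L ^ (s - 1) * z ^ (s - 1) := Real.mul_rpow hL.le hz.le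
  have h3 : L ^ s = L * L ^ (s - 1) := by
    rw [mul_comm, ← Real.rpow_add_one hL.ne']; congr 1; ring
  calc _ ≤ L * (s * (L * z) ^ (s - 1) * (L / (L + L * z) * 1)) := by gcongr
    _ = _ := by rw [h2, h3]; field_simp

lemma q_bound2 {s x η W : ℝ} (hx : 0 < x) (hs : 0 < s) (hη : 0 ≤ η) (hxη : x ≤ η)
    (hW : x / (1 + η) ≤ W) :
    ∫⁻ q in Set.Ioi (0:ℝ), ENNReal.ofReal (s * q ^ (s - 1)) *
      (ENNReal.ofReal ((1 + x⁻¹) / ((1 + x⁻¹) + q)) *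
      ENNReal.ofReal ((1 + q * W) ^ (-(1/2) : ℝ))) ≤
    ENNReal.ofReal (x ^ (-s) * (1 + η) ^ (3/2 : ℝ)) *
      ∫⁻ z in Set.Ioi (0:ℝ), ENNReal.ofReal (s * z ^ (s - 1) * (1 + z) ^ (-(3/2) : ℝ)) := by
  have hxi : 0 < x⁻¹ := by positivity
  have hW0 : 0 ≤ W := le_trans (by positivity) hW
  rw [lintegral_scale_Ioi _ hxi, ← lintegral_const_mul' _ _ ENNReal.ofReal_ne_top]
  refine setLIntegral_mono' measurableSet_Ioi fun z hz => ?_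
  have hz : (0:ℝ) < z := hz
  rw [← ENNReal.ofReal_mul (by positivity), ← ENNReal.ofReal_mul (by positivity),
    ← ENNReal.ofReal_mul (by positivity), ← ENNReal.ofReal_mul (by positivity)]
  refine ENNReal.ofReal_le_ofReal ?_
  have hp : 0 < 1 + z := by positivity
  have hq : 0 < 1 + η := by positivity
  have h1 : (1 + x⁻¹ * z * W) ^ (-(1/2) : ℝ) ≤ (1 + η) ^ (1/2 : ℝ) * (1 + z) ^ (-(1/2) : ℝ) := by
    have : (1 + z) / (1 + η) ≤ 1 + x⁻¹ * z * W := by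
      have e1 : x⁻¹ * z * (x / (1 + η)) ≤ x⁻¹ * z * W := by gcongr
      have e2 : x⁻¹ * z * (x / (1 + η)) = z / (1 + η) := by field_simp
      have e3 : 1 / (1 + η) ≤ 1 := by rw [div_le_one hq]; linarith
      rw [add_div]; linarith
    refine (Real.rpow_le_rpow_of_nonpos (by positivity) this (by norm_num)).trans (le_of_eq ?_)
    rw [Real.div_rpow hp.le hq.le, Real.rpow_neg hq.le, div_inv_eq_mul, mul_comm]
  have h2 : (x⁻¹ * z) ^ (s - 1) = x⁻¹ ^ (s - 1) * z ^ (s - 1) := Real.mul_rpow hxi.le hz.le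
  have h3 : x ^ (-s) = x⁻¹ * x⁻¹ ^ (s - 1) := by
    rw [mul_comm, ← Real.rpow_add_one hxi.ne', Real.rpow_neg hx.le, ← Real.inv_rpow hx.le]
    congr 1; ring
  have h4 : (1 + x⁻¹) / ((1 + x⁻¹) + x⁻¹ * z) ≤ (1 + η) * (1 + z)⁻¹ := by
    have : (1 + x⁻¹) / ((1 + x⁻¹) + x⁻¹ * z) = (1 + x) / (1 + x + z) := by field_simp; ring
    rw [this, ← div_eq_mul_inv]
    gcongr
    linarith
  have h5 : (1 + z) ^ (-(3/2) : ℝ) = (1 + z)⁻¹ * (1 + z) ^ (-(1/2) : ℝ) := by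
    rw [← Real.rpow_neg_one, ← Real.rpow_add hp]; norm_num
  have h6 : (1 + η) ^ (3/2 : ℝ) = (1 + η) * (1 + η) ^ (1/2 : ℝ) := by
    rw [mul_comm, ← Real.rpow_add_one hq.ne']; norm_num
  calc _ ≤ x⁻¹ * (s * (x⁻¹ * z) ^ (s - 1) * (((1 + η) * (1 + z)⁻¹) *
        ((1 + η) ^ (1/2 : ℝ) * (1 + z) ^ (-(1/2) : ℝ)))) := by gcongr
    _ = _ := by rw [h2, h3, h5, h6]; ring


theorem swap_all {T N S B Y : Type*} [MeasurableSpace T] [MeasurableSpace N] [MeasurableSpace S]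
    [MeasurableSpace B] [MeasurableSpace Y] (mT : Measure T) (mN : Measure N) (mS : Measure S)
    (mB : Measure B) (mY : Measure Y) [SFinite mT] [SFinite mN] [SFinite mS] [SFinite mB]
    [SFinite mY]
    (G : T → N → S → B → Y → ENNReal)
    (hG : Measurable (fun z : (((T × Y) × N) × S) × B => G z.1.1.1.1 z.1.1.2 z.1.2 z.2 z.1.1.1.2))
    (g : T → S → B → ENNReal) (hg : Measurable (fun z : T × S × B => g z.1 z.2.1 z.2.2))
    (i : T → S → ENNReal) (hi : Measurable (fun z : T × S => i z.1 z.2))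
    (v : N → ENNReal) (hv : Measurable v)
    (w : T → ENNReal) (hw : AEMeasurable w mT) (E : Y → ENNReal) (hE : Measurable E) :
    ∫⁻ x, (∫⁻ t, (∫⁻ ν, (∫⁻ s, (∫⁻ β, G t ν s β x * g t s β ∂mB) * i t s ∂mS) * v ν ∂mN)
        * w t ∂mT) * E x ∂mY =
      ∫⁻ t, (∫⁻ ν, (∫⁻ s, (∫⁻ β, (∫⁻ x, G t ν s β x * E x ∂mY) * g t s β ∂mB) * i t s ∂mS)
        * v ν ∂mN) * w t ∂mT ∧
    Measurable (fun x => ∫⁻ t, (∫⁻ ν, (∫⁻ s, (∫⁻ β, G t ν s β x * g t s β ∂mB) * i t s ∂mS) *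
        v ν ∂mN) * w t ∂mT) := by
  have h1 : Measurable (fun z : ((T × Y) × N) × S =>
      (∫⁻ β, G z.1.1.1 z.1.2 z.2 β z.1.1.2 * g z.1.1.1 z.2 β ∂mB)) := by
    refine Measurable.lintegral_prod_right' (f := fun z : (((T × Y) × N) × S) × B =>
      G z.1.1.1.1 z.1.1.2 z.1.2 z.2 z.1.1.1.2 * g z.1.1.1.1 z.1.2 z.2) ?_
    refine hG.mul ?_
    exact hg.comp (f := fun z : (((T × Y) × N) × S) × B => (z.1.1.1.1, z.1.2, z.2)) (by fun_prop)
  have h2 : Measurable (fun z : (T × Y) × N =>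
      (∫⁻ s, (∫⁻ β, G z.1.1 z.2 s β z.1.2 * g z.1.1 s β ∂mB) * i z.1.1 s ∂mS)) := by
    refine Measurable.lintegral_prod_right' (f := fun z : ((T × Y) × N) × S =>
      (∫⁻ β, G z.1.1.1 z.1.2 z.2 β z.1.1.2 * g z.1.1.1 z.2 β ∂mB) * i z.1.1.1 z.2) ?_
    refine h1.mul ?_
    exact hi.comp (f := fun z : ((T × Y) × N) × S => (z.1.1.1, z.2)) (by fun_prop)
  have h3 : Measurable (fun z : T × Y =>
      (∫⁻ ν, (∫⁻ s, (∫⁻ β, G z.1 ν s β z.2 * g z.1 s β ∂mB) * i z.1 s ∂mS) * v ν ∂mN)) := by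
    refine Measurable.lintegral_prod_right' (f := fun z : (T × Y) × N =>
      (∫⁻ s, (∫⁻ β, G z.1.1 z.2 s β z.1.2 * g z.1.1 s β ∂mB) * i z.1.1 s ∂mS) * v z.2) ?_
    exact h2.mul (hv.comp (by fun_prop))
  refine ⟨?_, ?_⟩
  swap
  · have hmk : (fun x => ∫⁻ t, (∫⁻ ν, (∫⁻ s, (∫⁻ β, G t ν s β x * g t s β ∂mB) * i t s ∂mS) *
        v ν ∂mN) * w t ∂mT) = fun x => ∫⁻ t, (∫⁻ ν, (∫⁻ s, (∫⁻ β, G t ν s β x * g t s β ∂mB) *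
          i t s ∂mS) * v ν ∂mN) * hw.mk w t ∂mT := by
      funext x
      refine lintegral_congr_ae ?_
      filter_upwards [hw.ae_eq_mk] with t ht
      rw [ht]
    rw [hmk]
    refine Measurable.lintegral_prod_right' (f := fun z : Y × T =>
      (∫⁻ ν, (∫⁻ s, (∫⁻ β, G z.2 ν s β z.1 * g z.2 s β ∂mB) * i z.2 s ∂mS) * v ν ∂mN) *
        hw.mk w z.2) ?_
    exact (h3.comp measurable_swap).mul (hw.measurable_mk.comp measurable_snd)
  rw [swap1 mT mY (fun t x => (∫⁻ ν, (∫⁻ s, (∫⁻ β, G t ν s β x * g t s β ∂mB) * i t s ∂mS)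
    * v ν ∂mN)) h3 w hw E hE]
  congr 1; ext t; congr 1
  rw [swap1 mN mY (fun ν x => (∫⁻ s, (∫⁻ β, G t ν s β x * g t s β ∂mB) * i t s ∂mS))
    (h2.comp (f := fun z : N × Y => ((t, z.2), z.1)) (by fun_prop)) v hv.aemeasurable E hE]
  congr 1; ext ν; congr 1
  rw [swap1 mS mY (fun s x => (∫⁻ β, G t ν s β x * g t s β ∂mB))
    (h1.comp (f := fun z : S × Y => (((t, z.2), ν), z.1)) (by fun_prop)) (i t)
    (hi.comp (f := fun z : S => (t, z)) (by fun_prop)).aemeasurable E hE]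
  congr 1; ext s; congr 1
  rw [swap1 mB mY (fun β x => G t ν s β x)
    (hG.comp (f := fun z : B × Y => ((((t, z.2), ν), s), z.1)) (by fun_prop)) (g t s)
    (hg.comp (f := fun z : B => (t, s, z)) (by fun_prop)).aemeasurable E hE]

/-- Same with the extra variable not entering through `t`. -/
theorem swap_three {N S B Y : Type*} [MeasurableSpace N] [MeasurableSpace S]
    [MeasurableSpace B] [MeasurableSpace Y] (mN : Measure N) (mS : Measure S)
    (mB : Measure B) (mY : Measure Y) [SFinite mN] [SFinite mS] [SFinite mB]
    [SFinite mY]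
    (G : N → S → B → Y → ENNReal)
    (hG : Measurable (fun z : ((Y × N) × S) × B => G z.1.1.2 z.1.2 z.2 z.1.1.1))
    (g : S → B → ENNReal) (hg : Measurable (fun z : S × B => g z.1 z.2))
    (i : S → ENNReal) (hi : Measurable i)
    (v : N → ENNReal) (hv : Measurable v)
    (E : Y → ENNReal) (hE : Measurable E) :
    ∫⁻ x, (∫⁻ ν, (∫⁻ s, (∫⁻ β, G ν s β x * g s β ∂mB) * i s ∂mS) * v ν ∂mN) * E x ∂mY =
      (∫⁻ ν, (∫⁻ s, (∫⁻ β, (∫⁻ x, G ν s β x * E x ∂mY) * g s β ∂mB) * i s ∂mS)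
        * v ν ∂mN) := by
  have := swap_all (Measure.dirac ()) mN mS mB mY (fun _ => G)
    (hG.comp (f := fun z : (((Unit × Y) × N) × S) × B => (((z.1.1.1.2, z.1.1.2), z.1.2), z.2))
      (by fun_prop)) (fun _ => g) (hg.comp (f := fun z : Unit × S × B => z.2) (by fun_prop))
      (fun _ => i) (hi.comp (f := fun z : Unit × S => z.2) (by fun_prop)) v hv (fun _ => 1)
      (by fun_prop) E hE
  simpa using this.1


theorem enorm_finprod {p : ℕ} (f : Fin p → ℝ) : ‖∏ i, f i‖ₑ = ∏ i, ‖f i‖ₑ := by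
  simp only [Real.enorm_eq_ofReal_abs, Finset.abs_prod]
  exact ENNReal.ofReal_prod_of_nonneg fun i _ => abs_nonneg _

theorem igDens_meas (α : ℝ) : Measurable (fun z : ℝ × ℝ => igDens α z.1 z.2) := by
  unfold igDens; fun_prop

theorem dot_meas {Z : Type*} [MeasurableSpace Z] {m : ℕ} (f g : Z → Fin m → ℝ)
    (hf : ∀ i, Measurable fun z => f z i) (hg : ∀ i, Measurable fun z => g z i) :
    Measurable fun z => f z ⬝ᵥ g z := by
  unfold dotProduct
  exact Finset.measurable_sum _ fun i _ => (hf i).mul (hg i)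

theorem mulVec_meas {Z : Type*} [MeasurableSpace Z] {m k : ℕ} (M : Z → Matrix (Fin m) (Fin k) ℝ)
    (g : Z → Fin k → ℝ)
    (hM : ∀ i j, Measurable fun z => M z i j) (hg : ∀ i, Measurable fun z => g z i) (i : Fin m) :
    Measurable fun z => ((M z).mulVec (g z)) i := by
  unfold mulVec
  exact dot_meas _ _ (hM i) hg

theorem mul_meas {Z : Type*} [MeasurableSpace Z] {m k l : ℕ} (M : Z → Matrix (Fin m) (Fin k) ℝ)
    (N : Z → Matrix (Fin k) (Fin l) ℝ)
    (hM : ∀ i j, Measurable fun z => M z i j) (hN : ∀ i j, Measurable fun z => N z i j)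
    (i : Fin m) (j : Fin l) :
    Measurable fun z => (M z * N z) i j := by
  simp only [Matrix.mul_apply]
  exact Finset.measurable_sum _ fun k _ => (hM i k).mul (hN k j)

theorem det_meas {Z : Type*} [MeasurableSpace Z] {m : ℕ} (M : Z → Matrix (Fin m) (Fin m) ℝ)
    (hM : ∀ i j, Measurable fun z => M z i j) : Measurable fun z => (M z).det := by
  simp only [Matrix.det_apply]
  refine Finset.measurable_sum _ fun σ _ => ?_
  refine Measurable.const_smul (Finset.measurable_prod _ fun i _ => hM _ _) _

theorem inv_meas {Z : Type*} [MeasurableSpace Z] {m : ℕ} (M : Z → Matrix (Fin m) (Fin m) ℝ)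
    (hM : ∀ i j, Measurable fun z => M z i j) (i j : Fin m) :
    Measurable fun z => (M z)⁻¹ i j := by
  simp only [Matrix.inv_def, Ring.inverse_eq_inv', Matrix.smul_apply, smul_eq_mul,
    Matrix.adjugate_apply]
  refine (det_meas M hM).inv.mul (det_meas _ fun k l => ?_)
  by_cases h : k = j
  · subst h; simp
  · simpa [Matrix.updateRow_ne h] using hM k l

theorem gaussDens_meas {Z : Type*} [MeasurableSpace Z] (p : ℕ) (A : Z → Matrix (Fin p) (Fin p) ℝ)
    (hA : ∀ i j, Measurable fun z => A z i j) (μ : Z → Fin p → ℝ)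
    (hμ : ∀ i, Measurable fun z => μ z i) (s : Z → ℝ) (hs : Measurable s) (β : Z → Fin p → ℝ)
    (hβ : ∀ i, Measurable fun z => β z i) :
    Measurable fun z => gaussDens p (A z) (μ z) (s z) (β z) := by
  unfold gaussDens
  have h1 := det_meas A hA
  have h0 : ∀ i, Measurable fun z => (β z - μ z) i := fun i => (hβ i).sub (hμ i)
  have h2 := dot_meas (fun z => β z - μ z) (fun z => (A z).mulVec (β z - μ z)) h0
    (mulVec_meas _ _ hA h0)
  fun_prop

theorem regA_meas (n p : ℕ) (X : Matrix (Fin n) (Fin p) ℝ) (c : ℝ) (x : Fin p → ℝ) (i j : Fin p) :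
    Measurable fun t => regA n p X c t x i j := by
  unfold regA
  simp only [Matrix.add_apply]
  refine measurable_const.add (inv_meas _ (fun i j => ?_) i j)
  simp only [Matrix.smul_apply, smul_eq_mul]
  fun_prop

theorem regR_meas (n p : ℕ) (X : Matrix (Fin n) (Fin p) ℝ) (y : Fin n → ℝ) (b c : ℝ)
    (x : Fin p → ℝ) : Measurable fun t => regR n p X y b c t x := by
  unfold regR
  refine ((dot_meas (fun _ => y) _ (fun _ => measurable_const)
    (mulVec_meas _ (fun _ => y) (fun i j => ?_) (fun _ => measurable_const))).div_const 2).add_const b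
  simp only [Matrix.sub_apply]
  refine measurable_const.sub (mul_meas _ (fun _ => Xᵀ) (fun i j => ?_) (fun _ _ => measurable_const) i j)
  exact mul_meas (fun _ => X) _ (fun _ _ => measurable_const) (inv_meas _ (regA_meas n p X c x)) i j

theorem regLamDens_meas (c : ℝ) :
    Measurable (fun z : (ℝ × ℝ) × ℝ => regLamDens c z.1.1 z.1.2 z.2) := by
  unfold regLamDens
  have h : Measurable (fun z : (ℝ × ℝ) × ℝ => regLamKernel c z.1.1 z.1.2 z.2) := by
    unfold regLamKernel; fun_prop
  refine h.div ?_
  have := (h.stronglyMeasurable.integral_prod_right' (ν := volume.restrict (Set.Ioi (0:ℝ)))).measurable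
  exact this.comp measurable_fst

theorem measSet_pi (p : ℕ) : MeasurableSet (Set.univ.pi (fun _ : Fin p => Set.Ioi (0 : ℝ))) :=
  MeasurableSet.univ_pi fun _ => measurableSet_Ioi

theorem phi_x (p : ℕ) (c t : ℝ) (ht : 0 < t) (r : Fin p → ℝ) (hr : ∀ i, 0 < r i) (j : Fin p)
    (σ : ℝ) (hσ : 0 < σ) :
    ∫⁻ x' in Set.univ.pi (fun _ : Fin p => Set.Ioi (0 : ℝ)),
      ‖∏ i, regLamDens c t (r i) (x' i)‖ₑ * ENNReal.ofReal ((x' j) ^ (-σ)) ≤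
    ∫⁻ q in Set.Ioi (0:ℝ), ENNReal.ofReal (Real.exp (-(r j * q))) *
      ENNReal.ofReal (σ * q ^ (σ - 1)) := by
  have hm : ∀ i, Measurable (fun u => regLamDens c t (r i) u) := fun i =>
    (regLamDens_meas c).comp (f := fun u : ℝ => ((t, r i), u)) (by fun_prop)
  have e1 : ∀ x' : Fin p → ℝ, ‖∏ i, regLamDens c t (r i) (x' i)‖ₑ * ENNReal.ofReal ((x' j) ^ (-σ))
      = ∏ i, (‖regLamDens c t (r i) (x' i)‖ₑ *
          if i = j then ENNReal.ofReal ((x' i) ^ (-σ)) else 1) := by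
    intro x'
    rw [Finset.prod_mul_distrib, enorm_finprod, Finset.prod_ite_eq']
    simp
  simp only [e1]
  rw [lintegral_orthant_prod (fun i u => ‖regLamDens c t (r i) u‖ₑ *
          if i = j then ENNReal.ofReal (u ^ (-σ)) else 1) (fun i => by
        have := hm i
        split_ifs <;> fun_prop)]
  have e2 : ∀ i (f : ℝ → ENNReal), ∫⁻ u in Set.Ioi (0:ℝ), ‖regLamDens c t (r i) u‖ₑ * f u
      = ∫⁻ u in Set.Ioi (0:ℝ), ENNReal.ofReal (regLamDens c t (r i) u) * f u := by
    intro i f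
    refine setLIntegral_congr_fun measurableSet_Ioi fun u hu => ?_
    simp only [Real.enorm_of_nonneg (regLamDens_nonneg ht hu)]
  rw [← Finset.mul_prod_erase _ _ (Finset.mem_univ j)]
  refine (mul_le_of_le_one_right' (Finset.prod_le_one' fun i hi => ?_)).trans ?_
  · rw [e2]
    simp only [Finset.ne_of_mem_erase hi, if_false, mul_one]
    exact regLam_mass ht
  · rw [e2]
    simp only [if_true]
    refine (regLam_moment ht (hr j) hσ).trans (le_of_eq ?_)
    refine lintegral_congr fun q => mul_comm _ _

theorem phi_bound (p : ℕ) (c t : ℝ) (ht : 0 < t) (A : Matrix (Fin p) (Fin p) ℝ) (hA : A.PosDef)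
    (μ : Fin p → ℝ) (α R : ℝ) (hα : 0 < α) (hR : 0 < R) (l : Fin p → ℝ) (hl : ∀ i, 0 < l i)
    (j : Fin p) (σ : ℝ) (hσ : 0 < σ) :
    ∫⁻ ν in Set.univ.pi (fun _ : Fin p => Set.Ioi (0 : ℝ)),
      (∫⁻ s in Set.Ioi (0:ℝ), (∫⁻ β : Fin p → ℝ,
        (∫⁻ x' in Set.univ.pi (fun _ : Fin p => Set.Ioi (0 : ℝ)),
          ‖∏ i, regLamDens c t ((ν i)⁻¹ + (β i) ^ 2 / (2 * s * t)) (x' i)‖ₑ *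
            ENNReal.ofReal ((x' j) ^ (-σ))) * ‖gaussDens p A μ s β‖ₑ) * ‖igDens α R s‖ₑ) *
        ‖∏ i, igDens 1 (l i) (ν i)‖ₑ ≤
    ∫⁻ q in Set.Ioi (0:ℝ), ENNReal.ofReal (σ * q ^ (σ - 1)) * (ENNReal.ofReal (l j / (l j + q)) *
      ENNReal.ofReal ((1 + q * (A⁻¹ j j / t)) ^ (-(1/2:ℝ)))) := by
  have hgm : Measurable (fun z : ℝ × (Fin p → ℝ) => ‖gaussDens p A μ z.1 z.2‖ₑ) :=
    (gaussDens_meas p (fun _ => A) (fun _ _ => measurable_const) (fun _ => μ)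
      (fun _ => measurable_const) (fun z : ℝ × (Fin p → ℝ) => z.1) (by fun_prop) (fun z => z.2)
      (by fun_prop)).enorm
  have him : Measurable (fun s => ‖igDens α R s‖ₑ) :=
    ((igDens_meas α).comp (f := fun u : ℝ => (R, u)) (by fun_prop)).enorm
  have hvi : ∀ i, Measurable (fun u => igDens 1 (l i) u) := fun i =>
    ((igDens_meas 1).comp (f := fun u : ℝ => (l i, u)) (by fun_prop))
  have hvm : Measurable (fun ν : Fin p → ℝ => ‖∏ i, igDens 1 (l i) (ν i)‖ₑ) :=
    (Finset.measurable_prod _ fun i _ => (hvi i).comp (measurable_pi_apply i)).enorm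
  calc _ ≤ ∫⁻ ν in Set.univ.pi (fun _ : Fin p => Set.Ioi (0 : ℝ)),
      (∫⁻ s in Set.Ioi (0:ℝ), (∫⁻ β : Fin p → ℝ,
        (∫⁻ q in Set.Ioi (0:ℝ), ENNReal.ofReal (Real.exp
            (-(((ν j)⁻¹ + (β j) ^ 2 / (2 * s * t)) * q))) *
          ENNReal.ofReal (σ * q ^ (σ - 1))) * ‖gaussDens p A μ s β‖ₑ) * ‖igDens α R s‖ₑ) *
        ‖∏ i, igDens 1 (l i) (ν i)‖ₑ := by
        refine setLIntegral_mono' (measSet_pi p) fun ν hν => ?_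
        gcongr ?_ * _
        refine setLIntegral_mono' measurableSet_Ioi fun s hs => ?_
        gcongr ?_ * _
        refine lintegral_mono fun β => ?_
        gcongr ?_ * _
        refine phi_x p c t ht (fun i => (ν i)⁻¹ + (β i) ^ 2 / (2 * s * t)) (fun i => ?_) j σ hσ
        have h1 : 0 < ν i := hν i (Set.mem_univ i)
        have h2 : 0 < s := hs
        positivity
    _ = ∫⁻ q in Set.Ioi (0:ℝ), (∫⁻ ν in Set.univ.pi (fun _ : Fin p => Set.Ioi (0 : ℝ)),
      (∫⁻ s in Set.Ioi (0:ℝ), (∫⁻ β : Fin p → ℝ,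
        ENNReal.ofReal (Real.exp
            (-(((ν j)⁻¹ + (β j) ^ 2 / (2 * s * t)) * q))) *
           ‖gaussDens p A μ s β‖ₑ) * ‖igDens α R s‖ₑ) *
        ‖∏ i, igDens 1 (l i) (ν i)‖ₑ) * ENNReal.ofReal (σ * q ^ (σ - 1)) := by
        refine (swap_three _ _ _ _ (fun (ν : Fin p → ℝ) (s : ℝ) (β : Fin p → ℝ) (q : ℝ) =>
          ENNReal.ofReal (Real.exp (-(((ν j)⁻¹ + (β j) ^ 2 / (2 * s * t)) * q)))) (by fun_prop)
          _ hgm _ him _ hvm _ (by fun_prop)).symm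
    _ ≤ _ := by
        refine setLIntegral_mono' measurableSet_Ioi fun q hq => ?_
        rw [mul_comm]
        gcongr _ * ?_
        have hq : 0 < q := hq
        set K := ENNReal.ofReal ((1 + q * (A⁻¹ j j / t)) ^ (-(1/2:ℝ))) with hK
        calc _ ≤ ∫⁻ ν in Set.univ.pi (fun _ : Fin p => Set.Ioi (0 : ℝ)),
              (K * ENNReal.ofReal (Real.exp (-q / ν j))) * ‖∏ i, igDens 1 (l i) (ν i)‖ₑ := by
              refine lintegral_mono fun ν => ?_
              gcongr ?_ * _
              calc _ ≤ ∫⁻ s in Set.Ioi (0:ℝ), (K * ENNReal.ofReal (Real.exp (-q / ν j))) *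
                    ‖igDens α R s‖ₑ := by
                    refine setLIntegral_mono' measurableSet_Ioi fun s hs => ?_
                    have hs : 0 < s := hs
                    gcongr ?_ * _
                    have hgt := gauss_tilt A hA s hs μ (q / t) (by positivity) j
                    have e3 : q / t * A⁻¹ j j = q * (A⁻¹ j j / t) := by ring
                    rw [e3] at hgt
                    rw [mul_comm K]
                    refine le_trans (le_of_eq ?_) (mul_le_mul_right hgt _)
                    rw [← lintegral_const_mul' _ _ ENNReal.ofReal_ne_top]
                    refine lintegral_congr fun β => ?_
                    have hg0 : 0 ≤ gaussDens p A μ s β := by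
                      unfold gaussDens
                      have := hA.det_pos
                      positivity
                    rw [Real.enorm_of_nonneg hg0, ← mul_assoc,
                      ← ENNReal.ofReal_mul (Real.exp_nonneg (-q / ν j)), ← Real.exp_add]
                    congr 3
                    ring
                _ ≤ _ := by
                    rw [lintegral_const_mul _ him]
                    refine mul_le_of_le_one_right' (le_of_eq ?_)
                    rw [← lintegral_igDens hα hR]
                    refine setLIntegral_congr_fun measurableSet_Ioi fun u hu => ?_
                    simp only [Real.enorm_of_nonneg (igDens_nonneg hα hR.le hu)]
          _ = K * ∫⁻ ν in Set.univ.pi (fun _ : Fin p => Set.Ioi (0 : ℝ)),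
              ∏ i, ((if i = j then ENNReal.ofReal (Real.exp (-q / ν i)) else 1) *
                ‖igDens 1 (l i) (ν i)‖ₑ) := by
              rw [← lintegral_const_mul' _ _ ENNReal.ofReal_ne_top]
              refine lintegral_congr fun ν => ?_
              rw [Finset.prod_mul_distrib, enorm_finprod, Finset.prod_ite_eq']
              simp only [Finset.mem_univ, if_true, mul_assoc, hK]
          _ = _ := by
              rw [mul_comm]
              congr 1
              rw [lintegral_orthant_prod (fun i u => (if i = j then ENNReal.ofReal (Real.exp (-q / u)) else 1) *
                ‖igDens 1 (l i) u‖ₑ) (fun i => by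
                  have := hvi i
                  split_ifs <;> fun_prop)]
              have e2 : ∀ i (f : ℝ → ENNReal), ∫⁻ u in Set.Ioi (0:ℝ), f u * ‖igDens 1 (l i) u‖ₑ
                  = ∫⁻ u in Set.Ioi (0:ℝ), f u * ENNReal.ofReal (igDens 1 (l i) u) := by
                intro i f
                refine setLIntegral_congr_fun measurableSet_Ioi fun u hu => ?_
                simp only [Real.enorm_of_nonneg (igDens_nonneg one_pos (hl i).le hu)]
              rw [← Finset.mul_prod_erase _ _ (Finset.mem_univ j), Finset.prod_eq_one, mul_one, e2]
              · simp only [if_true]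
                exact lintegral_igDens_tilt (hl j) hq.le
              · intro i hi
                rw [e2]
                simp only [Finset.ne_of_mem_erase hi, if_false, one_mul]
                exact lintegral_igDens one_pos (hl i)


theorem pi_integrable (πτ : ℝ → ℝ) (hπ_prob : ∫ t in Set.Ioi (0 : ℝ), πτ t = 1) :
    IntegrableOn πτ (Set.Ioi 0) := by
  by_contra h
  rw [integral_undef h] at hπ_prob
  norm_num at hπ_prob

theorem regTau_factor_meas (n p : ℕ) (X : Matrix (Fin n) (Fin p) ℝ) (y : Fin n → ℝ) (a b c : ℝ)
    (x : Fin p → ℝ) : Measurable fun t => ((regA n p X c t x).det) ^ (-(1 / 2 : ℝ)) *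
    (∏ j, ((c ^ 2)⁻¹ + (t * x j)⁻¹) ^ ((1 : ℝ) / 2)) *
    regR n p X y b c t x ^ (-(a + (n : ℝ) / 2)) := by
  have h1 := det_meas _ (regA_meas n p X c x)
  have h2 := regR_meas n p X y b c x
  fun_prop

theorem regTau_comp (n p : ℕ) (X : Matrix (Fin n) (Fin p) ℝ) (y : Fin n → ℝ) (a b c : ℝ)
    (ha : 0 < a) (hb : 0 < b) (hc : c ≠ 0) : ∃ lo hi : ℝ, 0 < lo ∧ 0 < hi ∧
      ∀ x : Fin p → ℝ, (∀ j, 0 < x j) → ∀ t, 0 < t →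
        lo ≤ ((regA n p X c t x).det) ^ (-(1 / 2 : ℝ)) *
          (∏ j, ((c ^ 2)⁻¹ + (t * x j)⁻¹) ^ ((1 : ℝ) / 2)) *
          regR n p X y b c t x ^ (-(a + (n : ℝ) / 2)) ∧
        ((regA n p X c t x).det) ^ (-(1 / 2 : ℝ)) *
          (∏ j, ((c ^ 2)⁻¹ + (t * x j)⁻¹) ^ ((1 : ℝ) / 2)) *
          regR n p X y b c t x ^ (-(a + (n : ℝ) / 2)) ≤ hi := by
  obtain ⟨C, hC, hdet⟩ := det_upper n p X c hc
  have hα : 0 < a + (n:ℝ)/2 := by positivity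
  have hyy : 0 ≤ y ⬝ᵥ y := by
    unfold dotProduct; exact Finset.sum_nonneg fun i _ => mul_self_nonneg _
  refine ⟨C ^ (-(1/2:ℝ)) * (b + y ⬝ᵥ y / 2) ^ (-(a + (n : ℝ) / 2)), 1 * b ^ (-(a + (n : ℝ) / 2)),
    by positivity, by positivity, fun x hx t ht => ?_⟩
  obtain ⟨hr1, hr2⟩ := regR_bounds n p X y b c t hc x ht hx
  have hc2 : 0 < (c^2)⁻¹ := by positivity
  set d : Fin p → ℝ := fun j => (c ^ 2)⁻¹ + (t * x j)⁻¹ with hd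
  have hd0 : ∀ j, 0 < d j := fun j => by have := hx j; simp only [hd]; positivity
  have hdc : ∀ j, (c^2)⁻¹ ≤ d j := fun j => by
    have := hx j; simp only [hd]; have : 0 < (t * x j)⁻¹ := by positivity
    linarith
  have hApd := regA_posDef n p X c t hc x ht hx
  have hAe := regA_eq n p X c t x ht hx
  have hprod : (∏ j, d j ^ ((1:ℝ)/2)) = (∏ j, d j) ^ ((1:ℝ)/2) :=
    Real.finsetProd_rpow _ _ (fun i _ => (hd0 i).le) _
  have hP : 0 < ∏ j, d j := Finset.prod_pos fun j _ => hd0 j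
  have hr0 : 0 < regR n p X y b c t x := lt_of_lt_of_le hb hr1
  have hdetpos := hApd.det_pos
  have hcancel : (∏ j, d j) ^ (-(1/2:ℝ)) * (∏ j, d j) ^ ((1:ℝ)/2) = 1 := by
    rw [← Real.rpow_add hP]; norm_num
  have k1 : C ^ (-(1/2:ℝ)) ≤ ((regA n p X c t x).det) ^ (-(1 / 2 : ℝ)) *
          (∏ j, d j ^ ((1 : ℝ) / 2)) := by
    have h1 := hdet d hdc
    rw [← hAe] at h1
    have h2 := Real.rpow_le_rpow_of_nonpos hdetpos h1 (by norm_num : -(1/2:ℝ) ≤ 0)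
    rw [Real.mul_rpow hC.le hP.le] at h2
    rw [hprod]
    calc C ^ (-(1/2:ℝ)) = C ^ (-(1/2:ℝ)) * (∏ j, d j) ^ (-(1/2:ℝ)) * (∏ j, d j) ^ ((1:ℝ)/2) := by
          rw [mul_assoc, hcancel, mul_one]
      _ ≤ _ := by gcongr
  have k2 : ((regA n p X c t x).det) ^ (-(1 / 2 : ℝ)) *
          (∏ j, d j ^ ((1 : ℝ) / 2)) ≤ 1 := by
    have hD : (diagonal d).PosDef := Matrix.PosDef.diagonal hd0
    have h1 := det_lower hD hApd (fun v => by
      rw [hAe, Matrix.add_mulVec, dotProduct_add]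
      have h0 : 0 ≤ v ⬝ᵥ (Xᵀ * X).mulVec v := by
        rw [← Matrix.mulVec_mulVec, Matrix.dotProduct_mulVec, Matrix.vecMul_transpose]
        unfold dotProduct; exact Finset.sum_nonneg fun i _ => mul_self_nonneg _
      linarith)
    rw [Matrix.det_diagonal] at h1
    rw [hprod]
    calc _ ≤ (∏ j, d j) ^ (-(1/2:ℝ)) * (∏ j, d j) ^ ((1:ℝ)/2) := by gcongr
      _ = 1 := hcancel
  constructor
  · refine mul_le_mul k1 ?_ (by positivity) (le_trans (by positivity) k1)
    exact Real.rpow_le_rpow_of_nonpos hr0 hr2 (by linarith)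
  · refine mul_le_mul k2 ?_ (by positivity) zero_le_one
    exact Real.rpow_le_rpow_of_nonpos hb hr1 (by linarith)

theorem regTau_weight (n p : ℕ) (X : Matrix (Fin n) (Fin p) ℝ) (y : Fin n → ℝ) (a b c : ℝ)
    (ha : 0 < a) (hb : 0 < b) (hc : c ≠ 0) (πτ : ℝ → ℝ) (hπ_nonneg : ∀ t, 0 ≤ πτ t)
    (hπ_prob : ∫ t in Set.Ioi (0 : ℝ), πτ t = 1) : ∃ K : ℝ, 0 < K ∧
      ∀ x : Fin p → ℝ, (∀ j, 0 < x j) → 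
        AEMeasurable (fun t => ‖regTauDens n p X y a b c πτ x t /
            ∫ u in Set.Ioi (0 : ℝ), regTauDens n p X y a b c πτ x u‖ₑ)
            (volume.restrict (Set.Ioi 0)) ∧
        (∀ t, 0 < t → ‖regTauDens n p X y a b c πτ x t /
            ∫ u in Set.Ioi (0 : ℝ), regTauDens n p X y a b c πτ x u‖ₑ ≤
              ENNReal.ofReal K * ENNReal.ofReal (πτ t)) ∧
        ∫⁻ t in Set.Ioi (0:ℝ), ‖regTauDens n p X y a b c πτ x t /
            ∫ u in Set.Ioi (0 : ℝ), regTauDens n p X y a b c πτ x u‖ₑ ≤ 1 := by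
  obtain ⟨lo, hi, hlo, hhi, H⟩ := regTau_comp n p X y a b c ha hb hc
  have hπi := pi_integrable πτ hπ_prob
  refine ⟨hi / lo, by positivity, fun x hx => ?_⟩
  have hlb : ∀ t, 0 < t → lo * πτ t ≤ regTauDens n p X y a b c πτ x t := fun t ht =>
    mul_le_mul_of_nonneg_right (H x hx t ht).1 (hπ_nonneg t)
  have hub : ∀ t, 0 < t → regTauDens n p X y a b c πτ x t ≤ hi * πτ t := fun t ht =>
    mul_le_mul_of_nonneg_right (H x hx t ht).2 (hπ_nonneg t)
  have h0 : ∀ t, 0 < t → 0 ≤ regTauDens n p X y a b c πτ x t := fun t ht =>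
    le_trans (mul_nonneg hlo.le (hπ_nonneg t)) (hlb t ht)
  have haem : AEMeasurable (fun t => regTauDens n p X y a b c πτ x t)
      (volume.restrict (Set.Ioi 0)) :=
    (regTau_factor_meas n p X y a b c x).aemeasurable.mul hπi.aemeasurable
  have hIntg : IntegrableOn (regTauDens n p X y a b c πτ x) (Set.Ioi 0) := by
    refine Integrable.mono' (hπi.const_mul hi) haem.aestronglyMeasurable ?_
    refine (ae_restrict_iff' measurableSet_Ioi).2 (.of_forall fun t ht => ?_)
    rw [Real.norm_of_nonneg (h0 t ht)]
    exact hub t ht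
  have hN : lo ≤ ∫ u in Set.Ioi (0 : ℝ), regTauDens n p X y a b c πτ x u := by
    calc lo = ∫ u in Set.Ioi (0 : ℝ), lo * πτ u := by
          rw [integral_const_mul, hπ_prob, mul_one]
      _ ≤ _ := setIntegral_mono_on (hπi.const_mul lo) hIntg measurableSet_Ioi hlb
  set N := ∫ u in Set.Ioi (0 : ℝ), regTauDens n p X y a b c πτ x u with hNdef
  have hN0 : 0 < N := lt_of_lt_of_le hlo hN
  have e : ∀ t, 0 < t → ‖regTauDens n p X y a b c πτ x t / N‖ₑ =
      ENNReal.ofReal (regTauDens n p X y a b c πτ x t / N) := fun t ht =>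
    Real.enorm_of_nonneg (div_nonneg (h0 t ht) hN0.le)
  refine ⟨(haem.div_const N).enorm, fun t ht => ?_, ?_⟩
  · rw [e t ht, ← ENNReal.ofReal_mul (by positivity)]
    refine ENNReal.ofReal_le_ofReal ?_
    calc _ ≤ hi * πτ t / lo := div_le_div₀ (mul_nonneg hhi.le (hπ_nonneg t)) (hub t ht) hlo hN
      _ = _ := by ring
  · rw [setLIntegral_congr_fun measurableSet_Ioi (fun t ht => e t ht)]
    rw [← ofReal_integral_eq_lintegral_ofReal (hIntg.div_const N)]
    · rw [integral_div, ← hNdef, div_self hN0.ne']; simp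
    · exact (ae_restrict_iff' measurableSet_Ioi).2 (.of_forall fun t ht =>
        div_nonneg (h0 t ht) hN0.le)

theorem mtd_bound (n p : ℕ) (X : Matrix (Fin n) (Fin p) ℝ) (y : Fin n → ℝ) (a b c : ℝ)
    (ha : 0 < a) (hb : 0 < b) (hc : c ≠ 0) (πτ : ℝ → ℝ) (x : Fin p → ℝ) (hx : ∀ j, 0 < x j)
    (hw : AEMeasurable (fun t => ‖regTauDens n p X y a b c πτ x t /
            ∫ u in Set.Ioi (0 : ℝ), regTauDens n p X y a b c πτ x u‖ₑ)
            (volume.restrict (Set.Ioi 0))) (σ : ℝ) (hσ : 0 < σ) :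
    ∫⁻ x' in Set.univ.pi (fun _ : Fin p => Set.Ioi (0 : ℝ)),
          ENNReal.ofReal (regMTD n p X y a b c πτ x x' * ∑ j, (x' j) ^ (-σ)) ≤
    ∑ j, ∫⁻ t in Set.Ioi (0:ℝ), (∫⁻ q in Set.Ioi (0:ℝ), ENNReal.ofReal (σ * q ^ (σ - 1)) *
      (ENNReal.ofReal ((1 + (x j)⁻¹) / ((1 + (x j)⁻¹) + q)) *
      ENNReal.ofReal ((1 + q * ((regA n p X c t x)⁻¹ j j / t)) ^ (-(1/2:ℝ))))) *
        ‖regTauDens n p X y a b c πτ x t /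
            ∫ u in Set.Ioi (0 : ℝ), regTauDens n p X y a b c πτ x u‖ₑ := by
  set w : ℝ → ℝ := fun t => regTauDens n p X y a b c πτ x t /
            ∫ u in Set.Ioi (0 : ℝ), regTauDens n p X y a b c πτ x u with hwdef
  set M : ℝ → Fin p → ℝ := fun t => (regA n p X c t x)⁻¹.mulVec (X.transpose.mulVec y) with hM
  have hMm : ∀ i, Measurable fun t => M t i := mulVec_meas _ (fun _ => Xᵀ.mulVec y)
    (inv_meas _ (regA_meas n p X c x)) (fun _ => measurable_const)
  set J : (Fin p → ℝ) → ENNReal := fun x' => ∫⁻ t in Set.Ioi (0 : ℝ),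
    (∫⁻ ν in Set.univ.pi (fun _ : Fin p => Set.Ioi (0 : ℝ)),
      (∫⁻ s in Set.Ioi (0 : ℝ),
        (∫⁻ β : Fin p → ℝ,
          ‖∏ j, regLamDens c t ((ν j)⁻¹ + (β j) ^ 2 / (2 * s * t)) (x' j)‖ₑ *
            ‖gaussDens p (regA n p X c t x) (M t) s β‖ₑ) *
          ‖igDens (a + (n : ℝ) / 2) (regR n p X y b c t x) s‖ₑ) *
        ‖∏ j, igDens 1 (1 + (x j)⁻¹) (ν j)‖ₑ) * ‖w t‖ₑ with hJ
  have hmtd : ∀ x', ‖regMTD n p X y a b c πτ x x'‖ₑ ≤ J x' := by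
    intro x'
    unfold regMTD
    refine (enorm_integral_le_lintegral_enorm _).trans ?_
    simp only [hJ]
    refine lintegral_mono fun t => ?_
    rw [enorm_mul]
    gcongr ?_ * _
    refine (enorm_integral_le_lintegral_enorm _).trans ?_
    refine lintegral_mono fun ν => ?_
    rw [enorm_mul]
    gcongr ?_ * _
    refine (enorm_integral_le_lintegral_enorm _).trans ?_
    refine lintegral_mono fun s => ?_
    rw [enorm_mul]
    gcongr ?_ * _
    refine (enorm_integral_le_lintegral_enorm _).trans ?_
    refine lintegral_mono fun β => ?_
    rw [enorm_mul]
  have hG : Measurable (fun z : (((ℝ × (Fin p → ℝ)) × (Fin p → ℝ)) × ℝ) × (Fin p → ℝ) =>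
      ‖∏ j, regLamDens c z.1.1.1.1 ((z.1.1.2 j)⁻¹ + (z.2 j) ^ 2 / (2 * z.1.2 * z.1.1.1.1))
        (z.1.1.1.2 j)‖ₑ) := by
    refine (Finset.measurable_prod _ fun j _ => ?_).enorm
    exact (regLamDens_meas c).comp
      (f := fun z : (((ℝ × (Fin p → ℝ)) × (Fin p → ℝ)) × ℝ) × (Fin p → ℝ) =>
      ((z.1.1.1.1, (z.1.1.2 j)⁻¹ + (z.2 j) ^ 2 / (2 * z.1.2 * z.1.1.1.1)), z.1.1.1.2 j))
      (by fun_prop)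
  have hg : Measurable (fun z : ℝ × ℝ × (Fin p → ℝ) =>
      ‖gaussDens p (regA n p X c z.1 x) (M z.1) z.2.1 z.2.2‖ₑ) := by
    refine (gaussDens_meas p (fun z : ℝ × ℝ × (Fin p → ℝ) => regA n p X c z.1 x)
      (fun i j => (regA_meas n p X c x i j).comp measurable_fst) (fun z => M z.1)
      (fun i => (hMm i).comp measurable_fst) (fun z => z.2.1) (by fun_prop) (fun z => z.2.2)
      (by fun_prop)).enorm
  have hi : Measurable (fun z : ℝ × ℝ =>
      ‖igDens (a + (n : ℝ) / 2) (regR n p X y b c z.1 x) z.2‖ₑ) := by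
    have := regR_meas n p X y b c x
    exact ((igDens_meas (a + (n : ℝ) / 2)).comp (f := fun z : ℝ × ℝ => (regR n p X y b c z.1 x, z.2))
      (by fun_prop)).enorm
  have hv : Measurable (fun ν : Fin p → ℝ => ‖∏ j, igDens 1 (1 + (x j)⁻¹) (ν j)‖ₑ) := by
    refine (Finset.measurable_prod _ fun j _ => ?_).enorm
    exact (igDens_meas 1).comp (f := fun ν : Fin p → ℝ => (1 + (x j)⁻¹, ν j)) (by fun_prop)
  have hsw : ∀ j, ∫⁻ x' in Set.univ.pi (fun _ : Fin p => Set.Ioi (0 : ℝ)),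
      J x' * ENNReal.ofReal (x' j ^ (-σ)) = _ ∧ Measurable J := fun j =>
    swap_all (volume.restrict (Set.Ioi (0:ℝ)))
      (volume.restrict (Set.univ.pi (fun _ : Fin p => Set.Ioi (0 : ℝ))))
      (volume.restrict (Set.Ioi (0:ℝ))) (volume : Measure (Fin p → ℝ))
      (volume.restrict (Set.univ.pi (fun _ : Fin p => Set.Ioi (0 : ℝ))))
      (fun t ν s β x' =>
        ‖∏ j, regLamDens c t ((ν j)⁻¹ + (β j) ^ 2 / (2 * s * t)) (x' j)‖ₑ) hG
      (fun t s β => ‖gaussDens p (regA n p X c t x) (M t) s β‖ₑ) hg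
      (fun t s => ‖igDens (a + (n : ℝ) / 2) (regR n p X y b c t x) s‖ₑ) hi
      _ hv _ hw (fun x' => ENNReal.ofReal (x' j ^ (-σ))) (by fun_prop)
  calc _ ≤ ∫⁻ x' in Set.univ.pi (fun _ : Fin p => Set.Ioi (0 : ℝ)),
        ∑ j, J x' * ENNReal.ofReal (x' j ^ (-σ)) := by
        refine setLIntegral_mono' (measSet_pi p) fun x' hx' => ?_
        have hx'0 : ∀ j, 0 < x' j := fun j => hx' j (Set.mem_univ j)
        have hs0 : ∀ j, 0 ≤ x' j ^ (-σ) := fun j => Real.rpow_nonneg (hx'0 j).le _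
        rw [mul_comm, ENNReal.ofReal_mul (Finset.sum_nonneg fun j _ => hs0 j),
          ENNReal.ofReal_sum_of_nonneg (fun j _ => hs0 j), ← Finset.mul_sum, mul_comm]
        gcongr
        exact (Real.ofReal_le_enorm _).trans (hmtd x')
    _ = ∑ j, ∫⁻ x' in Set.univ.pi (fun _ : Fin p => Set.Ioi (0 : ℝ)),
        J x' * ENNReal.ofReal (x' j ^ (-σ)) := by
        refine lintegral_finsetSum' _ fun j _ => ?_
        have := (hsw j).2
        exact (this.mul (by fun_prop)).aemeasurable
    _ ≤ _ := by
        refine Finset.sum_le_sum fun j _ => ?_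
        rw [(hsw j).1]
        refine setLIntegral_mono' measurableSet_Ioi fun t ht => ?_
        gcongr ?_ * _
        have hR := (regR_bounds n p X y b c t hc x ht hx).1
        exact phi_bound p c t ht _ (regA_posDef n p X c t hc x ht hx) _ _ _ (by positivity)
          (hb.trans_le hR) (fun j => 1 + (x j)⁻¹) (fun j => by have := hx j; positivity) j σ hσ


theorem W_lower (n p : ℕ) (X : Matrix (Fin n) (Fin p) ℝ) (c : ℝ) (hc : c ≠ 0) :
    ∃ B : ℝ, 0 < B ∧ ∀ x : Fin p → ℝ, (∀ j, 0 < x j) → ∀ t, 0 < t → ∀ j,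
      x j / (1 + B * (t * x j)) ≤ (regA n p X c t x)⁻¹ j j / t := by
  have hc2 : 0 < (c^2)⁻¹ := by positivity
  have hd : ∀ j, 0 ≤ (Xᵀ * X) j j := fun j => by
    rw [Matrix.mul_apply]
    exact Finset.sum_nonneg fun i _ => by rw [Matrix.transpose_apply]; exact mul_self_nonneg _
  refine ⟨∑ j, (Xᵀ * X) j j + (c^2)⁻¹, by have := Finset.sum_nonneg (s := Finset.univ) fun j _ => hd j; positivity,
    fun x hx t ht j => ?_⟩
  have h1 := inv_diag_ge (regA_posDef n p X c t hc x ht hx) j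
  have hxj := hx j
  refine le_trans ?_ (div_le_div_of_nonneg_right h1 ht.le)
  have h2 : (regA n p X c t x) j j ≤ (∑ j, (Xᵀ * X) j j + (c^2)⁻¹) + (t * x j)⁻¹ := by
    rw [regA_eq n p X c t x ht hx, Matrix.add_apply, Matrix.diagonal_apply_eq]
    have := Finset.single_le_sum (f := fun j => (Xᵀ * X) j j) (fun j _ => hd j) (Finset.mem_univ j)
    linarith
  have h3 : 0 < (regA n p X c t x) j j := (regA_posDef n p X c t hc x ht hx).diag_pos
  set B := ∑ j, (Xᵀ * X) j j + (c^2)⁻¹ with hB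
  have hB0 : 0 < B := by
    have := Finset.sum_nonneg (s := Finset.univ) fun j _ => hd j
    positivity
  have h4 : (B + (t * x j)⁻¹)⁻¹ ≤ ((regA n p X c t x) j j)⁻¹ := inv_anti₀ h3 h2
  refine le_trans (le_of_eq ?_) (div_le_div_of_nonneg_right h4 ht.le)
  field_simp
  ring

theorem tail_small (πτ : ℝ → ℝ) (hπ_nonneg : ∀ t, 0 ≤ πτ t) (hπi : IntegrableOn πτ (Set.Ioi 0))
    (ε : ℝ) (hε : 0 < ε) : ∃ T : ℝ, 0 < T ∧
      ∫⁻ t in Set.Ioi T, ENNReal.ofReal (πτ t) ≤ ENNReal.ofReal ε := by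
  have h := tendsto_setIntegral_of_antitone (μ := volume) (f := πτ)
    (s := fun n : ℕ => Set.Ioi (n : ℝ)) (fun n => measurableSet_Ioi)
    (fun m n hmn => Set.Ioi_subset_Ioi (by exact_mod_cast hmn)) ⟨0, by simpa using hπi⟩
  have he : (⋂ n : ℕ, Set.Ioi (n : ℝ)) = ∅ := by
    ext z
    simp only [Set.mem_iInter, Set.mem_Ioi, Set.mem_empty_iff_false, iff_false, not_forall, not_lt]
    exact exists_nat_ge z
  rw [he, Measure.restrict_empty, integral_zero_measure] at h
  obtain ⟨N, hN⟩ := ((h.eventually (gt_mem_nhds hε)).and (Filter.eventually_gt_atTop 0)).exists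
  refine ⟨N, by exact_mod_cast hN.2, ?_⟩
  rw [← ofReal_integral_eq_lintegral_ofReal (hπi.mono_set (Set.Ioi_subset_Ioi (by positivity)))
    (.of_forall hπ_nonneg)]
  exact ENNReal.ofReal_le_ofReal hN.1.le

theorem L_bound (x σ : ℝ) (hx : 0 < x) (hσ : 0 < σ) (hσ1 : σ ≤ 1) :
    (1 + x⁻¹) ^ σ ≤ 1 + x ^ (-σ) := by
  have := Real.rpow_add_le_add_rpow zero_le_one (inv_nonneg.2 hx.le) hσ.le hσ1
  rwa [Real.one_rpow, Real.inv_rpow hx.le, ← Real.rpow_neg hx.le] at this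


theorem stmt15 (n p : ℕ) (hn : 0 < n) (hp : 0 < p)
    (X : Matrix (Fin n) (Fin p) ℝ) (y : Fin n → ℝ)
    (a b c : ℝ) (ha : 0 < a) (hb : 0 < b) (hc : c ≠ 0)
    (πτ : ℝ → ℝ) (hπ_nonneg : ∀ t, 0 ≤ πτ t)
    (hπ_prob : ∫ t in Set.Ioi (0 : ℝ), πτ t = 1)
    (δ : ℝ) (hδ : δ ∈ Set.Ioo (0.00162 : ℝ) 0.22176)
    (hmom : IntegrableOn (fun u => u ^ (δ / 2) * πτ u) (Set.Ioi 0)) :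
    ∃ γ ∈ Set.Ioo (0 : ℝ) 1, ∃ bst : ℝ,
      ∀ x : Fin p → ℝ, (∀ j, 0 < x j) →
        (∫⁻ x' in Set.univ.pi (fun _ : Fin p => Set.Ioi (0 : ℝ)),
          ENNReal.ofReal (regMTD n p X y a b c πτ x x' *
            ∑ j, (x' j) ^ (-δ / 2))) ≤
        ENNReal.ofReal (γ * (∑ j, (x j) ^ (-δ / 2)) + bst) := by
  obtain ⟨hδ1, hδ2⟩ := hδ
  rw [neg_div]
  set σ := δ / 2 with hσdef
  have hσ : 0 < σ := by rw [hσdef]; norm_num at hδ1; linarith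
  have hσ2 : σ < 1 / 2 := by rw [hσdef]; norm_num at hδ2; linarith
  have hI := I_lt hσ hσ2
  have hC := C_fin hσ (by linarith)
  set I := ∫⁻ z in Set.Ioi (0:ℝ), ENNReal.ofReal (σ*z^(σ-1)*(1+z)^(-(3/2):ℝ)) with hIdef
  set C := ∫⁻ z in Set.Ioi (0:ℝ), ENNReal.ofReal (σ*z^(σ-1)*(1+z)⁻¹) with hCdef
  set ι := I.toReal with hι
  have hIι : I = ENNReal.ofReal ι := (ENNReal.ofReal_toReal (hI.trans ENNReal.one_lt_top).ne).symm
  have hCC : C = ENNReal.ofReal C.toReal := (ENNReal.ofReal_toReal hC.ne).symm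
  set Cs := C.toReal with hCs
  have hCs0 : 0 ≤ Cs := ENNReal.toReal_nonneg
  have hι0 : 0 ≤ ι := ENNReal.toReal_nonneg
  have hι1 : ι < 1 := by
    have := ENNReal.toReal_strict_mono ENNReal.one_ne_top hI
    simpa using this
  obtain ⟨K, hK, HK⟩ := regTau_weight n p X y a b c ha hb hc πτ hπ_nonneg hπ_prob
  obtain ⟨B, hB, HB⟩ := W_lower n p X c hc
  -- choice of η
  obtain ⟨η, hη, hη1⟩ : ∃ η : ℝ, 0 < η ∧ (1 + η) ^ (3/2 : ℝ) * ι < (1 + ι) / 2 := by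
    have ht : Filter.Tendsto (fun η : ℝ => (1 + η) ^ (3/2 : ℝ) * ι) (nhdsWithin 0 (Set.Ioi 0))
        (nhds ((1 + 0) ^ (3/2:ℝ) * ι)) := by
      refine Filter.Tendsto.mono_left ?_ nhdsWithin_le_nhds
      exact ((((continuous_const.add continuous_id).rpow_const
        (fun _ => Or.inr (by norm_num))).mul continuous_const).tendsto 0)
    have hlt : (1 + 0 : ℝ) ^ (3/2:ℝ) * ι < (1 + ι) / 2 := by
      rw [add_zero, Real.one_rpow]; linarith
    have := ht.eventually (gt_mem_nhds hlt)
    obtain ⟨η, h1, h2⟩ := (this.and self_mem_nhdsWithin).exists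
    exact ⟨η, h2, h1⟩
  set γ1 := (1 + ι) / 2 with hγ1
  set ε := (1 - ι) / 4 with hε
  have hε0 : 0 < ε := by rw [hε]; linarith
  obtain ⟨T, hT, HT⟩ := tail_small πτ hπ_nonneg (pi_integrable πτ hπ_prob) (ε / ((Cs + 1) * K))
    (by positivity)
  set x0 := min η (η / (B * T)) with hx0
  have hx00 : 0 < x0 := by rw [hx0]; exact lt_min hη (by positivity)
  set b0 := ε + Cs * (1 + x0⁻¹) ^ σ with hb0
  refine ⟨γ1 + ε, ⟨by rw [hγ1]; linarith, by rw [hγ1, hε]; linarith⟩, p * b0, fun x hx => ?_⟩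
  obtain ⟨hw, hwK, hw1⟩ := HK x hx
  refine (mtd_bound n p X y a b c ha hb hc πτ x hx hw σ hσ).trans ?_
  set w : ℝ → ENNReal := fun t => ‖regTauDens n p X y a b c πτ x t /
            ∫ u in Set.Ioi (0 : ℝ), regTauDens n p X y a b c πτ x u‖ₑ with hwdef
  have e : (γ1 + ε) * (∑ j, x j ^ (-σ)) + p * b0 = ∑ j, ((γ1 + ε) * x j ^ (-σ) + b0) := by
    rw [Finset.sum_add_distrib, ← Finset.mul_sum]; simp
  have hγ0 : 0 ≤ γ1 + ε := by rw [hγ1]; linarith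
  have hb00 : 0 ≤ b0 := by rw [hb0]; positivity
  have hxs : ∀ j, 0 ≤ x j ^ (-σ) := fun j => Real.rpow_nonneg (hx j).le _
  rw [e, ENNReal.ofReal_sum_of_nonneg (fun j _ => add_nonneg (mul_nonneg hγ0 (hxs j)) hb00)]
  refine Finset.sum_le_sum fun j _ => ?_
  have hxj := hx j
  have hW0 : ∀ t, 0 < t → 0 ≤ (regA n p X c t x)⁻¹ j j / t := fun t ht =>
    le_trans (by positivity) (HB x hx t ht j)
  have hQ1 : ∀ t, 0 < t → (∫⁻ q in Set.Ioi (0:ℝ), ENNReal.ofReal (σ * q ^ (σ - 1)) *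
      (ENNReal.ofReal ((1 + (x j)⁻¹) / ((1 + (x j)⁻¹) + q)) *
      ENNReal.ofReal ((1 + q * ((regA n p X c t x)⁻¹ j j / t)) ^ (-(1/2:ℝ))))) ≤
      ENNReal.ofReal ((1 + (x j)⁻¹) ^ σ * Cs) := fun t ht => by
    rw [ENNReal.ofReal_mul (by positivity), ← hCC]
    exact q_bound1 (by positivity) hσ (hW0 t ht)
  by_cases hxx : x j ≤ x0
  · have hxη : x j ≤ η := hxx.trans (min_le_left _ _)
    have hxB : x j ≤ η / (B * T) := hxx.trans (min_le_right _ _)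
    have hun : Set.Ioi (0:ℝ) = Set.Ioc 0 T ∪ Set.Ioi T := (Set.Ioc_union_Ioi_eq_Ioi hT.le).symm
    have hsub : Set.Ioc 0 T ⊆ Set.Ioi (0:ℝ) := fun t ht => ht.1
    have p1 : ∫⁻ t in Set.Ioc 0 T, (∫⁻ q in Set.Ioi (0:ℝ), ENNReal.ofReal (σ * q ^ (σ - 1)) *
      (ENNReal.ofReal ((1 + (x j)⁻¹) / ((1 + (x j)⁻¹) + q)) *
      ENNReal.ofReal ((1 + q * ((regA n p X c t x)⁻¹ j j / t)) ^ (-(1/2:ℝ))))) * w t ≤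
        ENNReal.ofReal (γ1 * x j ^ (-σ)) := by
      calc _ ≤ ∫⁻ t in Set.Ioc 0 T, ENNReal.ofReal (γ1 * x j ^ (-σ)) * w t := by
            refine setLIntegral_mono' measurableSet_Ioc fun t ht => ?_
            gcongr ?_ * _
            have hWt : x j / (1 + η) ≤ (regA n p X c t x)⁻¹ j j / t := by
              refine le_trans ?_ (HB x hx t ht.1 j)
              have ht0 := ht.1
              have : B * (t * x j) ≤ η := by
                calc B * (t * x j) ≤ B * (T * (η / (B * T))) := by
                      have := ht.2
                      gcongr
                  _ = η := by field_simp
              gcongr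
            refine (q_bound2 hxj hσ hη.le hxη hWt).trans ?_
            change _ * I ≤ _
            rw [hIι, ← ENNReal.ofReal_mul (by positivity)]
            refine ENNReal.ofReal_le_ofReal ?_
            calc x j ^ (-σ) * (1 + η) ^ (3/2:ℝ) * ι = x j ^ (-σ) * ((1 + η) ^ (3/2:ℝ) * ι) := by ring
              _ ≤ x j ^ (-σ) * γ1 := mul_le_mul_of_nonneg_left hη1.le (hxs j)
              _ = _ := mul_comm _ _
        _ = ENNReal.ofReal (γ1 * x j ^ (-σ)) * ∫⁻ t in Set.Ioc 0 T, w t :=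
            lintegral_const_mul' _ _ ENNReal.ofReal_ne_top
        _ ≤ _ := mul_le_of_le_one_right' ((lintegral_mono_set hsub).trans hw1)
    have p2 : ∫⁻ t in Set.Ioi T, (∫⁻ q in Set.Ioi (0:ℝ), ENNReal.ofReal (σ * q ^ (σ - 1)) *
      (ENNReal.ofReal ((1 + (x j)⁻¹) / ((1 + (x j)⁻¹) + q)) *
      ENNReal.ofReal ((1 + q * ((regA n p X c t x)⁻¹ j j / t)) ^ (-(1/2:ℝ))))) * w t ≤
        ENNReal.ofReal ((1 + x j ^ (-σ)) * ε) := by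
      calc _ ≤ ∫⁻ t in Set.Ioi T, (ENNReal.ofReal ((1 + (x j)⁻¹) ^ σ * Cs) * ENNReal.ofReal K) *
              ENNReal.ofReal (πτ t) := by
            refine setLIntegral_mono' measurableSet_Ioi fun t ht => ?_
            have ht0 : 0 < t := hT.trans ht
            rw [mul_assoc]
            exact mul_le_mul' (hQ1 t ht0) (hwK t ht0)
        _ = (ENNReal.ofReal ((1 + (x j)⁻¹) ^ σ * Cs) * ENNReal.ofReal K) *
              ∫⁻ t in Set.Ioi T, ENNReal.ofReal (πτ t) :=
            lintegral_const_mul' _ _ (ENNReal.mul_ne_top ENNReal.ofReal_ne_top ENNReal.ofReal_ne_top)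
        _ ≤ (ENNReal.ofReal ((1 + (x j)⁻¹) ^ σ * Cs) * ENNReal.ofReal K) *
              ENNReal.ofReal (ε / ((Cs + 1) * K)) := by gcongr
        _ ≤ _ := by
            rw [← ENNReal.ofReal_mul (by positivity), ← ENNReal.ofReal_mul (by positivity)]
            refine ENNReal.ofReal_le_ofReal ?_
            calc (1 + (x j)⁻¹) ^ σ * Cs * K * (ε / ((Cs + 1) * K))
                = (1 + (x j)⁻¹) ^ σ * (ε * (Cs / (Cs + 1))) := by field_simp
              _ ≤ (1 + x j ^ (-σ)) * (ε * 1) := by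
                  have h1 := L_bound (x j) σ hxj hσ (by linarith)
                  have h2 : Cs / (Cs + 1) ≤ 1 := by rw [div_le_one (by positivity)]; linarith
                  have h3 := hxs j
                  gcongr
              _ = _ := by ring
    have hsplit : ∀ f : ℝ → ENNReal, ∫⁻ t in Set.Ioi (0:ℝ), f t =
        (∫⁻ t in Set.Ioc 0 T, f t) + ∫⁻ t in Set.Ioi T, f t := fun f => by
      rw [hun, lintegral_union measurableSet_Ioi (Set.Ioc_disjoint_Ioi le_rfl)]
    refine (hsplit _).trans_le ?_
    refine (add_le_add p1 p2).trans ?_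
    have h3 := hxs j
    have hγ10 : 0 ≤ γ1 := by rw [hγ1]; linarith
    rw [← ENNReal.ofReal_add (by positivity) (by positivity)]
    refine ENNReal.ofReal_le_ofReal ?_
    have : 0 ≤ Cs * (1 + x0⁻¹) ^ σ := by positivity
    rw [hb0]
    linarith
  · push Not at hxx
    calc _ ≤ ∫⁻ t in Set.Ioi (0:ℝ), ENNReal.ofReal ((1 + (x j)⁻¹) ^ σ * Cs) * w t := by
          refine setLIntegral_mono' measurableSet_Ioi fun t ht => ?_
          exact mul_le_mul_left (hQ1 t ht) _
      _ = ENNReal.ofReal ((1 + (x j)⁻¹) ^ σ * Cs) * ∫⁻ t in Set.Ioi (0:ℝ), w t :=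
          lintegral_const_mul' _ _ ENNReal.ofReal_ne_top
      _ ≤ ENNReal.ofReal ((1 + (x j)⁻¹) ^ σ * Cs) := mul_le_of_le_one_right' hw1
      _ ≤ _ := by
          refine ENNReal.ofReal_le_ofReal ?_
          have h1 : (1 + (x j)⁻¹) ^ σ * Cs ≤ (1 + x0⁻¹) ^ σ * Cs := by gcongr
          have h2 := mul_nonneg hγ0 (hxs j)
          rw [hb0]
          linarith
end

section
/- Fix δ ∈ (0,1) and let Ṽ(x) = Σ_{j=1}^p x_j^{−δ/2}. Then for every d > 0 there exist ε* > 0 and a probability density h on (0,∞)^p such that k_c(x, x′) ≥ ε* h(x′) for every x′ ∈ (0,∞)^p and every x ∈ (0,∞)^p with Ṽ(x) ≤ d. -/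
open Matrix MeasureTheory

lemma hs_one_le_det {m p : ℕ} (Y : Matrix (Fin m) (Fin p) ℝ) :
    1 ≤ (1 + Yᵀ * Y).det := by
  have hP : (Yᵀ * Y).PosSemidef := by
    have := Matrix.posSemidef_conjTranspose_mul_self Y
    simpa [Matrix.conjTranspose_eq_transpose_of_trivial] using this
  have hH : (1 + Yᵀ * Y).IsHermitian := Matrix.isHermitian_one.add hP.1
  rw [hH.det_eq_prod_eigenvalues]
  have : ∀ i, 1 ≤ hH.eigenvalues i := by
    intro i
    have h1 := hH.mulVec_eigenvectorBasis i
    set v : Fin p → ℝ := (hH.eigenvectorBasis i).ofLp with hv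
    have h2 : 0 ≤ v ⬝ᵥ ((Yᵀ * Y) *ᵥ v) := by
      have := hP.dotProduct_mulVec_nonneg v
      simpa using this
    have h3 : v ⬝ᵥ v = 1 := by
      have := hH.eigenvectorBasis.orthonormal.1 i
      have h4 : inner ℝ (hH.eigenvectorBasis i) (hH.eigenvectorBasis i) = (1:ℝ) := by
        rw [real_inner_self_eq_norm_sq, this]; norm_num
      rw [EuclideanSpace.inner_eq_star_dotProduct] at h4
      simpa using h4
    have h5 : v ⬝ᵥ ((1 + Yᵀ * Y) *ᵥ v) = hH.eigenvalues i := by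
      rw [h1, dotProduct_smul, h3]; simp
    rw [Matrix.add_mulVec, Matrix.one_mulVec, dotProduct_add, h3] at h5
    linarith
  have h := Finset.prod_le_prod (s := Finset.univ) (f := fun _ : Fin p => (1:ℝ)) (g := hH.eigenvalues) (fun _ _ => zero_le_one) (fun i _ => this i)
  simpa using h

lemma hs_det_ge {m p : ℕ} (X : Matrix (Fin m) (Fin p) ℝ) (D : Fin p → ℝ) (hD : ∀ j, 0 < D j) :
    ∏ j, D j ≤ (Xᵀ * X + Matrix.diagonal D).det := by
  set S : Matrix (Fin p) (Fin p) ℝ := Matrix.diagonal (fun j => (Real.sqrt (D j))⁻¹) with hS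
  have hsq : ∀ j, 0 < Real.sqrt (D j) := fun j => Real.sqrt_pos.2 (hD j)
  have key : S * (Xᵀ * X + Matrix.diagonal D) * S = 1 + (X * S)ᵀ * (X * S) := by
    have hSt : Sᵀ = S := by simp [hS]
    have : S * Matrix.diagonal D * S = 1 := by
      rw [hS, Matrix.diagonal_mul_diagonal, Matrix.diagonal_mul_diagonal, ← Matrix.diagonal_one]
      congr 1; ext j
      have := Real.mul_self_sqrt (hD j).le
      have h2 := (hsq j).ne'
      field_simp
      nlinarith
    rw [Matrix.mul_add, Matrix.add_mul, this, Matrix.transpose_mul, hSt, add_comm]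
    simp only [Matrix.mul_assoc]
  have h1 := hs_one_le_det (X * S)
  rw [← key, Matrix.det_mul, Matrix.det_mul] at h1
  have hdS : S.det * S.det * ∏ j, D j = 1 := by
    rw [hS, Matrix.det_diagonal, ← Finset.prod_mul_distrib, ← Finset.prod_mul_distrib]
    apply Finset.prod_eq_one
    intro j _
    have := Real.mul_self_sqrt (hD j).le
    have h2 := (hsq j).ne'
    field_simp
    nlinarith
  have hpos : 0 < ∏ j, D j := Finset.prod_pos fun j _ => hD j
  nlinarith [mul_le_mul_of_nonneg_left h1 hpos.le]

lemma hs_ig_int (α b : ℝ) (hα : 0 < α) (hb : 0 < b) :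
    IntegrableOn (fun s : ℝ => s ^ (-α - 1) * Real.exp (-b / s)) (Set.Ioi 0) := by
  have h := integrableOn_rpow_mul_exp_neg_mul_rpow (p := 1) (s := α - 1) (b := b) (by linarith) one_pos hb
  rw [← integrableOn_Ioi_comp_rpow_iff _ (p := -1) (by norm_num)] at h
  refine h.congr_fun (fun s hs => ?_) measurableSet_Ioi
  have hs : 0 < s := hs
  simp only [abs_neg, abs_one, one_mul, smul_eq_mul, ← Real.rpow_mul hs.le]
  rw [← mul_assoc, ← Real.rpow_add hs, mul_one (-1 : ℝ), Real.rpow_neg_one, ← div_eq_mul_inv]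
  congr 2
  ring

lemma hs_low {α : Type*} [MeasurableSpace α] {μ : Measure α} {f : α → ℝ} {s : Set α} {κ : ℝ}
    (hf : Integrable f μ) (h0 : 0 ≤ᵐ[μ] f) (hs : MeasurableSet s) (hμ : μ s = 1)
    (h : ∀ x ∈ s, κ ≤ f x) : κ ≤ ∫ x, f x ∂μ := by
  have h1 := setIntegral_ge_of_const_le_real hs (by simp [hμ]) h hf.integrableOn
  simp only [Measure.real, hμ, ENNReal.toReal_one, mul_one] at h1
  exact h1.trans (setIntegral_le_integral hf h0)

/-- bound on the integral of a product -/
lemma hs_bd {α : Type*} [MeasurableSpace α] {μ : Measure α} {f g : α → ℝ}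
    {C : ℝ} (hfm : AEStronglyMeasurable f μ) (hg : Integrable g μ)
    (hf0 : ∀ᵐ x ∂μ, 0 ≤ f x) (hfg : ∀ᵐ x ∂μ, f x ≤ C * g x) :
    Integrable f μ ∧ 0 ≤ ∫ x, f x ∂μ ∧ ∫ x, f x ∂μ ≤ C * ∫ x, g x ∂μ := by
  have h1 : Integrable f μ := by
    refine (hg.const_mul C).mono' hfm ?_
    filter_upwards [hf0, hfg] with x h1 h2
    rwa [Real.norm_of_nonneg h1]
  refine ⟨h1, integral_nonneg_of_ae hf0, ?_⟩
  rw [← integral_const_mul]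
  exact integral_mono_ae h1 (hg.const_mul C) hfg

lemma hs_box (p : ℕ) : volume (Set.univ.pi (fun _ : Fin p => Set.Icc (1:ℝ) 2)) = 1 := by
  rw [volume_pi_pi]; simp; norm_num

lemma hs_main (p : ℕ) (L : ℝ → (Fin p → ℝ) → ℝ → (Fin p → ℝ) → ℝ)
    (G : ℝ → ℝ → (Fin p → ℝ) → ℝ) (I : ℝ → ℝ → ℝ) (V : (Fin p → ℝ) → ℝ) (T πτ g : ℝ → ℝ)
    (J : ℝ → ℝ)
    (hLm : Measurable (fun q : ((ℝ × (Fin p → ℝ)) × ℝ) × (Fin p → ℝ) => L q.1.1.1 q.1.1.2 q.1.2 q.2))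
    (hGm : Measurable (fun q : ((ℝ × (Fin p → ℝ)) × ℝ) × (Fin p → ℝ) => G q.1.1.1 q.1.2 q.2))
    (hIm : Measurable (fun q : (ℝ × (Fin p → ℝ)) × ℝ => I q.1.1 q.2))
    (hVm : Measurable V)
    (hTm : AEStronglyMeasurable T (volume.restrict (Set.Ioi 0)))
    (hπ : IntegrableOn πτ (Set.Ioi 0)) (hπ0 : ∀ t, 0 ≤ πτ t)
    (C : ℝ)
    (hL : ∀ t ν s β, 0 < t → (∀ j, 0 < ν j) → 0 < s → 0 ≤ L t ν s β ∧ L t ν s β ≤ C)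
    (hG0 : ∀ t s β, 0 < t → 0 < s → 0 ≤ G t s β)
    (hGi : ∀ t s, 0 < t → 0 < s → Integrable (G t s))
    (hGg : ∀ t s, 0 < t → 0 < s → ∫ β, G t s β ≤ g t)
    (hI : ∀ t s, 0 < t → 0 < s → 0 ≤ I t s ∧ I t s ≤ J s)
    (hJ : IntegrableOn J (Set.Ioi 0))
    (hV0 : ∀ ν, (∀ j, 0 < ν j) → 0 ≤ V ν)
    (hV : IntegrableOn V (Set.univ.pi (fun _ => Set.Ioi 0)))
    (K : ℝ) (hT0 : ∀ t, 0 < t → 0 ≤ T t) (hT : ∀ t, 0 < t → g t * T t ≤ K * πτ t) :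
    0 ≤ (∫ t in Set.Ioi (0 : ℝ),
      (∫ ν in Set.univ.pi (fun _ : Fin p => Set.Ioi (0 : ℝ)),
        (∫ s in Set.Ioi (0 : ℝ), (∫ β : Fin p → ℝ, L t ν s β * G t s β) * I t s) * V ν) * T t)
    ∧ ∀ (t0 κ1 κ2 κ3 κ4 : ℝ), 0 < t0 → 0 ≤ κ1 → 0 ≤ κ2 → 0 ≤ κ3 → 0 ≤ κ4 →
      (∀ t ν s β, t0 < t → (∀ j, ν j ∈ Set.Icc (1:ℝ) 2) → s ∈ Set.Icc (1:ℝ) 2 →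
        (∀ j, β j ∈ Set.Icc (1:ℝ) 2) → κ1 ≤ L t ν s β * G t s β) →
      (∀ t s, t0 < t → s ∈ Set.Icc (1:ℝ) 2 → κ2 ≤ I t s) →
      (∀ ν, (∀ j, ν j ∈ Set.Icc (1:ℝ) 2) → κ3 ≤ V ν) →
      (∀ t, t0 < t → κ4 * πτ t ≤ T t) →
      κ1 * κ2 * κ3 * κ4 * (∫ t in Set.Ioi t0, πτ t) ≤ (∫ t in Set.Ioi (0 : ℝ),
      (∫ ν in Set.univ.pi (fun _ : Fin p => Set.Ioi (0 : ℝ)),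
        (∫ s in Set.Ioi (0 : ℝ), (∫ β : Fin p → ℝ, L t ν s β * G t s β) * I t s) * V ν) * T t) := by
  classical
  have hpi : MeasurableSet (Set.univ.pi (fun _ : Fin p => Set.Ioi (0:ℝ))) :=
    MeasurableSet.univ_pi fun _ => measurableSet_Ioi
  have hbox : MeasurableSet (Set.univ.pi (fun _ : Fin p => Set.Icc (1:ℝ) 2)) :=
    MeasurableSet.univ_pi fun _ => measurableSet_Icc
  have hC : 0 ≤ C := by
    obtain ⟨h1, h2⟩ := hL 1 (fun _ => 1) 1 0 one_pos (fun _ => one_pos) one_pos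
    linarith
  have hg : ∀ t, 0 < t → 0 ≤ g t := fun t ht =>
    (integral_nonneg (fun β => hG0 t 1 β ht one_pos)).trans (hGg t 1 ht one_pos)
  -- layer 1
  set F1 : ℝ → (Fin p → ℝ) → ℝ → ℝ := fun t ν s => ∫ β : Fin p → ℝ, L t ν s β * G t s β with hF1
  have m1 : Measurable (fun q : (ℝ × (Fin p → ℝ)) × ℝ => F1 q.1.1 q.1.2 q.2) :=
    ((hLm.mul hGm).stronglyMeasurable.integral_prod_right').measurable
  have b1 : ∀ t ν s, 0 < t → (∀ j, 0 < ν j) → 0 < s →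
      Integrable (fun β => L t ν s β * G t s β) ∧ 0 ≤ F1 t ν s ∧ F1 t ν s ≤ C * g t := by
    intro t ν s ht hν hs
    have := hs_bd (μ := volume) (f := fun β => L t ν s β * G t s β) (g := G t s) (C := C)
      (((hLm.mul hGm).comp (measurable_prodMk_left (x := ((t, ν), s)))).aestronglyMeasurable)
      (hGi t s ht hs) (ae_of_all _ fun β => mul_nonneg (hL t ν s β ht hν hs).1 (hG0 t s β ht hs))
      (ae_of_all _ fun β => mul_le_mul_of_nonneg_right (hL t ν s β ht hν hs).2 (hG0 t s β ht hs))
    exact ⟨this.1, this.2.1, this.2.2.trans (mul_le_mul_of_nonneg_left (hGg t s ht hs) hC)⟩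
  -- layer 2
  set F2 : ℝ → (Fin p → ℝ) → ℝ := fun t ν => ∫ s in Set.Ioi (0 : ℝ), F1 t ν s * I t s with hF2
  have m2 : Measurable (fun q : ℝ × (Fin p → ℝ) => F2 q.1 q.2) :=
    ((m1.mul hIm).stronglyMeasurable.integral_prod_right').measurable
  have b2 : ∀ t ν, 0 < t → (∀ j, 0 < ν j) →
      IntegrableOn (fun s => F1 t ν s * I t s) (Set.Ioi 0) ∧ 0 ≤ F2 t ν ∧
        F2 t ν ≤ C * g t * ∫ s in Set.Ioi (0:ℝ), J s := by
    intro t ν ht hν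
    refine hs_bd (μ := volume.restrict (Set.Ioi 0)) (f := fun s => F1 t ν s * I t s) (g := J)
      (C := C * g t)
      (((m1.mul hIm).comp (measurable_prodMk_left (x := (t, ν)))).aestronglyMeasurable)
      hJ (ae_restrict_of_forall_mem measurableSet_Ioi fun s hs => ?_)
      (ae_restrict_of_forall_mem measurableSet_Ioi fun s hs => ?_)
    · exact mul_nonneg (b1 t ν s ht hν hs).2.1 (hI t s ht hs).1
    · exact mul_le_mul (b1 t ν s ht hν hs).2.2 (hI t s ht hs).2 (hI t s ht hs).1
        (mul_nonneg hC (hg t ht))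
  -- layer 3
  set F3 : ℝ → ℝ := fun t => ∫ ν in Set.univ.pi (fun _ : Fin p => Set.Ioi (0 : ℝ)), F2 t ν * V ν
    with hF3
  have m3' : Measurable (fun q : ℝ × (Fin p → ℝ) => F2 q.1 q.2 * V q.2) :=
    m2.mul (hVm.comp measurable_snd)
  have m3 : Measurable F3 := (m3'.stronglyMeasurable.integral_prod_right').measurable
  set JJ := ∫ s in Set.Ioi (0:ℝ), J s
  set VV := ∫ ν in Set.univ.pi (fun _ : Fin p => Set.Ioi (0 : ℝ)), V ν
  have b3 : ∀ t, 0 < t →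
      IntegrableOn (fun ν => F2 t ν * V ν) (Set.univ.pi (fun _ : Fin p => Set.Ioi (0 : ℝ))) ∧
      0 ≤ F3 t ∧ F3 t ≤ C * g t * JJ * VV := by
    intro t ht
    refine hs_bd (μ := volume.restrict (Set.univ.pi (fun _ : Fin p => Set.Ioi (0 : ℝ))))
      (f := fun ν => F2 t ν * V ν) (g := V) (C := C * g t * JJ)
      ((m3'.comp (measurable_prodMk_left (x := t))).aestronglyMeasurable)
      hV (ae_restrict_of_forall_mem hpi fun ν hν => ?_)
      (ae_restrict_of_forall_mem hpi fun ν hν => ?_)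
    · have hν : ∀ j, 0 < ν j := fun j => hν j (Set.mem_univ _)
      exact mul_nonneg (b2 t ν ht hν).2.1 (hV0 ν hν)
    · have hν : ∀ j, 0 < ν j := fun j => hν j (Set.mem_univ _)
      exact mul_le_mul_of_nonneg_right (b2 t ν ht hν).2.2 (hV0 ν hν)
  have hJJ : 0 ≤ JJ := setIntegral_nonneg measurableSet_Ioi fun s hs =>
    (hI 1 s one_pos hs).1.trans (hI 1 s one_pos hs).2
  have hVV : 0 ≤ VV := setIntegral_nonneg hpi fun ν hν => hV0 ν fun j => hν j (Set.mem_univ _)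
  have b4 := hs_bd (μ := volume.restrict (Set.Ioi 0)) (f := fun t => F3 t * T t) (g := πτ)
      (C := C * JJ * VV * K) (m3.aestronglyMeasurable.mul hTm) hπ
      (ae_restrict_of_forall_mem measurableSet_Ioi fun t ht =>
        mul_nonneg (b3 t ht).2.1 (hT0 t ht))
      (ae_restrict_of_forall_mem measurableSet_Ioi fun t ht => by
        calc F3 t * T t ≤ (C * g t * JJ * VV) * T t :=
              mul_le_mul_of_nonneg_right (b3 t ht).2.2 (hT0 t ht)
          _ = (C * JJ * VV) * (g t * T t) := by ring
          _ ≤ (C * JJ * VV) * (K * πτ t) :=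
              mul_le_mul_of_nonneg_left (hT t ht) (by positivity)
          _ = _ := by ring)
  refine ⟨b4.2.1, ?_⟩
  intro t0 κ1 κ2 κ3 κ4 ht0 h1 h2 h3 h4 H1 H2 H3 H4
  have c1 : ∀ t ν s, t0 < t → (∀ j, ν j ∈ Set.Icc (1:ℝ) 2) → s ∈ Set.Icc (1:ℝ) 2 →
      κ1 ≤ F1 t ν s := by
    intro t ν s ht hν hs
    have hν' : ∀ j, 0 < ν j := fun j => one_pos.trans_le (hν j).1
    have hs' : 0 < s := one_pos.trans_le hs.1
    have ht' := ht0.trans ht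
    exact hs_low (b1 t ν s ht' hν' hs').1
      (ae_of_all _ fun β => mul_nonneg (hL t ν s β ht' hν' hs').1 (hG0 t s β ht' hs'))
      hbox (hs_box p) (fun β hβ => H1 t ν s β ht hν hs fun j => hβ j (Set.mem_univ _))
  have c2 : ∀ t ν, t0 < t → (∀ j, ν j ∈ Set.Icc (1:ℝ) 2) → κ1 * κ2 ≤ F2 t ν := by
    intro t ν ht hν
    have hν' : ∀ j, 0 < ν j := fun j => one_pos.trans_le (hν j).1
    have ht' := ht0.trans ht
    refine hs_low (s := Set.Icc 1 2) (b2 t ν ht' hν').1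
      (ae_restrict_of_forall_mem measurableSet_Ioi fun s hs =>
        mul_nonneg (b1 t ν s ht' hν' hs).2.1 (hI t s ht' hs).1)
      measurableSet_Icc ?_ (fun s hs => mul_le_mul (c1 t ν s ht hν hs) (H2 t s ht hs) h2
        (h1.trans (c1 t ν s ht hν hs)))
    rw [Measure.restrict_apply measurableSet_Icc, Set.inter_eq_left.2]
    · simp; norm_num
    · intro s hs; exact one_pos.trans_le hs.1
  have c3 : ∀ t, t0 < t → κ1 * κ2 * κ3 ≤ F3 t := by
    intro t ht
    have ht' := ht0.trans ht
    refine hs_low (s := Set.univ.pi (fun _ : Fin p => Set.Icc (1:ℝ) 2)) (b3 t ht').1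
      (ae_restrict_of_forall_mem hpi fun ν hν =>
        mul_nonneg (b2 t ν ht' fun j => hν j (Set.mem_univ _)).2.1
          (hV0 ν fun j => hν j (Set.mem_univ _)))
      hbox ?_ (fun ν hν => mul_le_mul (c2 t ν ht fun j => hν j (Set.mem_univ _))
        (H3 ν fun j => hν j (Set.mem_univ _)) h3
        ((mul_nonneg h1 h2).trans (c2 t ν ht fun j => hν j (Set.mem_univ _))))
    rw [Measure.restrict_apply hbox, Set.inter_eq_left.2]
    · exact hs_box p
    · intro ν hν j _; exact one_pos.trans_le (hν j (Set.mem_univ _)).1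
  have hsub : Set.Ioi t0 ⊆ Set.Ioi 0 := Set.Ioi_subset_Ioi ht0.le
  calc κ1 * κ2 * κ3 * κ4 * (∫ t in Set.Ioi t0, πτ t)
      = ∫ t in Set.Ioi t0, κ1 * κ2 * κ3 * κ4 * πτ t := (integral_const_mul _ _).symm
    _ ≤ ∫ t in Set.Ioi t0, F3 t * T t := by
        refine setIntegral_mono_on ((hπ.mono_set hsub).const_mul _) (b4.1.mono_measure
          (Measure.restrict_mono hsub le_rfl)) measurableSet_Ioi fun t ht => ?_
        rw [mul_assoc]
        exact mul_le_mul (c3 t ht) (H4 t ht) (mul_nonneg h4 (hπ0 t)) (b3 t (hsub ht)).2.1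
    _ ≤ ∫ t in Set.Ioi 0, F3 t * T t := by
        refine setIntegral_mono_set b4.1 ?_ (Filter.Eventually.of_forall hsub)
        exact ae_restrict_of_forall_mem measurableSet_Ioi fun t ht =>
          mul_nonneg (b3 t ht).2.1 (hT0 t ht)

lemma hs_rpow32 (u : ℝ) (hu : 0 < u) : u ^ (-(3 : ℝ) / 2) = (Real.sqrt u ^ 3)⁻¹ := by
  rw [Real.sqrt_eq_rpow, ← Real.rpow_natCast, ← Real.rpow_mul hu.le, ← Real.rpow_neg hu.le]
  congr 1; norm_num

lemma hs_ker_nonneg (c t r u : ℝ) (ht : 0 < t) (hu : 0 < u) : 0 ≤ regLamKernel c t r u := by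
  unfold regLamKernel; positivity

lemma hs_ker_meas (c : ℝ) :
    Measurable (fun q : (ℝ × ℝ) × ℝ => regLamKernel c q.1.1 q.1.2 q.2) := by
  unfold regLamKernel; fun_prop

lemma hs_ker_int (c t r : ℝ) (ht : 0 < t) (hr : 0 < r) :
    IntegrableOn (regLamKernel c t r) (Set.Ioi 0) := by
  have h1 := (hs_ig_int (1/2) r (by norm_num) hr).const_mul (1 + (c^2)⁻¹)
  have h2 := (hs_ig_int (3/2) r (by norm_num) hr).const_mul (t⁻¹)
  refine (h1.add h2).mono' ?_ (ae_restrict_of_forall_mem measurableSet_Ioi fun u hu => ?_)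
  · exact ((hs_ker_meas c).comp (measurable_prodMk_left (x := (t, r)))).aestronglyMeasurable
  · have hu : 0 < u := hu
    rw [Real.norm_of_nonneg (hs_ker_nonneg c t r u ht hu)]
    unfold regLamKernel
    have hq : 0 ≤ (c^2)⁻¹ := by positivity
    have hA : 0 ≤ (c ^ 2)⁻¹ + (t * u)⁻¹ := by positivity
    have e1 : ((c ^ 2)⁻¹ + (t * u)⁻¹) ^ ((1 : ℝ) / 2) ≤ 1 + (c ^ 2)⁻¹ + t⁻¹ * u⁻¹ := by
      rw [← Real.sqrt_eq_rpow, Real.sqrt_le_iff]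
      rw [mul_inv] at *
      constructor
      · linarith
      · nlinarith
    have e2 : u ^ (-(3/2 : ℝ) - 1) = u⁻¹ * u ^ (-(3 : ℝ) / 2) := by
      rw [← Real.rpow_neg_one, ← Real.rpow_add hu]; norm_num
    have e3 : u ^ (-(1/2 : ℝ) - 1) = u ^ (-(3 : ℝ) / 2) := by norm_num
    simp only [Pi.add_apply, e2, e3]
    calc _ ≤ (1 + (c ^ 2)⁻¹ + t⁻¹ * u⁻¹) * u ^ (-(3 : ℝ) / 2) * Real.exp (-r / u) := by gcongr
      _ = _ := by ring

lemma hs_N_ge (c t r : ℝ) (ht : 0 < t) (hr : 0 < r) :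
    Real.sqrt ((c ^ 2)⁻¹ + (t * (2 * r))⁻¹) * ((Real.sqrt 2 * Real.sqrt r) ^ 3)⁻¹ *
      Real.exp (-1) * r ≤ ∫ v in Set.Ioi (0 : ℝ), regLamKernel c t r v := by
  have hsub : Set.Icc r (2 * r) ⊆ Set.Ioi 0 := fun v hv => hr.trans_le hv.1
  have h := setIntegral_ge_of_const_le_real (μ := volume) (f := regLamKernel c t r)
    (c := Real.sqrt ((c ^ 2)⁻¹ + (t * (2 * r))⁻¹) * ((Real.sqrt 2 * Real.sqrt r) ^ 3)⁻¹ *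
      Real.exp (-1)) (measurableSet_Icc (a := r) (b := 2 * r)) (by simp) (fun v hv => ?_)
    ((hs_ker_int c t r ht hr).mono_set hsub)
  · have hv : volume.real (Set.Icc r (2 * r)) = r := by
      rw [Real.volume_real_Icc]; rw [max_eq_left] <;> linarith
    rw [hv] at h
    refine h.trans (setIntegral_mono_set (hs_ker_int c t r ht hr) ?_
      (Filter.Eventually.of_forall hsub))
    exact ae_restrict_of_forall_mem measurableSet_Ioi fun u hu => hs_ker_nonneg c t r u ht hu
  · have hv0 : 0 < v := hsub hv
    unfold regLamKernel
    rw [hs_rpow32 v hv0, ← Real.sqrt_eq_rpow]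
    have e1 : Real.sqrt v ≤ Real.sqrt 2 * Real.sqrt r := by
      rw [← Real.sqrt_mul (by norm_num)]; exact Real.sqrt_le_sqrt hv.2
    have e2 : -1 ≤ -r / v := by
      rw [neg_div, neg_le_neg_iff, div_le_one hv0]; exact hv.1
    have e3 : 0 < Real.sqrt v := Real.sqrt_pos.2 hv0
    have e4 : v ≤ 2 * r := hv.2
    gcongr

lemma hs_N_pos (c t r : ℝ) (ht : 0 < t) (hr : 0 < r) :
    0 < ∫ v in Set.Ioi (0 : ℝ), regLamKernel c t r v := by
  refine lt_of_lt_of_le ?_ (hs_N_ge c t r ht hr)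
  have : 0 < Real.sqrt ((c ^ 2)⁻¹ + (t * (2 * r))⁻¹) := Real.sqrt_pos.2 (by positivity)
  positivity

lemma hs_lam_nonneg (c t r u : ℝ) (ht : 0 < t) (hr : 0 < r) (hu : 0 < u) :
    0 ≤ regLamDens c t r u :=
  div_nonneg (hs_ker_nonneg c t r u ht hu) (hs_N_pos c t r ht hr).le

lemma hs_lam_le (c t r u : ℝ) (ht : 0 < t) (hr : 0 < r) (hu : 0 < u) :
    regLamDens c t r u ≤ Real.sqrt 2 ^ 3 * Real.exp 1 / u := by
  unfold regLamDens
  rw [div_le_iff₀ (hs_N_pos c t r ht hr)]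
  refine le_trans ?_ (mul_le_mul_of_nonneg_left (hs_N_ge c t r ht hr) (by positivity))
  unfold regLamKernel
  rw [hs_rpow32 u hu, ← Real.sqrt_eq_rpow]
  have hz : 0 < r / u := by positivity
  have e1 : Real.sqrt ((c ^ 2)⁻¹ + (t * u)⁻¹) ≤
      Real.sqrt (1 + 2 * (r / u)) * Real.sqrt ((c ^ 2)⁻¹ + (t * (2 * r))⁻¹) := by
    rw [← Real.sqrt_mul (by positivity)]
    apply Real.sqrt_le_sqrt
    have : (1 + 2 * (r / u)) * ((c ^ 2)⁻¹ + (t * (2 * r))⁻¹) =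
      (c ^ 2)⁻¹ + (t * u)⁻¹ + ((t * (2 * r))⁻¹ + 2 * (r / u) * (c ^ 2)⁻¹) := by
      have : 2 * (r / u) * (t * (2 * r))⁻¹ = (t * u)⁻¹ := by field_simp
      linear_combination this
    rw [this]
    have : 0 ≤ (t * (2 * r))⁻¹ + 2 * (r / u) * (c ^ 2)⁻¹ := by positivity
    linarith
  have e2 : Real.sqrt (1 + 2 * (r / u)) * (Real.sqrt r / Real.sqrt u) * Real.exp (-r / u) ≤ 1 := by
    rw [← Real.sqrt_div hr.le, ← Real.sqrt_mul (by positivity), neg_div, Real.exp_neg,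
      ← div_eq_mul_inv, div_le_one (Real.exp_pos _), Real.sqrt_le_iff]
    refine ⟨(Real.exp_pos _).le, ?_⟩
    have h := Real.quadratic_le_exp_of_nonneg hz.le
    have h1 := Real.add_one_le_exp (r / u)
    nlinarith [mul_self_nonneg (r/u), mul_pos hz hz, mul_pos hz (mul_pos hz hz), mul_pos (mul_pos hz hz) (mul_pos hz hz)]
  have hR : 0 < Real.sqrt r := Real.sqrt_pos.2 hr
  have hU : 0 < Real.sqrt u := Real.sqrt_pos.2 hu
  have hR2 : r = Real.sqrt r ^ 2 := (Real.sq_sqrt hr.le).symm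
  have hU2 : u = Real.sqrt u ^ 2 := (Real.sq_sqrt hu.le).symm
  have h22 : 0 < Real.sqrt 2 := by positivity
  set B := Real.sqrt ((c ^ 2)⁻¹ + (t * (2 * r))⁻¹)
  set W := Real.sqrt (1 + 2 * (r / u))
  set E := Real.exp (-r / u)
  have hE : 0 < E := Real.exp_pos _
  have hB : 0 ≤ B := Real.sqrt_nonneg _
  set R := Real.sqrt r
  set U := Real.sqrt u
  calc _ ≤ W * B * (U ^ 3)⁻¹ * E := by gcongr
    _ = (B * (U^2)⁻¹ * R⁻¹) * (W * (R / U) * E) := by field_simp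
    _ ≤ (B * (U^2)⁻¹ * R⁻¹) * 1 := mul_le_mul_of_nonneg_left e2 (by positivity)
    _ = _ := by
      rw [Real.exp_neg, hU2, hR2]
      have : Real.exp 1 ≠ 0 := (Real.exp_pos _).ne'
      field_simp

lemma hs_lam_ge (c t t0 r R u : ℝ) (ht0 : 0 < t0) (ht : t0 < t) (hr : 1/2 ≤ r) (hR : r ≤ R)
    (hu : u ∈ Set.Icc (1:ℝ) 2) :
    Real.sqrt ((c^2)⁻¹) * (Real.sqrt 2 ^ 3)⁻¹ * Real.exp (-R) /
      (∫ v in Set.Ioi (0 : ℝ), regLamKernel c t0 (1/2) v) ≤ regLamDens c t r u := by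
  have ht' := ht0.trans ht
  have hr' : 0 < r := by linarith
  have hu0 : 0 < u := by linarith [hu.1]
  unfold regLamDens
  refine div_le_div₀ (hs_ker_nonneg _ _ _ _ ht' hu0) ?_ (hs_N_pos _ _ _ ht' hr') ?_
  · unfold regLamKernel
    rw [hs_rpow32 u hu0, ← Real.sqrt_eq_rpow]
    have h1 : (c^2)⁻¹ ≤ (c ^ 2)⁻¹ + (t * u)⁻¹ := by
      have : 0 ≤ (t * u)⁻¹ := by positivity
      linarith
    have h2 : -R ≤ -r / u := by
      rw [neg_div, neg_le_neg_iff, div_le_iff₀ hu0]; nlinarith [hu.1]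
    have h3 := Real.sqrt_pos.2 hu0
    have h4 := hu.2
    gcongr
  · refine setIntegral_mono_on (hs_ker_int _ _ _ ht' hr') (hs_ker_int _ _ _ ht0 (by norm_num))
      measurableSet_Ioi fun v hv => ?_
    have hv : 0 < v := hv
    unfold regLamKernel
    have : -r / v ≤ -(1/2) / v := by gcongr
    gcongr

lemma hs_lam_meas (c u : ℝ) : Measurable (fun q : ℝ × ℝ => regLamDens c q.1 q.2 u) := by
  unfold regLamDens
  refine Measurable.div ?_ ((hs_ker_meas c).stronglyMeasurable.integral_prod_right').measurable
  exact (hs_ker_meas c).comp (measurable_id.prodMk measurable_const)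

lemma hs_regA {n p : ℕ} (X : Matrix (Fin n) (Fin p) ℝ) (c t : ℝ) (x : Fin p → ℝ)
    (ht : 0 < t) (hx : ∀ j, 0 < x j) :
    regA n p X c t x = Xᵀ * X + Matrix.diagonal (fun j => (c ^ 2)⁻¹ + (t * x j)⁻¹) := by
  unfold regA
  have : (t • Matrix.diagonal x)⁻¹ = Matrix.diagonal (fun j => (t * x j)⁻¹) := by
    apply Matrix.inv_eq_left_inv
    rw [← Matrix.diagonal_smul, Matrix.diagonal_mul_diagonal, ← Matrix.diagonal_one]
    congr 1; ext j
    have := (hx j).ne'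
    simp; field_simp
  rw [this, add_assoc]
  congr 1
  ext i j
  by_cases h : i = j <;> simp [Matrix.diagonal, h]

/-- quadratic form facts -/
lemma hs_quad {n p : ℕ} (X : Matrix (Fin n) (Fin p) ℝ) (y : Fin n → ℝ) (D : Fin p → ℝ)
    (hD : ∀ j, 0 < D j) (A : Matrix (Fin p) (Fin p) ℝ) (hA : A = Xᵀ * X + Matrix.diagonal D) :
    (∀ v : Fin p → ℝ, v ⬝ᵥ A *ᵥ v = (X *ᵥ v) ⬝ᵥ (X *ᵥ v) + ∑ j, D j * v j ^ 2) ∧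
    0 ≤ y ⬝ᵥ ((1 - X * A⁻¹ * Xᵀ) *ᵥ y) ∧
    y ⬝ᵥ ((1 - X * A⁻¹ * Xᵀ) *ᵥ y) ≤ y ⬝ᵥ y ∧
    ∀ v : Fin p → ℝ, (v - A⁻¹ *ᵥ (Xᵀ *ᵥ y)) ⬝ᵥ A *ᵥ (v - A⁻¹ *ᵥ (Xᵀ *ᵥ y)) ≤
      (X *ᵥ v - y) ⬝ᵥ (X *ᵥ v - y) + ∑ j, D j * v j ^ 2 := by
  have hq : ∀ v : Fin p → ℝ, v ⬝ᵥ A *ᵥ v = (X *ᵥ v) ⬝ᵥ (X *ᵥ v) + ∑ j, D j * v j ^ 2 := by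
    intro v
    rw [hA, Matrix.add_mulVec, dotProduct_add, ← Matrix.mulVec_mulVec, Matrix.dotProduct_mulVec,
      Matrix.vecMul_transpose]
    congr 1
    simp only [dotProduct, Matrix.mulVec_diagonal]
    exact Finset.sum_congr rfl fun j _ => by ring
  have hdet : A.det ≠ 0 := by
    have h1 := hs_det_ge X D hD
    rw [← hA] at h1
    exact ((Finset.prod_pos fun j _ => hD j).trans_le h1).ne'
  have hu : IsUnit A.det := isUnit_iff_ne_zero.2 hdet
  have hAt : Aᵀ = A := by rw [hA]; simp [Matrix.transpose_mul]
  set w := A⁻¹ *ᵥ (Xᵀ *ᵥ y) with hw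
  have hAw : A *ᵥ w = Xᵀ *ᵥ y := by
    rw [hw, Matrix.mulVec_mulVec, Matrix.mul_nonsing_inv _ hu, Matrix.one_mulVec]
  have hvA : ∀ v : Fin p → ℝ, v ⬝ᵥ A *ᵥ w = (X *ᵥ v) ⬝ᵥ y := by
    intro v
    rw [hAw, Matrix.dotProduct_mulVec, Matrix.vecMul_transpose]
  have hwA : ∀ v : Fin p → ℝ, w ⬝ᵥ A *ᵥ v = (X *ᵥ v) ⬝ᵥ y := by
    intro v
    rw [← hvA v, Matrix.dotProduct_mulVec, ← Matrix.mulVec_transpose, hAt, dotProduct_comm]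
  have hy : y ⬝ᵥ ((1 - X * A⁻¹ * Xᵀ) *ᵥ y) = y ⬝ᵥ y - (X *ᵥ w) ⬝ᵥ y := by
    rw [Matrix.sub_mulVec, Matrix.one_mulVec, dotProduct_sub, ← Matrix.mulVec_mulVec,
      ← Matrix.mulVec_mulVec, ← hw, dotProduct_comm y (X *ᵥ w)]
  have hsum : ∀ v : Fin p → ℝ, 0 ≤ ∑ j, D j * v j ^ 2 := fun v =>
    Finset.sum_nonneg fun j _ => mul_nonneg (hD j).le (sq_nonneg _)
  have hsq : ∀ {m : ℕ} (v : Fin m → ℝ), 0 ≤ v ⬝ᵥ v := fun v =>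
    Finset.sum_nonneg fun j _ => mul_self_nonneg _
  have hww := hq w
  rw [hvA w] at hww
  have hlow : 0 ≤ y ⬝ᵥ y - (X *ᵥ w) ⬝ᵥ y := by
    have h1 := hsq (y - X *ᵥ w)
    rw [sub_dotProduct, dotProduct_sub, dotProduct_sub, dotProduct_comm y (X *ᵥ w)] at h1
    have := hsum w
    linarith
  refine ⟨hq, by rw [hy]; exact hlow, ?_, ?_⟩
  · rw [hy]; have := hsum w; have := hsq (X *ᵥ w); linarith
  · intro v
    rw [Matrix.mulVec_sub, sub_dotProduct, dotProduct_sub, dotProduct_sub, hq v, hvA, hwA, hvA,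
      sub_dotProduct (X *ᵥ v) y, dotProduct_sub, dotProduct_sub, dotProduct_comm y (X *ᵥ v)]
    linarith

lemma hs_det_meas {α : Type*} [MeasurableSpace α] {p : ℕ} (M : α → Matrix (Fin p) (Fin p) ℝ)
    (hM : ∀ i j, Measurable fun a => M a i j) : Measurable fun a => (M a).det := by
  simp only [Matrix.det_apply]
  refine Finset.measurable_fun_sum _ fun σ _ => ?_
  exact (Finset.measurable_fun_prod _ fun i _ => hM _ _).const_smul _

lemma hs_inv_meas {α : Type*} [MeasurableSpace α] {p : ℕ} (M : α → Matrix (Fin p) (Fin p) ℝ)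
    (hM : ∀ i j, Measurable fun a => M a i j) (i j : Fin p) :
    Measurable fun a => (M a)⁻¹ i j := by
  simp only [Matrix.inv_def, Matrix.smul_apply, Matrix.adjugate_apply, Ring.inverse_eq_inv',
    smul_eq_mul]
  refine (hs_det_meas M hM).inv.mul (hs_det_meas _ fun k l => ?_)
  by_cases h : k = j
  · subst h; simp
  · simpa [Matrix.updateRow_ne h] using hM k l

lemma hs_regA_meas {n p : ℕ} (X : Matrix (Fin n) (Fin p) ℝ) (c : ℝ) (x : Fin p → ℝ)
    (i j : Fin p) : Measurable fun t => regA n p X c t x i j := by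
  unfold regA
  simp only [Matrix.add_apply]
  refine measurable_const.add (hs_inv_meas _ (fun k l => ?_) i j)
  simp only [Matrix.smul_apply, smul_eq_mul]
  fun_prop

lemma hs_mulVec_meas {α : Type*} [MeasurableSpace α] {m p : ℕ} (M : α → Matrix (Fin m) (Fin p) ℝ)
    (hM : ∀ i j, Measurable fun a => M a i j) (v : α → Fin p → ℝ)
    (hv : ∀ i, Measurable fun a => v a i) (i : Fin m) : Measurable fun a => (M a *ᵥ v a) i := by
  simp only [Matrix.mulVec, dotProduct]
  exact Finset.measurable_fun_sum _ fun j _ => (hM i j).mul (hv j)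

lemma hs_dot_meas {α : Type*} [MeasurableSpace α] {p : ℕ} (u v : α → Fin p → ℝ)
    (hu : ∀ i, Measurable fun a => u a i)
    (hv : ∀ i, Measurable fun a => v a i) : Measurable fun a => u a ⬝ᵥ v a := by
  simp only [dotProduct]
  exact Finset.measurable_fun_sum _ fun j _ => (hu j).mul (hv j)

lemma hs_mul_meas {α : Type*} [MeasurableSpace α] {m p q : ℕ} (M : α → Matrix (Fin m) (Fin p) ℝ)
    (hM : ∀ i j, Measurable fun a => M a i j) (N : α → Matrix (Fin p) (Fin q) ℝ)
    (hN : ∀ i j, Measurable fun a => N a i j) (i : Fin m) (j : Fin q) :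
    Measurable fun a => (M a * N a) i j := by
  simp only [Matrix.mul_apply]
  exact Finset.measurable_fun_sum _ fun k _ => (hM i k).mul (hN k j)

lemma hs_regR_meas {n p : ℕ} (X : Matrix (Fin n) (Fin p) ℝ) (y : Fin n → ℝ) (b c : ℝ)
    (x : Fin p → ℝ) : Measurable fun t => regR n p X y b c t x := by
  unfold regR
  refine ((hs_dot_meas (fun _ : ℝ => y) _ (fun i => measurable_const)
    (hs_mulVec_meas (fun t : ℝ => 1 - X * (regA n p X c t x)⁻¹ * Xᵀ) (fun i j => ?_) (fun _ => y)
    (fun i => measurable_const))).div_const 2).add_const b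
  simp only [Matrix.sub_apply]
  refine measurable_const.sub ?_
  exact hs_mul_meas _ (hs_mul_meas (fun _ => X) (fun _ _ => measurable_const) _
    (hs_inv_meas _ (hs_regA_meas X c x))) (fun _ => Xᵀ) (fun _ _ => measurable_const) i j

lemma hs_gauss_meas {n p : ℕ} (X : Matrix (Fin n) (Fin p) ℝ) (y : Fin n → ℝ) (c : ℝ)
    (x : Fin p → ℝ) : Measurable (fun q : ((ℝ × (Fin p → ℝ)) × ℝ) × (Fin p → ℝ) =>
      gaussDens p (regA n p X c q.1.1.1 x)
        ((regA n p X c q.1.1.1 x)⁻¹.mulVec (X.transpose.mulVec y)) q.1.2 q.2) := by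
  unfold gaussDens
  have h1 : ∀ i j, Measurable (fun q : ((ℝ × (Fin p → ℝ)) × ℝ) × (Fin p → ℝ) =>
      (regA n p X c q.1.1.1 x) i j) := fun i j =>
      (hs_regA_meas X c x i j).comp
        ((measurable_fst.comp measurable_fst).comp measurable_fst)
  have h2 := hs_inv_meas _ h1
  have h3 := hs_det_meas _ h1
  have hs : Measurable (fun q : ((ℝ × (Fin p → ℝ)) × ℝ) × (Fin p → ℝ) => q.1.2) :=
    measurable_snd.comp measurable_fst
  have h4 : ∀ i, Measurable (fun q : ((ℝ × (Fin p → ℝ)) × ℝ) × (Fin p → ℝ) =>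
      (q.2 - (regA n p X c q.1.1.1 x)⁻¹ *ᵥ (Xᵀ *ᵥ y)) i) := by
    intro i
    simp only [Pi.sub_apply]
    exact ((measurable_pi_apply i).comp measurable_snd).sub
      (hs_mulVec_meas _ h2 (fun _ => Xᵀ *ᵥ y) (fun _ => measurable_const) i)
  refine (((hs.const_mul _).pow_const _).mul (h3.pow_const _)).mul (Measurable.exp ?_)
  exact (hs_dot_meas _ _ h4 (hs_mulVec_meas _ h1 _ h4)).neg.div (hs.const_mul 2)

lemma hs_R_bd {n p : ℕ} (X : Matrix (Fin n) (Fin p) ℝ) (y : Fin n → ℝ) (b c t : ℝ)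
    (x : Fin p → ℝ) (ht : 0 < t) (hx : ∀ j, 0 < x j) :
    b ≤ regR n p X y b c t x ∧ regR n p X y b c t x ≤ y ⬝ᵥ y / 2 + b := by
  have hD : ∀ j, 0 < (c ^ 2)⁻¹ + (t * x j)⁻¹ := fun j => by have := hx j; positivity
  obtain ⟨-, h1, h2, -⟩ := hs_quad X y _ hD _ (hs_regA X c t x ht hx)
  unfold regR
  constructor <;> linarith

lemma hs_det_lo {n p : ℕ} (X : Matrix (Fin n) (Fin p) ℝ) (c t : ℝ)
    (x : Fin p → ℝ) (ht : 0 < t) (hx : ∀ j, 0 < x j) :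
    ∏ j, ((c ^ 2)⁻¹ + (t * x j)⁻¹) ≤ (regA n p X c t x).det ∧ 0 < (regA n p X c t x).det := by
  have hD : ∀ j, 0 < (c ^ 2)⁻¹ + (t * x j)⁻¹ := fun j => by have := hx j; positivity
  have h := hs_det_ge X _ hD
  rw [← hs_regA X c t x ht hx] at h
  exact ⟨h, (Finset.prod_pos fun j _ => hD j).trans_le h⟩

lemma hs_det_hi {n p : ℕ} (X : Matrix (Fin n) (Fin p) ℝ) (c t0 m : ℝ) (ht0 : 0 < t0)
    (hm : 0 < m) : ∃ Δ : ℝ, 0 < Δ ∧ ∀ t x, t0 < t → (∀ j, m ≤ x j) →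
      (regA n p X c t x).det ≤ Δ := by
  set S : ℝ := ∑ i, ∑ j, |(Xᵀ * X) i j| with hS
  have hS0 : 0 ≤ S := Finset.sum_nonneg fun i _ => Finset.sum_nonneg fun j _ => abs_nonneg _
  set E : ℝ := S + ((c^2)⁻¹ + (t0 * m)⁻¹) with hE
  have hE0 : 0 < E := by positivity
  refine ⟨(Nat.factorial (Fintype.card (Fin p))) • E ^ Fintype.card (Fin p), ?_, ?_⟩
  · rw [nsmul_eq_mul]; positivity
  intro t x ht hx
  have ht' := ht0.trans ht
  have hx' : ∀ j, 0 < x j := fun j => hm.trans_le (hx j)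
  refine (le_abs_self _).trans (Matrix.det_le (abv := AbsoluteValue.abs) (x := E) fun i j => ?_)
  rw [hs_regA X c t x ht' hx', Matrix.add_apply]
  refine (abs_add_le _ _).trans (add_le_add ?_ ?_)
  · have h1 := Finset.single_le_sum (f := fun j => |(Xᵀ * X) i j|) (fun j _ => abs_nonneg _) (Finset.mem_univ j)
    have h2 := Finset.single_le_sum (f := fun i => ∑ j, |(Xᵀ * X) i j|)
      (fun i _ => Finset.sum_nonneg fun j _ => abs_nonneg _) (Finset.mem_univ i)
    exact h1.trans h2
  · rw [Matrix.diagonal_apply]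
    split_ifs with h
    · have := hx' i
      have h2 := hx i
      rw [abs_of_nonneg (by positivity)]
      gcongr
    · simp; positivity

lemma hs_ig_nonneg (α β s : ℝ) (hα : 0 < α) (hβ : 0 < β) (hs : 0 < s) : 0 ≤ igDens α β s := by
  unfold igDens
  have := Real.Gamma_pos_of_pos hα
  positivity

lemma hs_ig_le (α l β h s : ℝ) (hα : 0 < α) (hl : 0 < l) (h1 : l ≤ β) (h2 : β ≤ h) (hs : 0 < s) :
    igDens α β s ≤ h ^ α * (Real.Gamma α)⁻¹ * (s ^ (-α - 1) * Real.exp (-l / s)) := by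
  unfold igDens
  have := Real.Gamma_pos_of_pos hα
  have hβ : 0 < β := hl.trans_le h1
  have hh : 0 < h := hβ.trans_le h2
  rw [← mul_assoc]
  gcongr

lemma hs_ig_ge (α l β h s : ℝ) (hα : 0 < α) (hl : 0 < l) (h1 : l ≤ β) (h2 : β ≤ h)
    (hs : s ∈ Set.Icc (1:ℝ) 2) :
    l ^ α * (Real.Gamma α)⁻¹ * 2 ^ (-α - 1) * Real.exp (-h) ≤ igDens α β s := by
  unfold igDens
  have := Real.Gamma_pos_of_pos hα
  have hβ : 0 < β := hl.trans_le h1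
  have hs0 : 0 < s := by linarith [hs.1]
  have e1 : (2:ℝ) ^ (-α - 1) ≤ s ^ (-α - 1) :=
    Real.rpow_le_rpow_of_nonpos hs0 hs.2 (by linarith)
  have e2 : -h ≤ -β / s := by
    rw [neg_div, neg_le_neg_iff, div_le_iff₀ hs0]; nlinarith [hs.1]
  gcongr

lemma hs_gauss_bd {n p : ℕ} (X : Matrix (Fin n) (Fin p) ℝ) (D : Fin p → ℝ)
    (hD : ∀ j, 0 < D j) (A : Matrix (Fin p) (Fin p) ℝ) (hA : A = Xᵀ * X + Matrix.diagonal D)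
    (μ : Fin p → ℝ) (s : ℝ) (hs : 0 < s) (hm : Measurable (gaussDens p A μ s)) :
    Integrable (gaussDens p A μ s) ∧
      ∫ β, gaussDens p A μ s β ≤ A.det ^ ((1:ℝ)/2) * (∏ j, D j ^ ((1:ℝ)/2))⁻¹ := by
  have hdet : 0 < A.det := by
    have h1 := hs_det_ge X D hD
    rw [← hA] at h1
    exact (Finset.prod_pos fun j _ => hD j).trans_le h1
  have hq := (hs_quad X 0 D hD A hA).1
  set Cn : ℝ := (2 * Real.pi * s) ^ (-(p : ℝ) / 2) * A.det ^ ((1 : ℝ) / 2) with hCn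
  have hCn0 : 0 ≤ Cn := by have := Real.pi_pos; positivity
  have hi : ∀ j, Integrable (fun u : ℝ => Real.exp (-(D j / (2 * s)) * (u - μ j) ^ 2)) := fun j =>
    (integrable_exp_neg_mul_sq (b := D j / (2*s)) (by have := hD j; positivity)).comp_sub_right (μ j)
  have hpi : Integrable (fun β : Fin p → ℝ => ∏ j, Real.exp (-(D j / (2 * s)) * (β j - μ j) ^ 2)) := by
    rw [volume_pi]
    exact Integrable.fintype_prod (f := fun j (u : ℝ) => Real.exp (-(D j / (2 * s)) * (u - μ j) ^ 2)) hi
  have h := hs_bd (μ := volume) (f := gaussDens p A μ s) (C := Cn) hm.aestronglyMeasurable hpi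
    (ae_of_all _ fun β => by unfold gaussDens; rw [← hCn]; positivity)
    (ae_of_all _ fun β => by
      unfold gaussDens
      rw [← hCn, ← Real.exp_sum]
      refine mul_le_mul_of_nonneg_left (Real.exp_le_exp.2 ?_) hCn0
      have e1 : ∑ j, -(D j / (2 * s)) * (β j - μ j) ^ 2 = -(∑ j, D j * (β - μ) j ^ 2) / (2 * s) := by
        rw [← Finset.sum_neg_distrib, Finset.sum_div]
        refine Finset.sum_congr rfl fun j _ => ?_
        simp only [Pi.sub_apply]; ring
      rw [e1, hq]
      have : 0 ≤ (X *ᵥ (β - μ)) ⬝ᵥ (X *ᵥ (β - μ)) := Finset.sum_nonneg fun j _ => mul_self_nonneg _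
      gcongr
      linarith)
  refine ⟨h.1, h.2.2.trans (le_of_eq ?_)⟩
  rw [integral_fintype_prod_volume_eq_prod (f := fun j (u : ℝ) => Real.exp (-(D j / (2 * s)) * (u - μ j) ^ 2))]
  have e2 : ∀ j, ∫ u : ℝ, Real.exp (-(D j / (2 * s)) * (u - μ j) ^ 2) =
      (2 * Real.pi * s) ^ ((1:ℝ)/2) * (D j ^ ((1:ℝ)/2))⁻¹ := by
    intro j
    rw [integral_sub_right_eq_self (fun u : ℝ => Real.exp (-(D j / (2 * s)) * u ^ 2)) (μ j),
      integral_gaussian, ← Real.sqrt_eq_rpow, ← Real.sqrt_eq_rpow, ← Real.sqrt_inv, ← Real.sqrt_mul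
      (by have := Real.pi_pos; positivity)]
    congr 1
    have := hD j
    field_simp
  simp only [e2]
  rw [Finset.prod_mul_distrib, Finset.prod_const, Finset.prod_inv_distrib, Finset.card_univ,
    Fintype.card_fin, hCn]
  have hps : 0 < 2 * Real.pi * s := by have := Real.pi_pos; positivity
  have e3 : (2 * Real.pi * s) ^ (-(p : ℝ) / 2) * ((2 * Real.pi * s) ^ ((1:ℝ)/2)) ^ p = 1 := by
    rw [← Real.rpow_natCast, ← Real.rpow_mul hps.le, ← Real.rpow_add hps]
    convert Real.rpow_zero _ using 2; ring
  linear_combination (A.det ^ ((1:ℝ)/2) * (∏ j, D j ^ ((1:ℝ)/2))⁻¹) * e3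

lemma hs_gauss_nonneg (p : ℕ) (A : Matrix (Fin p) (Fin p) ℝ) (hA : 0 < A.det)
    (μ : Fin p → ℝ) (s : ℝ) (hs : 0 < s) (β : Fin p → ℝ) : 0 ≤ gaussDens p A μ s β := by
  unfold gaussDens; have := Real.pi_pos; positivity

lemma hs_gauss_lo {n p : ℕ} (X : Matrix (Fin n) (Fin p) ℝ) (y : Fin n → ℝ) (c t0 m : ℝ)
    (hc : c ≠ 0) (ht0 : 0 < t0) (hm : 0 < m) : ∃ κ : ℝ, 0 < κ ∧ ∀ t s x β, t0 < t →
      (∀ j, m ≤ x j) → s ∈ Set.Icc (1:ℝ) 2 → (∀ j, β j ∈ Set.Icc (1:ℝ) 2) →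
      κ ≤ gaussDens p (regA n p X c t x)
        ((regA n p X c t x)⁻¹.mulVec (X.transpose.mulVec y)) s β := by
  have hcpt : IsCompact (Set.univ.pi (fun _ : Fin p => Set.Icc (1:ℝ) 2)) :=
    isCompact_univ_pi fun _ => isCompact_Icc
  have hcont : Continuous (fun β : Fin p → ℝ => (X *ᵥ β - y) ⬝ᵥ (X *ᵥ β - y)) := by
    simp only [dotProduct, Matrix.mulVec, Pi.sub_apply]
    fun_prop
  obtain ⟨Q0, hQ0⟩ := hcpt.exists_bound_of_continuousOn hcont.continuousOn
  set Q : ℝ := Q0 + ∑ j : Fin p, ((c^2)⁻¹ + (t0 * m)⁻¹) * 4 with hQ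
  have hpi := Real.pi_pos
  have hq : 0 < (c^2)⁻¹ := by positivity
  refine ⟨(2 * Real.pi * 2) ^ (-(p : ℝ) / 2) * (∏ j : Fin p, (c^2)⁻¹) ^ ((1 : ℝ) / 2) *
    Real.exp (-Q), ?_, ?_⟩
  · have : 0 < ∏ j : Fin p, (c^2)⁻¹ := Finset.prod_pos fun _ _ => hq
    positivity
  intro t s x β ht hx hs hβ
  have ht' := ht0.trans ht
  have hx' : ∀ j, 0 < x j := fun j => hm.trans_le (hx j)
  have hD : ∀ j, 0 < (c ^ 2)⁻¹ + (t * x j)⁻¹ := fun j => by have := hx' j; positivity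
  have hs0 : 0 < s := by linarith [hs.1]
  have h1 := (hs_quad X y _ hD _ (hs_regA X c t x ht' hx')).2.2.2 β
  obtain ⟨h2, h3⟩ := hs_det_lo X c t x ht' hx'
  unfold gaussDens
  set z := (β - (regA n p X c t x)⁻¹ *ᵥ (Xᵀ *ᵥ y)) ⬝ᵥ
    regA n p X c t x *ᵥ (β - (regA n p X c t x)⁻¹ *ᵥ (Xᵀ *ᵥ y))
  have hb := hQ0 β fun j _ => hβ j
  rw [Real.norm_eq_abs] at hb
  have hz : z ≤ Q := by
    refine h1.trans (add_le_add ((le_abs_self _).trans hb) (Finset.sum_le_sum fun j _ => ?_))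
    have e1 := hx j
    have e2 := hx' j
    have e3 : β j ^ 2 ≤ 4 := by nlinarith [(hβ j).1, (hβ j).2]
    gcongr
  have hQ0' : 0 ≤ Q := by
    have : 0 ≤ Q0 := (abs_nonneg _).trans hb
    have : 0 ≤ ∑ j : Fin p, ((c^2)⁻¹ + (t0 * m)⁻¹) * 4 := Finset.sum_nonneg fun _ _ => by positivity
    linarith
  have e1 : -Q ≤ -z / (2 * s) := by
    rw [neg_div, neg_le_neg_iff, div_le_iff₀ (by positivity)]
    nlinarith [hs.1]
  have e2 : (2 * Real.pi * 2) ^ (-(p : ℝ) / 2) ≤ (2 * Real.pi * s) ^ (-(p : ℝ) / 2) := by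
    apply Real.rpow_le_rpow_of_nonpos (by positivity)
    · have := hs.2; gcongr
    · have : (0:ℝ) ≤ p := Nat.cast_nonneg p
      linarith
  have e3 : (∏ j : Fin p, (c^2)⁻¹) ≤ (regA n p X c t x).det := by
    refine le_trans (Finset.prod_le_prod (fun _ _ => hq.le) fun j _ => ?_) h2
    have := hx' j
    have : 0 < (t * x j)⁻¹ := by positivity
    linarith
  have e4 : 0 ≤ ∏ j : Fin p, (c^2)⁻¹ := Finset.prod_nonneg fun _ _ => hq.le
  gcongr

lemma hs_t0 (πτ : ℝ → ℝ) (hπ_prob : ∫ t in Set.Ioi (0 : ℝ), πτ t = 1)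
    (hπ : IntegrableOn πτ (Set.Ioi 0)) : ∃ t0 : ℝ, 0 < t0 ∧ 0 < ∫ t in Set.Ioi t0, πτ t := by
  have hU : (⋃ k : ℕ, Set.Ioi (1 / ((k : ℝ) + 1))) = Set.Ioi (0:ℝ) := by
    ext t
    simp only [Set.mem_iUnion, Set.mem_Ioi]
    constructor
    · rintro ⟨k, hk⟩
      exact lt_trans (by positivity) hk
    · intro ht
      exact exists_nat_one_div_lt ht
  have h := tendsto_setIntegral_of_monotone (μ := volume) (f := πτ)
    (s := fun k : ℕ => Set.Ioi (1 / ((k : ℝ) + 1))) (fun _ => measurableSet_Ioi)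
    (fun i j hij => Set.Ioi_subset_Ioi (Nat.one_div_le_one_div hij)) (by rw [hU]; exact hπ)
  rw [hU, hπ_prob] at h
  obtain ⟨k, hk⟩ := (h.eventually (lt_mem_nhds (show (0:ℝ) < 1 by norm_num))).exists
  exact ⟨_, by positivity, hk⟩

lemma hs_tau {n p : ℕ} (X : Matrix (Fin n) (Fin p) ℝ) (y : Fin n → ℝ)
    (a b c : ℝ) (ha : 0 < a) (hb : 0 < b)
    (πτ : ℝ → ℝ) (hπ0 : ∀ t, 0 ≤ πτ t) (hπ_prob : ∫ t in Set.Ioi (0 : ℝ), πτ t = 1)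
    (hπ : IntegrableOn πτ (Set.Ioi 0)) (x : Fin p → ℝ) (hx : ∀ j, 0 < x j) :
    AEStronglyMeasurable (regTauDens n p X y a b c πτ x) (volume.restrict (Set.Ioi 0)) ∧
    IntegrableOn (regTauDens n p X y a b c πτ x) (Set.Ioi 0) ∧
    (∀ t, 0 < t → 0 ≤ regTauDens n p X y a b c πτ x t) ∧
    (∫ t in Set.Ioi (0 : ℝ), regTauDens n p X y a b c πτ x t) ≤ b ^ (-(a + (n : ℝ) / 2)) := by
  have hα : -(a + (n : ℝ) / 2) ≤ 0 := by
    have : (0:ℝ) ≤ n := Nat.cast_nonneg n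
    linarith
  have hmeas : AEStronglyMeasurable (regTauDens n p X y a b c πτ x)
      (volume.restrict (Set.Ioi 0)) := by
    unfold regTauDens
    refine AEStronglyMeasurable.mul (Measurable.aestronglyMeasurable ?_) hπ.1
    refine (((hs_det_meas _ (hs_regA_meas X c x)).pow_const _).mul ?_).mul
      ((hs_regR_meas X y b c x).pow_const _)
    exact Finset.measurable_fun_prod _ fun j _ => by fun_prop
  have h0 : ∀ t, 0 < t → 0 ≤ regTauDens n p X y a b c πτ x t := by
    intro t ht
    unfold regTauDens
    have h1 := (hs_det_lo X c t x ht hx).2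
    have h2 := hb.trans_le (hs_R_bd X y b c t x ht hx).1
    have h3 : 0 ≤ ∏ j, ((c ^ 2)⁻¹ + (t * x j)⁻¹) ^ ((1 : ℝ) / 2) := Finset.prod_nonneg fun j _ => by
      have := hx j; positivity
    have := hπ0 t
    positivity
  have hle : ∀ t, 0 < t → regTauDens n p X y a b c πτ x t ≤ b ^ (-(a + (n : ℝ) / 2)) * πτ t := by
    intro t ht
    unfold regTauDens
    obtain ⟨h1, h1'⟩ := hs_det_lo X c t x ht hx
    have h2 := (hs_R_bd X y b c t x ht hx).1
    have h2' := hb.trans_le h2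
    have hD : ∀ j, 0 < (c ^ 2)⁻¹ + (t * x j)⁻¹ := fun j => by have := hx j; positivity
    refine mul_le_mul_of_nonneg_right ?_ (hπ0 t)
    rw [Real.finsetProd_rpow _ _ (fun j _ => (hD j).le)]
    have e1 : (regA n p X c t x).det ^ (-(1 / 2 : ℝ)) *
        (∏ j, ((c ^ 2)⁻¹ + (t * x j)⁻¹)) ^ ((1 : ℝ) / 2) ≤ 1 := by
      rw [Real.rpow_neg h1'.le, inv_mul_le_iff₀ (by positivity), mul_one]
      exact Real.rpow_le_rpow (Finset.prod_nonneg fun j _ => (hD j).le) h1 (by norm_num)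
    have e2 := Real.rpow_le_rpow_of_nonpos hb h2 hα
    calc _ ≤ 1 * b ^ (-(a + (n : ℝ) / 2)) := mul_le_mul e1 e2 (by positivity) zero_le_one
      _ = _ := one_mul _
  have h := hs_bd hmeas hπ (ae_restrict_of_forall_mem measurableSet_Ioi h0)
    (ae_restrict_of_forall_mem measurableSet_Ioi hle)
  rw [hπ_prob, mul_one] at h
  exact ⟨hmeas, h.1, h0, h.2.2⟩

lemma hs_tau_lo {n p : ℕ} (X : Matrix (Fin n) (Fin p) ℝ) (y : Fin n → ℝ)
    (a b c t0 m : ℝ) (ha : 0 < a) (hb : 0 < b) (hc : c ≠ 0) (ht0 : 0 < t0) (hm : 0 < m) :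
    ∃ κ : ℝ, 0 < κ ∧ ∀ (πτ : ℝ → ℝ) t x, (∀ t, 0 ≤ πτ t) → t0 < t → (∀ j, m ≤ x j) →
      κ * πτ t ≤ regTauDens n p X y a b c πτ x t := by
  obtain ⟨Δ, hΔ, h⟩ := hs_det_hi X c t0 m ht0 hm
  have hyy : 0 ≤ y ⬝ᵥ y := Finset.sum_nonneg fun j _ => mul_self_nonneg _
  have hα : -(a + (n : ℝ) / 2) ≤ 0 := by
    have : (0:ℝ) ≤ n := Nat.cast_nonneg n
    linarith
  have hq : 0 < (c^2)⁻¹ := by positivity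
  have hP : 0 < ∏ j : Fin p, ((c ^ 2)⁻¹) ^ ((1 : ℝ) / 2) := Finset.prod_pos fun j _ => by positivity
  refine ⟨Δ ^ (-(1 / 2 : ℝ)) * (∏ j : Fin p, ((c ^ 2)⁻¹) ^ ((1 : ℝ) / 2)) *
    (y ⬝ᵥ y / 2 + b) ^ (-(a + (n : ℝ) / 2)), by positivity, ?_⟩
  intro πτ t x hπ0 ht hx
  have ht' := ht0.trans ht
  have hx' : ∀ j, 0 < x j := fun j => hm.trans_le (hx j)
  obtain ⟨-, h1'⟩ := hs_det_lo X c t x ht' hx'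
  obtain ⟨h2, h3⟩ := hs_R_bd X y b c t x ht' hx'
  have h2' := hb.trans_le h2
  unfold regTauDens
  refine mul_le_mul_of_nonneg_right ?_ (hπ0 t)
  have e1 := Real.rpow_le_rpow_of_nonpos h1' (h t x ht hx) (show -(1/2:ℝ) ≤ 0 by norm_num)
  have e2 := Real.rpow_le_rpow_of_nonpos h2' h3 hα
  have e3 : ∏ j : Fin p, ((c ^ 2)⁻¹) ^ ((1 : ℝ) / 2) ≤
      ∏ j, ((c ^ 2)⁻¹ + (t * x j)⁻¹) ^ ((1 : ℝ) / 2) := by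
    refine Finset.prod_le_prod (fun _ _ => by positivity) fun j _ => ?_
    have := hx' j
    have : 0 < (t * x j)⁻¹ := by positivity
    gcongr
    linarith
  have e4 := hP.trans_le e3
  gcongr

lemma hs_L_meas (p : ℕ) (c : ℝ) (x' : Fin p → ℝ) :
    Measurable (fun q : ((ℝ × (Fin p → ℝ)) × ℝ) × (Fin p → ℝ) =>
      ∏ j, regLamDens c q.1.1.1 ((q.1.1.2 j)⁻¹ + (q.2 j) ^ 2 / (2 * q.1.2 * q.1.1.1)) (x' j)) := by
  refine Finset.measurable_fun_prod _ fun j _ => ?_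
  have h1 : Measurable (fun q : ((ℝ × (Fin p → ℝ)) × ℝ) × (Fin p → ℝ) => q.1.1.1) :=
    (measurable_fst.comp measurable_fst).comp measurable_fst
  have h2 : Measurable (fun q : ((ℝ × (Fin p → ℝ)) × ℝ) × (Fin p → ℝ) => q.1.1.2 j) :=
    (measurable_pi_apply j).comp ((measurable_snd.comp measurable_fst).comp measurable_fst)
  have h3 : Measurable (fun q : ((ℝ × (Fin p → ℝ)) × ℝ) × (Fin p → ℝ) => q.1.2) :=
    measurable_snd.comp measurable_fst
  have h4 : Measurable (fun q : ((ℝ × (Fin p → ℝ)) × ℝ) × (Fin p → ℝ) => q.2 j) :=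
    (measurable_pi_apply j).comp measurable_snd
  have h5 : Measurable (fun q : ((ℝ × (Fin p → ℝ)) × ℝ) × (Fin p → ℝ) =>
      (q.1.1.2 j)⁻¹ + (q.2 j) ^ 2 / (2 * q.1.2 * q.1.1.1)) := by
    have h6 := (h4.pow_const 2)
    have h7 := (h3.const_mul 2).mul h1
    exact h2.inv.add (h6.div h7)
  have h8 := (hs_lam_meas c (x' j)).comp (h1.prodMk h5)
  simp only [Function.comp_def] at h8
  exact h8

lemma hs_I_meas {n p : ℕ} (X : Matrix (Fin n) (Fin p) ℝ) (y : Fin n → ℝ) (b c α : ℝ)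
    (x : Fin p → ℝ) : Measurable (fun q : (ℝ × (Fin p → ℝ)) × ℝ =>
      igDens α (regR n p X y b c q.1.1 x) q.2) := by
  have h1 : Measurable (fun q : (ℝ × (Fin p → ℝ)) × ℝ => regR n p X y b c q.1.1 x) :=
    (hs_regR_meas X y b c x).comp (measurable_fst.comp measurable_fst)
  unfold igDens
  exact (((h1.pow_const _).mul_const _).mul (measurable_snd.pow_const _)).mul
    (h1.neg.div measurable_snd).exp

lemma hs_V_meas (p : ℕ) (x : Fin p → ℝ) :
    Measurable (fun ν : Fin p → ℝ => ∏ j, igDens 1 (1 + (x j)⁻¹) (ν j)) := by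
  unfold igDens; fun_prop

lemma hs_V_int (p : ℕ) (x : Fin p → ℝ) (hx : ∀ j, 0 < x j) :
    IntegrableOn (fun ν : Fin p → ℝ => ∏ j, igDens 1 (1 + (x j)⁻¹) (ν j))
      (Set.univ.pi (fun _ => Set.Ioi 0)) := by
  have h1 : ∀ j, IntegrableOn (igDens 1 (1 + (x j)⁻¹)) (Set.Ioi 0) := by
    intro j
    have hj := hx j
    have := (hs_ig_int 1 (1 + (x j)⁻¹) one_pos (by positivity)).const_mul
      ((1 + (x j)⁻¹) ^ (1:ℝ) * (Real.Gamma 1)⁻¹)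
    refine this.congr (ae_of_all _ fun s => ?_)
    simp only [igDens]; ring
  unfold IntegrableOn
  rw [volume_pi, Measure.restrict_pi_pi]
  exact Integrable.fintype_prod h1

lemma hs_gT {n p : ℕ} (X : Matrix (Fin n) (Fin p) ℝ) (y : Fin n → ℝ)
    (a b c : ℝ) (ha : 0 < a) (hb : 0 < b)
    (πτ : ℝ → ℝ) (hπ0 : ∀ t, 0 ≤ πτ t) (x : Fin p → ℝ) (hx : ∀ j, 0 < x j) (N : ℝ) (hN : 0 < N)
    (t : ℝ) (ht : 0 < t) :
    ((regA n p X c t x).det ^ ((1:ℝ)/2) *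
      (∏ j, ((c ^ 2)⁻¹ + (t * x j)⁻¹) ^ ((1:ℝ)/2))⁻¹) * (regTauDens n p X y a b c πτ x t / N) ≤
    b ^ (-(a + (n : ℝ) / 2)) / N * πτ t := by
  have hα : -(a + (n : ℝ) / 2) ≤ 0 := by
    have : (0:ℝ) ≤ n := Nat.cast_nonneg n
    linarith
  have h1 := (hs_det_lo X c t x ht hx).2
  have h2 := (hs_R_bd X y b c t x ht hx).1
  have h3 : 0 < ∏ j, ((c ^ 2)⁻¹ + (t * x j)⁻¹) ^ ((1:ℝ)/2) := Finset.prod_pos fun j _ => by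
    have := hx j; positivity
  have e2 := Real.rpow_le_rpow_of_nonpos hb h2 hα
  unfold regTauDens
  rw [Real.rpow_neg h1.le (1/2)]
  have h4 : 0 < (regA n p X c t x).det ^ ((1:ℝ)/2) := by positivity
  generalize ∏ j, ((c ^ 2)⁻¹ + (t * x j)⁻¹) ^ ((1:ℝ)/2) = P at *
  generalize (regA n p X c t x).det ^ ((1:ℝ)/2) = dd at *
  have := hπ0 t
  calc _ = regR n p X y b c t x ^ (-(a + (n : ℝ) / 2)) / N * πτ t := by field_simp
    _ ≤ _ := by gcongr

lemma hs_gauss_meas' {n p : ℕ} (X : Matrix (Fin n) (Fin p) ℝ) (y : Fin n → ℝ) (c t s : ℝ)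
    (x : Fin p → ℝ) : Measurable (gaussDens p (regA n p X c t x)
        ((regA n p X c t x)⁻¹.mulVec (X.transpose.mulVec y)) s) := by
  have h := (hs_gauss_meas X y c x).comp (measurable_prodMk_left (x := ((t, fun _ => 0), s)))
  simp only [Function.comp_def] at h
  exact h

set_option maxHeartbeats 400000

/-- (Minorization condition for the regularized Horseshoe
Gibbs sampler of Piironen and Vehtari.)  Fix `δ ∈ (0,1)` and
`Ṽ(x) = Σⱼ x_j^{−δ/2}`.  Then for every `d > 0` there exist `ε* > 0` and a
probability density `h` on `(0,∞)^p` such that `k_c(x, x′) ≥ ε* h(x′)` for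
all `x′ ∈ (0,∞)^p` and all `x ∈ (0,∞)^p` with `Ṽ(x) ≤ d`. -/
theorem stmt16 (n p : ℕ) (hn : 0 < n) (hp : 0 < p)
    (X : Matrix (Fin n) (Fin p) ℝ) (y : Fin n → ℝ)
    (a b c : ℝ) (ha : 0 < a) (hb : 0 < b) (hc : c ≠ 0)
    (πτ : ℝ → ℝ) (hπ_nonneg : ∀ t, 0 ≤ πτ t)
    (hπ_prob : ∫ t in Set.Ioi (0 : ℝ), πτ t = 1)
    (δ : ℝ) (hδ : δ ∈ Set.Ioo (0 : ℝ) 1)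
    (d : ℝ) (hd : 0 < d) :
    ∃ ε : ℝ, 0 < ε ∧ ∃ h : (Fin p → ℝ) → ℝ,
      (∀ x', 0 ≤ h x') ∧
      (∫ x' in Set.univ.pi (fun _ : Fin p => Set.Ioi (0 : ℝ)), h x') = 1 ∧
      ∀ x x' : Fin p → ℝ, (∀ j, 0 < x j) → (∀ j, 0 < x' j) →
        (∑ j, (x j) ^ (-δ / 2)) ≤ d →
        ε * h x' ≤ regMTD n p X y a b c πτ x x' := by
  obtain ⟨hδ0, hδ1⟩ := hδ
  have hπ : IntegrableOn πτ (Set.Ioi 0) := by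
    by_contra hcon
    rw [integral_undef hcon] at hπ_prob
    exact zero_ne_one hπ_prob
  obtain ⟨t0, ht0, hπt0⟩ := hs_t0 πτ hπ_prob hπ
  set m : ℝ := d ^ (-(2 / δ)) with hm_def
  have hm : 0 < m := Real.rpow_pos_of_pos hd _
  have hxm : ∀ x : Fin p → ℝ, (∀ j, 0 < x j) → (∑ j, (x j) ^ (-δ / 2)) ≤ d → ∀ j, m ≤ x j := by
    intro x hx hV j
    have h1 : (x j) ^ (-δ / 2) ≤ d := le_trans
      (Finset.single_le_sum (f := fun j => (x j) ^ (-δ / 2))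
        (fun i _ => (Real.rpow_pos_of_pos (hx i) _).le) (Finset.mem_univ j)) hV
    have h2 := Real.rpow_le_rpow_of_nonpos (Real.rpow_pos_of_pos (hx j) (-δ / 2)) h1
      (show -(2 / δ) ≤ 0 by have : 0 < 2 / δ := by positivity
                            linarith)
    rw [← Real.rpow_mul (hx j).le] at h2
    have e : -δ / 2 * -(2 / δ) = 1 := by field_simp
    rwa [e, Real.rpow_one] at h2
  set α : ℝ := a + (n : ℝ) / 2 with hα_def
  have hα : 0 < α := by positivity
  have hyy : 0 ≤ y ⬝ᵥ y := Finset.sum_nonneg fun j _ => mul_self_nonneg _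
  set Rh : ℝ := y ⬝ᵥ y / 2 + b with hRh
  have hRh0 : 0 < Rh := by positivity
  obtain ⟨κG, hκG, HG⟩ := hs_gauss_lo X y c t0 m hc ht0 hm
  obtain ⟨κT, hκT, HT⟩ := hs_tau_lo X y a b c t0 m ha hb hc ht0 hm
  set κ0 : ℝ := Real.sqrt ((c^2)⁻¹) * (Real.sqrt 2 ^ 3)⁻¹ * Real.exp (-(1 + 2 / t0)) /
      (∫ v in Set.Ioi (0 : ℝ), regLamKernel c t0 (1/2) v) with hκ0_def
  have hκ0 : 0 < κ0 := by
    have h1 := hs_N_pos c t0 (1/2) ht0 (by norm_num)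
    have h2 : 0 < Real.sqrt ((c^2)⁻¹) := Real.sqrt_pos.2 (by positivity)
    positivity
  set κI : ℝ := b ^ α * (Real.Gamma α)⁻¹ * 2 ^ (-α - 1) * Real.exp (-Rh) with hκI_def
  have hκI : 0 < κI := by
    have := Real.Gamma_pos_of_pos hα
    positivity
  set κν : ℝ := 1 ^ (1:ℝ) * (Real.Gamma 1)⁻¹ * 2 ^ (-(1:ℝ) - 1) * Real.exp (-(1 + m⁻¹)) with hκν_def
  have hκν : 0 < κν := by
    have := Real.Gamma_pos_of_pos one_pos
    positivity
  set κ4 : ℝ := κT / b ^ (-α) with hκ4_def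
  have hκ4 : 0 < κ4 := by positivity
  have hbox : MeasurableSet (Set.univ.pi (fun _ : Fin p => Set.Icc (1:ℝ) 2)) :=
    MeasurableSet.univ_pi fun _ => measurableSet_Icc
  refine ⟨(κ0 ^ p * κG) * κI * κν ^ p * κ4 * ∫ t in Set.Ioi t0, πτ t, by positivity,
    (Set.univ.pi (fun _ : Fin p => Set.Icc (1:ℝ) 2)).indicator (fun _ => 1),
    fun x' => Set.indicator_nonneg (fun _ _ => zero_le_one) x', ?_, ?_⟩
  · rw [setIntegral_indicator hbox, Set.inter_eq_right.2]
    · rw [setIntegral_const, Measure.real, hs_box]; simp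
    · intro ν hν j _; exact one_pos.trans_le (hν j (Set.mem_univ _)).1
  intro x x' hx hx' hV
  unfold regMTD
  rw [← hα_def]
  have hmx := hxm x hx hV
  have hD : ∀ t, 0 < t → ∀ j, 0 < (c ^ 2)⁻¹ + (t * x j)⁻¹ := fun t ht j => by
    have := hx j; positivity
  obtain ⟨hTm, hTi, hT0, hTle⟩ := hs_tau X y a b c ha hb πτ hπ_nonneg hπ_prob hπ x hx
  rw [← hα_def] at hTle
  set N := ∫ u in Set.Ioi (0 : ℝ), regTauDens n p X y a b c πτ x u with hN
  have hNpos : 0 < N := by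
    have hsub : Set.Ioi t0 ⊆ Set.Ioi 0 := Set.Ioi_subset_Ioi ht0.le
    calc 0 < κT * ∫ t in Set.Ioi t0, πτ t := by positivity
      _ = ∫ t in Set.Ioi t0, κT * πτ t := (integral_const_mul _ _).symm
      _ ≤ ∫ t in Set.Ioi t0, regTauDens n p X y a b c πτ x t :=
          setIntegral_mono_on ((hπ.mono_set hsub).const_mul _) (hTi.mono_set hsub)
            measurableSet_Ioi fun t ht => HT πτ t x hπ_nonneg ht hmx
      _ ≤ N := setIntegral_mono_set hTi
          (ae_restrict_of_forall_mem measurableSet_Ioi hT0) (Filter.Eventually.of_forall hsub)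
  have hrpos : ∀ t s, 0 < t → 0 < s → ∀ u v : ℝ, 0 < u → 0 < u⁻¹ + v ^ 2 / (2 * s * t) :=
    fun t s ht hs u v hu => by positivity
  have main := hs_main p
    (fun t ν s β => ∏ j, regLamDens c t ((ν j)⁻¹ + (β j) ^ 2 / (2 * s * t)) (x' j))
    (fun t s β => gaussDens p (regA n p X c t x)
              ((regA n p X c t x)⁻¹.mulVec (X.transpose.mulVec y)) s β)
    (fun t s => igDens α (regR n p X y b c t x) s)
    (fun ν => ∏ j, igDens 1 (1 + (x j)⁻¹) (ν j))
    (fun t => regTauDens n p X y a b c πτ x t / N) πτ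
    (fun t => (regA n p X c t x).det ^ ((1:ℝ)/2) *
      (∏ j, ((c ^ 2)⁻¹ + (t * x j)⁻¹) ^ ((1:ℝ)/2))⁻¹)
    (fun s => Rh ^ α * (Real.Gamma α)⁻¹ * (s ^ (-α - 1) * Real.exp (-b / s)))
    (hs_L_meas p c x')
    (hs_gauss_meas X y c x)
    (hs_I_meas X y b c α x)
    (hs_V_meas p x)
    (by simp only [div_eq_mul_inv]; exact hTm.mul_const _)
    hπ hπ_nonneg
    (∏ j, (Real.sqrt 2 ^ 3 * Real.exp 1 / x' j))
    (fun t ν s β ht hν hs =>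
      ⟨Finset.prod_nonneg fun j _ => hs_lam_nonneg _ _ _ _ ht (hrpos t s ht hs _ _ (hν j)) (hx' j),
       Finset.prod_le_prod
        (fun j _ => hs_lam_nonneg _ _ _ _ ht (hrpos t s ht hs _ _ (hν j)) (hx' j))
        (fun j _ => hs_lam_le _ _ _ _ ht (hrpos t s ht hs _ _ (hν j)) (hx' j))⟩)
    (fun t s β ht hs => hs_gauss_nonneg p _ (hs_det_lo X c t x ht hx).2 _ s hs β)
    (fun t s ht hs => (hs_gauss_bd X _ (hD t ht) _ (hs_regA X c t x ht hx) _ s hs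
      (hs_gauss_meas' X y c t s x)).1)
    (fun t s ht hs => (hs_gauss_bd X _ (hD t ht) _ (hs_regA X c t x ht hx) _ s hs
      (hs_gauss_meas' X y c t s x)).2)
    (fun t s ht hs => by
      obtain ⟨h1, h2⟩ := hs_R_bd X y b c t x ht hx
      exact ⟨hs_ig_nonneg _ _ _ hα (hb.trans_le h1) hs, hs_ig_le _ _ _ _ _ hα hb h1 h2 hs⟩)
    ((hs_ig_int α b hα hb).const_mul _)
    (fun ν hν => Finset.prod_nonneg fun j _ => by
      have := hx j
      exact hs_ig_nonneg _ _ _ one_pos (by positivity) (hν j))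
    (hs_V_int p x hx)
    (b ^ (-α) / N)
    (fun t ht => div_nonneg (hT0 t ht) hNpos.le)
    (fun t ht => hs_gT X y a b c ha hb πτ hπ_nonneg x hx N hNpos t ht)
  obtain ⟨main0, main1⟩ := main
  by_cases hbx : x' ∈ Set.univ.pi (fun _ : Fin p => Set.Icc (1:ℝ) 2)
  · rw [Set.indicator_of_mem hbx, mul_one]
    refine main1 t0 (κ0 ^ p * κG) κI (κν ^ p) κ4 ht0 (by positivity) hκI.le (by positivity) hκ4.le
      ?_ ?_ ?_ ?_
    · intro t ν s β ht hν hs hβ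
      refine mul_le_mul ?_ (HG t s x β ht hmx hs hβ) hκG.le ?_
      · have : κ0 ^ p = ∏ j : Fin p, κ0 := by simp
        rw [this]
        refine Finset.prod_le_prod (fun _ _ => hκ0.le) fun j _ => ?_
        have ht' := ht0.trans ht
        have hs0 : 0 < s := one_pos.trans_le hs.1
        have hνj := hν j
        have hν0 : 0 < ν j := one_pos.trans_le hνj.1
        refine hs_lam_ge c t t0 _ _ _ ht0 ht ?_ ?_ (hbx j (Set.mem_univ _))
        · have h1 : (1/2 : ℝ) ≤ (ν j)⁻¹ := by
            rw [one_div]; exact inv_anti₀ hν0 hνj.2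
          have h2 : 0 ≤ (β j) ^ 2 / (2 * s * t) := by positivity
          linarith
        · have h1 : (ν j)⁻¹ ≤ 1 := inv_le_one_of_one_le₀ hνj.1
          have h2 : (β j) ^ 2 / (2 * s * t) ≤ 2 / t0 := by
            rw [div_le_div_iff₀ (by positivity) ht0]
            have h3 : β j ^ 2 ≤ 4 := by nlinarith [(hβ j).1, (hβ j).2]
            have h4 : t0 ≤ s * t := by nlinarith [hs.1]
            nlinarith
          linarith
      · refine Finset.prod_nonneg fun j _ => hs_lam_nonneg _ _ _ _ (ht0.trans ht)
          (hrpos t s (ht0.trans ht) (one_pos.trans_le hs.1) _ _ (one_pos.trans_le (hν j).1)) (hx' j)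
    · intro t s ht hs
      obtain ⟨h1, h2⟩ := hs_R_bd X y b c t x (ht0.trans ht) hx
      exact hs_ig_ge _ _ _ _ _ hα hb h1 h2 hs
    · intro ν hν
      have : κν ^ p = ∏ j : Fin p, κν := by simp
      rw [this]
      refine Finset.prod_le_prod (fun _ _ => hκν.le) fun j _ => ?_
      have h1 : 0 < (x j)⁻¹ := inv_pos.2 (hx j)
      have h2 : (x j)⁻¹ ≤ m⁻¹ := inv_anti₀ hm (hmx j)
      exact hs_ig_ge _ _ _ _ _ one_pos one_pos (by linarith) (by linarith) (hν j)
    · intro t ht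
      have h1 := HT πτ t x hπ_nonneg ht hmx
      rw [hκ4_def, div_mul_eq_mul_div]
      exact div_le_div₀ (hT0 t (ht0.trans ht)) h1 hNpos hTle
  · rw [Set.indicator_of_notMem hbx, mul_zero]
    exact main0
end
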